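/- arXiv:2506.09001 — 8 statements merged into one kernel-verified Lean document; each statement's English description precedes it below -/
import Mathlib

section
/- Let λ > 0, β > 0, σ ≥ 0, α > 0, x_* ∈ ℝ, and let f be a classical solution on [0,T] of the superlinear consensus Fokker–Planck equation ∂_t f = λ ∂_x[(x − x_*)(1 + β f^α) f] + (σ²/2) ∂²_{xx}[(x − x_*)² f]. Then the second moment V(t) := ∫_ℝ (x − x_*)² f(x,t) dx satisfies, for every t ∈ [0,T], the identity dV/dt (t) = (σ² − 2λ) V(t) − 2λβ ∫_ℝ (x − x_*)² f(x,t)^{α+1} dx. -/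
open MeasureTheory Set

/-- A classical solution on `[0,T]` of the one-dimensional superlinear consensus
Fokker–Planck equation
`∂_t f = λ ∂_x[(x - x_*)(1 + β f^α) f] + (σ²/2) ∂²_{xx}[(x - x_*)² f]`:
a nonnegative function `f(x,t)`, twice continuously differentiable in `x` and
continuously differentiable in `t`, with `x`-support contained in a fixed compact set
for every `t ∈ [0,T]`, satisfying the equation pointwise. -/
def IsClassicalSolution (lam β σ α xstar T : ℝ) (f : ℝ → ℝ → ℝ) : Prop :=
  (∀ x t, t ∈ Icc (0 : ℝ) T → 0 ≤ f x t) ∧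
  (∃ C : Set ℝ, IsCompact C ∧ ∀ t ∈ Icc (0 : ℝ) T, ∀ x : ℝ, f x t ≠ 0 → x ∈ C) ∧
  (∀ t ∈ Icc (0 : ℝ) T, ContDiff ℝ 2 (fun x => f x t)) ∧
  (∀ x : ℝ, ContDiffOn ℝ 1 (fun t => f x t) (Icc 0 T)) ∧
  (∀ x : ℝ, ∀ t ∈ Icc (0 : ℝ) T,
    derivWithin (fun s => f x s) (Icc 0 T) t =
      lam * deriv (fun y => (y - xstar) * (1 + β * f y t ^ α) * f y t) x +
        σ ^ 2 / 2 * deriv (deriv (fun y => (y - xstar) ^ 2 * f y t)) x)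

section

open Filter Topology intervalIntegral

section CompactSupport

theorem integrable_of_continuous_of_eq_zero {R : ℝ} {h : ℝ → ℝ} (hc : Continuous h)
    (hs : ∀ x, R < |x| → h x = 0) : Integrable h := by
  refine hc.integrable_of_hasCompactSupport
    (HasCompactSupport.intro (isCompact_Icc (a := -R) (b := R)) fun x hx => hs x ?_)
  by_contra hle
  exact hx (abs_le.1 (not_lt.1 hle))

theorem tendsto_integral_of_eq_zero_of_le {R : ℝ} {F : ℕ → ℝ → ℝ} {f h : ℝ → ℝ}
    (hc : Continuous h) (hm : ∀ n, AEStronglyMeasurable (F n)) (hs : ∀ n x, R < |x| → F n x = 0)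
    (hb : ∀ n x, |x| ≤ R → |F n x| ≤ h x) (hl : ∀ x, Tendsto (fun n => F n x) atTop (𝓝 (f x))) :
    Tendsto (fun n => ∫ x, F n x) atTop (𝓝 (∫ x, f x)) := by
  refine tendsto_integral_of_dominated_convergence ((Icc (-R) R).indicator h) hm
    ((integrable_indicator_iff measurableSet_Icc).2 hc.continuousOn.integrableOn_Icc)
    (fun n => ae_of_all _ fun x => ?_) (ae_of_all _ hl)
  by_cases hx : |x| ≤ R
  · rw [indicator_of_mem (show x ∈ Icc (-R) R from abs_le.1 hx)]
    exact hb n x hx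
  · rw [hs n x (not_le.1 hx), indicator_of_notMem (fun h' : x ∈ Icc (-R) R => hx (abs_le.2 h')),
      norm_zero]

/-- A compactly supported function with a bounded derivative satisfies a linear growth bound for
its dilations. -/
theorem exists_abs_sub_le_mul {R : ℝ} {h h' : ℝ → ℝ} (hd : ∀ x, HasDerivAt h (h' x) x)
    (hc : Continuous h') (hs : ∀ x, R < |x| → h' x = 0) :
    ∃ L, 0 ≤ L ∧ ∀ x y, |h x - h y| ≤ L * |x - y| := by
  obtain ⟨L, hL⟩ := hc.bounded_above_of_compact_support
    (HasCompactSupport.intro (isCompact_Icc (a := -R) (b := R)) fun x hx => hs x (by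
      by_contra hle
      exact hx (abs_le.1 (not_lt.1 hle))))
  refine ⟨L, (norm_nonneg _).trans (hL 0), fun x y => ?_⟩
  exact Convex.norm_image_sub_le_of_norm_hasDerivWithin_le
    (fun z _ => (hd z).hasDerivWithinAt) (fun z _ => hL z) convex_univ (mem_univ y) (mem_univ x)

theorem deriv_eq_zero_of_eq_zero {R : ℝ} {h h' : ℝ → ℝ} (hd : ∀ x, HasDerivAt h (h' x) x)
    (hs : ∀ x, R < |x| → h x = 0) (x : ℝ) (hx : R < |x|) : h' x = 0 := by
  refine (hd x).unique ((hasDerivAt_const x (0 : ℝ)).congr_of_eventuallyEq ?_)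
  filter_upwards [(isOpen_lt continuous_const continuous_abs).mem_nhds hx] with y hy using hs y hy

end CompactSupport

section IntegrationByParts

variable {R : ℝ} {φ φ' P P' : ℝ → ℝ}

theorem integral_mul_comp_mul_deriv (hφ : ∀ x, HasDerivAt φ (φ' x) x) (hφ' : Continuous φ')
    (hP : ∀ x, HasDerivAt P (P' x) x) (hP' : Continuous P') (hs : ∀ x, R < |x| → P x = 0)
    {w w' : ℝ → ℝ} (hw : ∀ r, HasDerivAt w (w' r) r) (hw' : Continuous w') (hw0 : w 0 = 0) :
    ∫ x, φ x * (w' (P x) * P' x) = -∫ x, φ' x * w (P x) := by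
  have hφc : Continuous φ := continuous_iff_continuousAt.2 fun x => (hφ x).continuousAt
  have hPc : Continuous P := continuous_iff_continuousAt.2 fun x => (hP x).continuousAt
  have hwc : Continuous w := continuous_iff_continuousAt.2 fun x => (hw x).continuousAt
  have hs' := deriv_eq_zero_of_eq_zero hP hs
  refine integral_mul_deriv_eq_deriv_mul_of_integrable (fun x _ => hφ x)
    (fun x _ => (hw (P x)).comp x (hP x)) ?_ ?_ ?_
  · refine integrable_of_continuous_of_eq_zero (R := R) (by fun_prop) fun x hx => ?_
    simp [hs' x hx]
  · refine integrable_of_continuous_of_eq_zero (R := R) (by fun_prop) fun x hx => ?_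
    simp [hs x hx, hw0]
  · refine integrable_of_continuous_of_eq_zero (R := R) (by fun_prop) fun x hx => ?_
    simp [hs x hx, hw0]

/-- The smooth approximation of the absolute value. -/
noncomputable def smoothAbs (ε r : ℝ) : ℝ := √(r ^ 2 + ε ^ 2) - ε

theorem hasDerivAt_smoothAbs {ε : ℝ} (hε : 0 < ε) (r : ℝ) :
    HasDerivAt (smoothAbs ε) (r / √(r ^ 2 + ε ^ 2)) r := by
  have h : r ^ 2 + ε ^ 2 ≠ 0 := by positivity
  have := ((((hasDerivAt_id r).pow 2).add_const (ε ^ 2)).sqrt h).sub_const ε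
  refine this.congr_deriv ?_
  simp only [id]
  have hs : √(r ^ 2 + ε ^ 2) ≠ 0 := (Real.sqrt_pos.2 (by positivity)).ne'
  simp only [Pi.pow_apply, id, Nat.cast_ofNat, Nat.add_one_sub_one, pow_one, mul_one]
  field_simp

theorem smoothAbs_nonneg (ε r : ℝ) : 0 ≤ smoothAbs ε r := by
  have : ε ≤ √(r ^ 2 + ε ^ 2) := Real.le_sqrt_of_sq_le (by nlinarith [sq_nonneg r])
  unfold smoothAbs
  linarith

theorem smoothAbs_zero {ε : ℝ} (hε : 0 < ε) : smoothAbs ε 0 = 0 := by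
  simp [smoothAbs, Real.sqrt_sq hε.le]

theorem continuous_smoothAbs_deriv {ε : ℝ} (hε : 0 < ε) :
    Continuous fun r : ℝ => r / √(r ^ 2 + ε ^ 2) := by
  refine continuous_id.div (by fun_prop) fun r => ?_
  have : 0 < r ^ 2 + ε ^ 2 := by positivity
  positivity

theorem abs_smoothAbs_deriv_le (ε r : ℝ) : |r / √(r ^ 2 + ε ^ 2)| ≤ 1 := by
  rw [abs_div, abs_of_nonneg (Real.sqrt_nonneg _)]
  refine div_le_one_of_le₀ ?_ (Real.sqrt_nonneg _)
  exact Real.abs_le_sqrt (by nlinarith [sq_nonneg ε])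

theorem tendsto_smoothAbs_deriv (r : ℝ) :
    Tendsto (fun n : ℕ => r / √(r ^ 2 + (1 / ((n : ℝ) + 1)) ^ 2)) atTop (𝓝 (r / |r|)) := by
  rcases eq_or_ne r 0 with rfl | hr
  · simp
  · have h0 := tendsto_one_div_add_atTop_nhds_zero_nat (𝕜 := ℝ)
    have h1 : Tendsto (fun n : ℕ => √(r ^ 2 + (1 / ((n : ℝ) + 1)) ^ 2)) atTop (𝓝 |r|) := by
      have := ((tendsto_const_nhds (x := r ^ 2)).add (h0.pow 2)).sqrt
      simpa [Real.sqrt_sq_eq_abs] using this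
    exact tendsto_const_nhds.div h1 (abs_ne_zero.2 hr)

theorem tendsto_smoothAbs (r : ℝ) :
    Tendsto (fun n : ℕ => smoothAbs (1 / ((n : ℝ) + 1)) r) atTop (𝓝 |r|) := by
  have h0 := tendsto_one_div_add_atTop_nhds_zero_nat (𝕜 := ℝ)
  have := (((tendsto_const_nhds (x := r ^ 2)).add (h0.pow 2)).sqrt).sub h0
  simpa [Real.sqrt_sq_eq_abs, smoothAbs] using this

theorem integral_mul_sign_mul_deriv_nonpos (hφ : ∀ x, HasDerivAt φ (φ' x) x)
    (hφ' : Continuous φ') (hφ'0 : ∀ x, 0 ≤ φ' x)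
    (hP : ∀ x, HasDerivAt P (P' x) x) (hP' : Continuous P') (hs : ∀ x, R < |x| → P x = 0) :
    ∫ x, φ x * (P x / |P x| * P' x) ≤ 0 := by
  have hφc : Continuous φ := continuous_iff_continuousAt.2 fun x => (hφ x).continuousAt
  have hPc : Continuous P := continuous_iff_continuousAt.2 fun x => (hP x).continuousAt
  have hs' := deriv_eq_zero_of_eq_zero hP hs
  have hpos : ∀ n : ℕ, (0 : ℝ) < 1 / ((n : ℝ) + 1) := fun n => by positivity
  refine le_of_tendsto (tendsto_integral_of_eq_zero_of_le (R := R)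
    (F := fun n x => φ x * (P x / √(P x ^ 2 + (1 / ((n : ℝ) + 1)) ^ 2) * P' x))
    (h := fun x => |φ x| * |P' x|) (by fun_prop) ?_ ?_ ?_ ?_) (Eventually.of_forall fun n => ?_)
  · intro n
    exact (hφc.mul (((continuous_smoothAbs_deriv (hpos n)).comp hPc).mul hP')).aestronglyMeasurable
  · intro n x hx
    simp [hs' x hx]
  · intro n x _
    rw [abs_mul, abs_mul]
    exact mul_le_mul_of_nonneg_left
      (mul_le_of_le_one_left (abs_nonneg _) (abs_smoothAbs_deriv_le _ _)) (abs_nonneg _)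
  · intro x
    exact ((tendsto_smoothAbs_deriv (P x)).mul_const _).const_mul _
  · rw [integral_mul_comp_mul_deriv hφ hφ' hP hP' hs (hasDerivAt_smoothAbs (hpos n))
      (continuous_smoothAbs_deriv (hpos n)) (smoothAbs_zero (hpos n))]
    exact neg_nonpos.2 (integral_nonneg fun x =>
      mul_nonneg (hφ'0 x) (smoothAbs_nonneg _ _))

theorem abs_sub_abs_eq_integral_sign_mul {a b : ℝ} (hab : a ≤ b) {r r' : ℝ → ℝ}
    (hr : ContinuousOn r (Icc a b)) (hd : ∀ t ∈ Ioo a b, HasDerivAt r (r' t) t)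
    (hr' : Continuous r') : |r b| - |r a| = ∫ t in a..b, r t / |r t| * r' t := by
  have hpos : ∀ n : ℕ, (0 : ℝ) < 1 / ((n : ℝ) + 1) := fun n => by positivity
  have hcont : ∀ n : ℕ, ContinuousOn
      (fun t => r t / √(r t ^ 2 + (1 / ((n : ℝ) + 1)) ^ 2) * r' t) (Icc a b) := fun n =>
    ((continuous_smoothAbs_deriv (hpos n)).comp_continuousOn hr).mul hr'.continuousOn
  have hint : ∀ n : ℕ, IntervalIntegrable
      (fun t => r t / √(r t ^ 2 + (1 / ((n : ℝ) + 1)) ^ 2) * r' t) volume a b := fun n =>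
    ContinuousOn.intervalIntegrable (by rw [uIcc_of_le hab]; exact hcont n)
  have h1 : Tendsto (fun n : ℕ => ∫ t in a..b, r t / √(r t ^ 2 + (1 / ((n : ℝ) + 1)) ^ 2) * r' t)
      atTop (𝓝 (∫ t in a..b, r t / |r t| * r' t)) := by
    refine tendsto_integral_filter_of_dominated_convergence (fun t => |r' t|)
      (Eventually.of_forall fun n => (hint n).def'.aestronglyMeasurable)
      (Eventually.of_forall fun n => ae_of_all _ fun t _ => ?_)
      (hr'.abs.intervalIntegrable _ _) (ae_of_all _ fun t _ => ?_)
    · rw [Real.norm_eq_abs, abs_mul]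
      exact mul_le_of_le_one_left (abs_nonneg _) (abs_smoothAbs_deriv_le _ _)
    · exact (tendsto_smoothAbs_deriv (r t)).mul_const _
  have h2 := (tendsto_smoothAbs (r b)).sub (tendsto_smoothAbs (r a))
  refine tendsto_nhds_unique h2 (h1.congr fun n => ?_)
  refine integral_eq_sub_of_hasDerivAt_of_le hab (f := fun t => smoothAbs (1 / ((n : ℝ) + 1)) (r t))
    ?_ (fun t ht => (hasDerivAt_smoothAbs (hpos n) (r t)).comp t (hd t ht)) (hint n)
  exact (continuous_iff_continuousAt.2 fun s =>
    (hasDerivAt_smoothAbs (hpos n) s).continuousAt).comp_continuousOn hr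

end IntegrationByParts

/-- Fubini's theorem for a weighted integral whose integrand evolves with a given rate. -/
theorem integral_sub_integral_eq_integral_integral {a b C : ℝ} (hab : a ≤ b) {φ : ℝ → ℝ}
    {y z : ℝ → ℝ → ℝ} (hφ : Measurable φ) (hya : Integrable fun x => φ x * y x a)
    (hyb : Integrable fun x => φ x * y x b) (hy : ∀ x, φ x ≠ 0 → y x b - y x a = ∫ t in a..b, z x t)
    (hzm : Measurable (Function.uncurry z))
    (hzi : ∀ t ∈ Icc a b, Integrable fun x => φ x * z x t)
    (hzC : ∀ t ∈ Icc a b, ∫ x, |φ x * z x t| ≤ C) :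
    (∫ x, φ x * y x b) - ∫ x, φ x * y x a = ∫ t in a..b, ∫ x, φ x * z x t := by
  have hm : Measurable (Function.uncurry fun x t => φ x * z x t) :=
    (hφ.comp measurable_fst).mul hzm
  rw [← integral_sub hyb hya, integral_of_le hab, ← integral_integral_swap]
  · refine integral_congr_ae (ae_of_all _ fun x => ?_)
    by_cases hx : φ x = 0
    · simp [hx]
    · simp only [← mul_sub, hy x hx, integral_of_le hab, MeasureTheory.integral_const_mul]
  · rw [integrable_prod_iff' hm.aestronglyMeasurable]
    have hmem : ∀ᵐ t ∂(volume.restrict (Ioc a b)), t ∈ Icc a b := by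
      filter_upwards [ae_restrict_mem measurableSet_Ioc] with t ht using Ioc_subset_Icc_self ht
    refine ⟨by filter_upwards [hmem] with t ht using hzi t ht, ?_⟩
    refine Integrable.mono' (integrable_const C) ?_ ?_
    · exact (StronglyMeasurable.integral_prod_left (f := fun x t => ‖φ x * z x t‖)
        hm.norm.stronglyMeasurable).aestronglyMeasurable
    · filter_upwards [hmem] with t ht
      rw [Real.norm_of_nonneg (integral_nonneg fun x => norm_nonneg _)]
      exact hzC t ht

section Weight

/-- A `C¹` weight supported in `[δ, ∞)`. -/
noncomputable def weight (δ x : ℝ) : ℝ := max (x - δ) 0 ^ 2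

theorem weight_nonneg (δ x : ℝ) : 0 ≤ weight δ x := sq_nonneg _

theorem weight_eq_zero {δ x : ℝ} (h : x ≤ δ) : weight δ x = 0 := by
  simp [weight, max_eq_right (sub_nonpos.2 h)]

theorem weight_pos {δ x : ℝ} (h : δ < x) : 0 < weight δ x := by
  rw [weight, max_eq_left (sub_pos.2 h).le]
  exact pow_pos (sub_pos.2 h) 2

theorem weight_mono (δ : ℝ) : Monotone (weight δ) := fun x y hxy =>
  pow_le_pow_left₀ (le_max_right _ _) (max_le_max_right _ (by linarith)) 2

theorem continuous_weight (δ : ℝ) : Continuous (weight δ) := by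
  unfold weight
  fun_prop

theorem hasDerivAt_weight (δ x : ℝ) : HasDerivAt (weight δ) (2 * max (x - δ) 0) x := by
  have hsq : HasDerivAt (fun y => (y - δ) ^ 2) (2 * (x - δ)) x := by
    simpa using ((hasDerivAt_id x).sub_const δ).fun_pow 2
  rcases lt_trichotomy x δ with h | h | h
  · rw [max_eq_right (by linarith), mul_zero]
    refine (hasDerivAt_const x (0 : ℝ)).congr_of_eventuallyEq ?_
    filter_upwards [Iio_mem_nhds h] with y hy using weight_eq_zero (le_of_lt hy)
  · subst h
    have h0 : HasDerivAt (fun y => (y - x) ^ 2) 0 x := by simpa using hsq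
    rw [sub_self, max_self, mul_zero]
    rw [hasDerivAt_iff_isLittleO] at h0 ⊢
    refine Asymptotics.IsBigO.trans_isLittleO (Asymptotics.IsBigO.of_bound 1 ?_) h0
    refine Eventually.of_forall fun y => ?_
    have h1 : max (y - x) 0 ^ 2 ≤ (y - x) ^ 2 := by
      rcases le_total (y - x) 0 with h | h
      · rw [max_eq_right h]
        simpa using sq_nonneg (y - x)
      · rw [max_eq_left h]
    simpa [weight, abs_of_nonneg, sq_nonneg] using h1
  · rw [max_eq_left (by linarith)]
    refine hsq.congr_of_eventuallyEq ?_
    filter_upwards [Ioi_mem_nhds h] with y hy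
    rw [weight, max_eq_left (sub_nonneg.2 (le_of_lt hy))]

theorem continuous_weight_deriv (δ : ℝ) : Continuous fun x : ℝ => 2 * max (x - δ) 0 := by
  fun_prop

end Weight

section Entropy

/-- A bump function supported in `[n, n + 1]`. -/
noncomputable def tent (n q : ℝ) : ℝ := max 0 (min (q - n) (n + 1 - q))

theorem tent_nonneg (n q : ℝ) : 0 ≤ tent n q := le_max_left _ _

theorem tent_le_one (n q : ℝ) : tent n q ≤ 1 := by
  refine max_le zero_le_one ?_
  rcases le_total q (n + 1) with h | h
  · exact (min_le_left _ _).trans (by linarith)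
  · exact (min_le_right _ _).trans (by linarith)

theorem tent_eq_zero_of_le {n q : ℝ} (h : q ≤ n) : tent n q = 0 :=
  max_eq_left ((min_le_left _ _).trans (by linarith))

theorem tent_eq_zero_of_ge {n q : ℝ} (h : n + 1 ≤ q) : tent n q = 0 :=
  max_eq_left ((min_le_right _ _).trans (by linarith))

theorem tent_pos {n q : ℝ} (h : n < q) (h' : q < n + 1) : 0 < tent n q :=
  lt_max_of_lt_right (lt_min (by linarith) (by linarith))

theorem continuous_tent (n : ℝ) : Continuous (tent n) := by
  unfold tent
  fun_prop

/-- The entropy density detecting the part of the flux `x * u r` exceeding `n`. -/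
noncomputable def entropy (u : ℝ → ℝ) (n x r : ℝ) : ℝ := ∫ s in (0 : ℝ)..r, tent n (x * u s)

variable {u : ℝ → ℝ} {n x r : ℝ}

theorem hasDerivAt_entropy (hu : Continuous u) (n x r : ℝ) :
    HasDerivAt (entropy u n x) (tent n (x * u r)) r := by
  have hc : Continuous fun s => tent n (x * u s) :=
    (continuous_tent n).comp (continuous_const.mul hu)
  exact integral_hasDerivAt_right (hc.intervalIntegrable _ _)
    (hc.stronglyMeasurableAtFilter _ _) hc.continuousAt

theorem continuous_entropy (hu : Continuous u) (n : ℝ) {v : ℝ → ℝ} (hv : Continuous v) :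
    Continuous fun x => entropy u n x (v x) := by
  refine continuous_parametric_intervalIntegral_of_continuous
    (f := fun x s => tent n (x * u s)) ?_ hv
  exact (continuous_tent n).comp (continuous_fst.mul (hu.comp continuous_snd))

theorem entropy_nonneg (hr : 0 ≤ r) : 0 ≤ entropy u n x r :=
  integral_nonneg hr fun _ _ => tent_nonneg _ _

theorem entropy_zero : entropy u n x 0 = 0 := integral_same

theorem entropy_le (hu : Continuous u) (hle : ∀ s, 0 ≤ s → s ≤ u s) {δ : ℝ} (hδ : 0 < δ)
    (hn : 0 ≤ n) (hx : δ < x) (hr : 0 ≤ r) : entropy u n x r ≤ (n + 1) / δ := by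
  have hc : Continuous fun s => tent n (x * u s) :=
    (continuous_tent n).comp (continuous_const.mul hu)
  have hA : 0 ≤ (n + 1) / δ := by positivity
  have hbound : ∀ a, 0 ≤ a → a ≤ (n + 1) / δ → entropy u n x a ≤ (n + 1) / δ := by
    intro a ha haA
    refine le_trans ?_ haA
    calc entropy u n x a ≤ ∫ _ in (0 : ℝ)..a, (1 : ℝ) :=
          integral_mono_on ha (hc.intervalIntegrable _ _) (by simp) fun s _ => tent_le_one _ _
      _ = a := by simp
  rcases le_total r ((n + 1) / δ) with h | h
  · exact hbound r hr h
  · rw [entropy, ← integral_add_adjacent_intervals (hc.intervalIntegrable 0 ((n + 1) / δ))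
      (hc.intervalIntegrable _ r)]
    have h0 : ∫ s in ((n + 1) / δ)..r, tent n (x * u s) = 0 := by
      rw [integral_congr (g := fun _ => (0 : ℝ)), intervalIntegral.integral_zero]
      intro s hs
      rw [uIcc_of_le h] at hs
      refine tent_eq_zero_of_ge ?_
      have hs1 : n + 1 ≤ s * δ := (div_le_iff₀ hδ).1 hs.1
      have hs0 : 0 ≤ s := hA.trans hs.1
      have := hle s hs0
      nlinarith
    rw [h0, add_zero]
    exact hbound _ hA le_rfl

theorem entropy_eq_zero_of_le (hmono : StrictMonoOn u (Ici 0)) (hx : 0 ≤ x) (hr : 0 ≤ r)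
    (h : x * u r ≤ n) : entropy u n x r = 0 := by
  rw [entropy, integral_congr (g := fun _ => (0 : ℝ)), intervalIntegral.integral_zero]
  intro s hs
  rw [uIcc_of_le hr] at hs
  exact tent_eq_zero_of_le
    ((mul_le_mul_of_nonneg_left (hmono.monotoneOn hs.1 hr hs.2) hx).trans h)

theorem le_of_entropy_eq_zero (hu : Continuous u) (hu0 : u 0 = 0) (hn : 0 ≤ n) (hr : 0 ≤ r)
    (h : entropy u n x r = 0) : x * u r ≤ n := by
  by_contra! hlt
  have hc : Continuous fun s => x * u s := continuous_const.mul hu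
  have hmem : min (x * u r) (n + 1 / 2) ∈ Icc (x * u 0) (x * u r) := by
    refine ⟨?_, min_le_left _ _⟩
    rw [hu0, mul_zero]
    exact le_min (hn.trans hlt.le) (by linarith)
  obtain ⟨s, hs, hsq⟩ := intermediate_value_Icc hr hc.continuousOn hmem
  have hpos : 0 < tent n (x * u s) := by
    simp only at hsq
    rw [hsq]
    exact tent_pos (lt_min hlt (by linarith)) ((min_le_right _ _).trans_lt (by linarith))
  have hr0 : 0 < r := by
    rcases hr.eq_or_lt with rfl | h'
    · simp [hu0] at hlt
      linarith
    · exact h'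
  refine (intervalIntegral.integral_pos hr0 ((continuous_tent n).comp hc).continuousOn
    (fun _ _ => tent_nonneg _ _) ⟨s, hs, hpos⟩).ne' h

end Entropy

end

section

open Filter Topology

section Transport

/-- Regular compactly supported solutions of `∂ₜ f = lam * ∂ₓ (x * u f)` on `[0, T]`, with separate
regularity in space and time; `p` and `g` are the space and time derivatives of `f`. -/
structure IsTransport (lam R T : ℝ) (u u' : ℝ → ℝ) (f p g : ℝ → ℝ → ℝ) : Prop where
  lam_pos : 0 < lam
  u_deriv : ∀ r, HasDerivAt u (u' r) r
  continuous_u' : Continuous u'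
  u_zero : u 0 = 0
  le_u : ∀ r, 0 ≤ r → r ≤ u r
  u_mono : StrictMonoOn u (Ici 0)
  nonneg : ∀ x t, 0 ≤ f x t
  supp : ∀ x t, R < |x| → f x t = 0
  deriv_x : ∀ x t, HasDerivAt (fun y => f y t) (p x t) x
  continuous_p : ∀ t, Continuous fun x => p x t
  continuous_t : ∀ x, Continuous fun t => f x t
  continuous_g_t : ∀ x, Continuous fun t => g x t
  g_eq : ∀ x t, g x t = lam * (u (f x t) + x * (u' (f x t) * p x t))
  deriv_t : ∀ x, ∀ t ∈ Ioo 0 T, HasDerivAt (fun s => f x s) (g x t) t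

/-- The weighted `L¹` distance between `f` and its dilation by `k`. -/
noncomputable def dilDiff (f : ℝ → ℝ → ℝ) (δ k t : ℝ) : ℝ :=
  ∫ x, weight δ x * |f (k * x) t - f x t|

/-- Quantitative bounds on the flux and on the dilations of `f` at time `t`. -/
def IsGood (u : ℝ → ℝ) (f : ℝ → ℝ → ℝ) (δ n t : ℝ) : Prop :=
  (∀ x, δ < x → x * u (f x t) ≤ n) ∧ ∀ k, 1 < k → k ≤ 2 → dilDiff f δ k t ≤ n * (k - 1)

namespace IsTransport

variable {lam R T : ℝ} {u u' : ℝ → ℝ} {f p g : ℝ → ℝ → ℝ} {δ n t : ℝ}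

theorem continuous_u (H : IsTransport lam R T u u' f p g) : Continuous u :=
  continuous_iff_continuousAt.2 fun r => (H.u_deriv r).continuousAt

theorem continuous_x (H : IsTransport lam R T u u' f p g) (t : ℝ) : Continuous fun x => f x t :=
  continuous_iff_continuousAt.2 fun x => (H.deriv_x x t).continuousAt

theorem p_eq_zero (H : IsTransport lam R T u u' f p g) {x t : ℝ} (hx : R < |x|) : p x t = 0 :=
  deriv_eq_zero_of_eq_zero (fun y => H.deriv_x y t) (fun y => H.supp y t) x hx

theorem continuous_g_x (H : IsTransport lam R T u u' f p g) (t : ℝ) :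
    Continuous fun x => g x t := by
  simp only [H.g_eq]
  have := H.continuous_x t
  have := H.continuous_u
  have := H.continuous_u'
  have := H.continuous_p t
  fun_prop

theorem g_eq_zero (H : IsTransport lam R T u u' f p g) {x t : ℝ} (hx : R < |x|) : g x t = 0 := by
  simp [H.g_eq, H.supp x t hx, H.p_eq_zero hx, H.u_zero]

theorem measurable_f (H : IsTransport lam R T u u' f p g) : Measurable (Function.uncurry f) :=
  (measurable_uncurry_of_continuous_of_measurable (u := fun t x => f x t) H.continuous_t
    fun t => (H.continuous_x t).measurable).comp measurable_swap

theorem measurable_g (H : IsTransport lam R T u u' f p g) : Measurable (Function.uncurry g) :=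
  (measurable_uncurry_of_continuous_of_measurable (u := fun t x => g x t) H.continuous_g_t
    fun t => (H.continuous_g_x t).measurable).comp measurable_swap

theorem u_nonneg (H : IsTransport lam R T u u' f p g) (x t : ℝ) : 0 ≤ u (f x t) :=
  (H.nonneg x t).trans (H.le_u _ (H.nonneg x t))

theorem le_div (H : IsTransport lam R T u u' f p g) (hδ : 0 < δ) {x : ℝ} (hx : δ < x)
    (h : x * u (f x t) ≤ n) : f x t ≤ n / δ := by
  rw [le_div_iff₀ hδ]
  have h1 := H.le_u _ (H.nonneg x t)
  have h2 := H.nonneg x t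
  nlinarith

theorem u_le_div (H : IsTransport lam R T u u' f p g) (hδ : 0 < δ) {x : ℝ} (hx : δ < x)
    (h : x * u (f x t) ≤ n) : u (f x t) ≤ n / δ := by
  rw [le_div_iff₀ hδ]
  have h2 := H.u_nonneg x t
  nlinarith

theorem lt_abs_mul {k x : ℝ} (hk : 1 ≤ k) (hx : R < |x|) : R < |k * x| := by
  rw [abs_mul, abs_of_nonneg (by linarith : (0 : ℝ) ≤ k)]
  nlinarith [abs_nonneg x]

theorem exists_lipschitz (H : IsTransport lam R T u u' f p g) (t : ℝ) :
    ∃ L, 0 ≤ L ∧ ∀ x y, |f x t - f y t| ≤ L * |x - y| :=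
  exists_abs_sub_le_mul (fun x => H.deriv_x x t) (H.continuous_p t) fun _ hx => H.p_eq_zero hx

/-- Every time is good at some level. -/
theorem exists_isGood (H : IsTransport lam R T u u' f p g) (δ t : ℝ) :
    ∃ n : ℕ, IsGood u f δ n t := by
  have hfc := H.continuous_x t
  have huc := H.continuous_u
  obtain ⟨A, hA⟩ :=
    (show Continuous fun x => x * u (f x t) by fun_prop).bounded_above_of_compact_support
    (HasCompactSupport.intro (isCompact_Icc (a := -R) (b := R)) fun x hx => by
      rw [H.supp x t (lt_of_not_ge fun h => hx (abs_le.1 h)), H.u_zero, mul_zero])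
  obtain ⟨L, hL0, hL⟩ := H.exists_lipschitz t
  have hw := continuous_weight δ
  set B : ℝ := ∫ x in Icc (-R) R, weight δ x * (L * |x|) with hB
  obtain ⟨n, hn⟩ := exists_nat_ge (max A B)
  refine ⟨n, fun x _ => (le_abs_self _).trans ((hA x).trans ((le_max_left _ _).trans hn)),
    fun k hk _ => ?_⟩
  have hle : dilDiff f δ k t ≤ ∫ x in Icc (-R) R, weight δ x * (L * |x|) * (k - 1) := by
    rw [dilDiff, ← integral_indicator measurableSet_Icc]
    refine integral_mono_of_nonneg (ae_of_all _ fun x => mul_nonneg (weight_nonneg _ _)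
      (abs_nonneg _)) ((integrable_indicator_iff measurableSet_Icc).2
      (Continuous.integrableOn_Icc (by fun_prop))) (ae_of_all _ fun x => ?_)
    by_cases hx : x ∈ Icc (-R) R
    · rw [indicator_of_mem hx]
      have := hL (k * x) x
      rw [show k * x - x = x * (k - 1) by ring, abs_mul, abs_of_pos (sub_pos.2 hk)] at this
      calc weight δ x * |f (k * x) t - f x t| ≤ weight δ x * (L * (|x| * (k - 1))) :=
            mul_le_mul_of_nonneg_left this (weight_nonneg _ _)
        _ = _ := by ring
    · have hx' : R < |x| := lt_of_not_ge fun h => hx (abs_le.1 h)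
      simp [indicator_of_notMem hx, H.supp x t hx', H.supp _ t (lt_abs_mul hk.le hx')]
  rw [MeasureTheory.integral_mul_const, ← hB] at hle
  exact hle.trans (mul_le_mul_of_nonneg_right ((le_max_right _ _).trans hn) (by linarith))

theorem integral_weight_mul_abs_le (H : IsTransport lam R T u u' f p g)
    (hg : IsGood u f δ n t) : ∫ x, weight δ x * |x * p x t| ≤ n := by
  obtain ⟨L, hL0, hL⟩ := H.exists_lipschitz t
  have hfc := H.continuous_x t
  have hw := continuous_weight δ
  have hpos : ∀ j : ℕ, (0 : ℝ) < 1 / ((j : ℝ) + 1) := fun j => by positivity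
  have hle1 : ∀ j : ℕ, 1 / ((j : ℝ) + 1) ≤ 1 := fun j =>
    div_le_one_of_le₀ (by simp) (by positivity)
  refine le_of_tendsto (tendsto_integral_of_eq_zero_of_le (R := R)
    (F := fun j x => (1 / ((j : ℝ) + 1))⁻¹ *
      (weight δ x * |f ((1 + 1 / ((j : ℝ) + 1)) * x) t - f x t|))
    (h := fun x => weight δ x * (L * |x|)) (by fun_prop) ?_ ?_ ?_ ?_)
    (Eventually.of_forall fun j => ?_)
  · intro j
    exact (by fun_prop : Continuous _).aestronglyMeasurable
  · intro j x hx
    have hk : 1 ≤ 1 + 1 / ((j : ℝ) + 1) := by linarith [hpos j]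
    rw [H.supp x t hx, H.supp _ t (lt_abs_mul hk hx)]
    simp
  · intro j x _
    have := hL ((1 + 1 / ((j : ℝ) + 1)) * x) x
    rw [show (1 + 1 / ((j : ℝ) + 1)) * x - x = 1 / ((j : ℝ) + 1) * x by ring, abs_mul,
      abs_of_pos (hpos j)] at this
    rw [abs_of_nonneg (mul_nonneg (inv_nonneg.2 (hpos j).le)
      (mul_nonneg (weight_nonneg _ _) (abs_nonneg _))), inv_mul_le_iff₀ (hpos j)]
    calc _ ≤ weight δ x * (L * (1 / ((j : ℝ) + 1) * |x|)) :=
          mul_le_mul_of_nonneg_left this (weight_nonneg _ _)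
      _ = _ := by ring
  · intro x
    have hd : HasDerivAt (fun ε => f ((1 + ε) * x) t) (p x t * x) 0 := by
      have h1 : HasDerivAt (fun ε : ℝ => (1 + ε) * x) x 0 := by
        simpa using ((hasDerivAt_id (0 : ℝ)).const_add 1).mul_const x
      have h2 := H.deriv_x ((1 + 0) * x) t
      simpa [Function.comp_def] using h2.comp (0 : ℝ) h1
    have h0 : Tendsto (fun j : ℕ => 1 / ((j : ℝ) + 1)) atTop (𝓝[≠] 0) :=
      tendsto_nhdsWithin_iff.2 ⟨tendsto_one_div_add_atTop_nhds_zero_nat,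
        Eventually.of_forall fun j => (hpos j).ne'⟩
    have := ((hd.tendsto_slope_zero.comp h0).abs).const_mul (weight δ x)
    rw [mul_comm x]
    refine this.congr fun j => ?_
    simp only [Function.comp, smul_eq_mul, abs_mul, zero_add, add_zero, one_mul,
      abs_of_pos (inv_pos.2 (hpos j))]
    ring
  · rw [MeasureTheory.integral_const_mul, inv_mul_le_iff₀ (hpos j), mul_comm]
    refine (hg.2 _ (by linarith [hpos j]) (by linarith [hle1 j])).trans_eq ?_
    ring

theorem exists_integral_abs_le (H : IsTransport lam R T u u' f p g) (hδ : 0 < δ) (n : ℝ) :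
    ∃ C, ∀ t, IsGood u f δ n t → ∫ x, |weight δ x * g x t| ≤ C := by
  obtain ⟨B, hB⟩ := (isCompact_Icc (a := (0 : ℝ)) (b := n / δ)).exists_bound_of_continuousOn
    H.continuous_u'.continuousOn
  have hw := continuous_weight δ
  set A := ∫ x in Icc (-R) R, weight δ x * (lam * (n / δ))
  refine ⟨A + lam * |B| * n, fun t hg => ?_⟩
  have hfc := H.continuous_x t
  have hpc := H.continuous_p t
  have hi1 : Integrable ((Icc (-R) R).indicator fun x => weight δ x * (lam * (n / δ))) :=
    (integrable_indicator_iff measurableSet_Icc).2 (Continuous.integrableOn_Icc (by fun_prop))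
  have hi2 : Integrable fun x => lam * |B| * (weight δ x * |x * p x t|) :=
    (integrable_of_continuous_of_eq_zero (R := R) (by fun_prop) fun x hx => by
      simp [H.p_eq_zero hx]).const_mul _
  calc ∫ x, |weight δ x * g x t|
      ≤ ∫ x, ((Icc (-R) R).indicator (fun x => weight δ x * (lam * (n / δ))) x +
          lam * |B| * (weight δ x * |x * p x t|)) := by
        refine integral_mono_of_nonneg (ae_of_all _ fun x => abs_nonneg _) (hi1.add hi2)
          (ae_of_all _ fun x => ?_)
        by_cases hx : x ∈ Icc (-R) R
        · simp only [indicator_of_mem hx]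
          rw [abs_mul, abs_of_nonneg (weight_nonneg _ _)]
          rcases le_or_gt x δ with hxδ | hxδ
          · simp [weight_eq_zero hxδ]
          · have h1 := H.u_le_div hδ hxδ (hg.1 x hxδ)
            have h2 : |u' (f x t)| ≤ |B| :=
              (hB _ ⟨H.nonneg x t, H.le_div hδ hxδ (hg.1 x hxδ)⟩).trans (le_abs_self B)
            have h3 : |g x t| ≤ lam * (n / δ) + lam * |B| * |x * p x t| := by
              rw [H.g_eq, abs_mul, abs_of_pos H.lam_pos, mul_assoc, ← mul_add]
              refine mul_le_mul_of_nonneg_left ((abs_add_le _ _).trans (add_le_add ?_ ?_))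
                H.lam_pos.le
              · rwa [abs_of_nonneg (H.u_nonneg x t)]
              · rw [mul_left_comm, abs_mul]
                exact mul_le_mul_of_nonneg_right h2 (abs_nonneg _)
            calc _ ≤ weight δ x * (lam * (n / δ) + lam * |B| * |x * p x t|) :=
                  mul_le_mul_of_nonneg_left h3 (weight_nonneg _ _)
              _ = _ := by ring
        · have hx' : R < |x| := lt_of_not_ge fun h => hx (abs_le.1 h)
          simp [indicator_of_notMem hx, H.g_eq_zero hx', H.p_eq_zero hx']
    _ = A + lam * |B| * ∫ x, weight δ x * |x * p x t| := by
        rw [integral_add hi1 hi2, integral_indicator measurableSet_Icc,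
          MeasureTheory.integral_const_mul]
    _ ≤ _ := by
        have := mul_le_mul_of_nonneg_left (H.integral_weight_mul_abs_le hg)
          (mul_nonneg H.lam_pos.le (abs_nonneg B))
        linarith

/-- Convergence of the dilation differences under a uniform flux bound. -/
theorem tendsto_dilDiff (H : IsTransport lam R T u u' f p g) (hδ : 0 < δ) {s : ℕ → ℝ}
    (hs : Tendsto s atTop (𝓝 t)) (hb : ∀ j, ∀ x, δ < x → x * u (f x (s j)) ≤ n) {k : ℝ}
    (hk : 1 ≤ k) : Tendsto (fun j => dilDiff f δ k (s j)) atTop (𝓝 (dilDiff f δ k t)) := by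
  have hw := continuous_weight δ
  refine tendsto_integral_of_eq_zero_of_le (R := R)
    (h := fun x => weight δ x * (n / δ)) (by fun_prop) ?_ ?_ ?_ ?_
  · intro j
    have := H.continuous_x (s j)
    exact (by fun_prop : Continuous _).aestronglyMeasurable
  · intro j x hx
    simp [H.supp x _ hx, H.supp _ _ (lt_abs_mul hk hx)]
  · intro j x _
    rw [abs_mul, abs_abs, abs_of_nonneg (weight_nonneg _ _)]
    rcases le_or_gt x δ with hx | hx
    · simp [weight_eq_zero hx]
    · refine mul_le_mul_of_nonneg_left (abs_sub_le_of_nonneg_of_le (H.nonneg _ _) ?_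
        (H.nonneg _ _) ?_) (weight_nonneg _ _)
      · have hkx : δ < k * x := by nlinarith
        exact H.le_div hδ hkx (hb j _ hkx)
      · exact H.le_div hδ hx (hb j x hx)
  · intro x
    exact ((((H.continuous_t (k * x)).tendsto t).comp hs).sub
      (((H.continuous_t x).tendsto t).comp hs)).abs.const_mul _

theorem isClosed_setOf_isGood (H : IsTransport lam R T u u' f p g) (hδ : 0 < δ) (n : ℝ) :
    IsClosed {t | IsGood u f δ n t} := by
  refine isSeqClosed_iff_isClosed.1 fun s t hs hst => ⟨fun x hx => ?_, fun k hk hk2 => ?_⟩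
  · refine le_of_tendsto
      ((((H.continuous_u.comp (H.continuous_t x)).tendsto t).comp hst).const_mul x)
      (Eventually.of_forall fun j => (hs j).1 x hx)
  · exact le_of_tendsto (H.tendsto_dilDiff hδ hst (fun j => (hs j).1) hk.le)
      (Eventually.of_forall fun j => (hs j).2 k hk hk2)

end IsTransport

end Transport

section Evolution

namespace IsTransport

variable {lam R T : ℝ} {u u' : ℝ → ℝ} {f p g : ℝ → ℝ → ℝ} {δ n m a b : ℝ}

theorem sub_eq_integral (H : IsTransport lam R T u u' f p g) (ha : 0 ≤ a) (hab : a ≤ b)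
    (hb : b ≤ T) (x : ℝ) : f x b - f x a = ∫ t in a..b, g x t :=
  (intervalIntegral.integral_eq_sub_of_hasDerivAt_of_le hab (H.continuous_t x).continuousOn
    (fun t ht => H.deriv_t x t ⟨ha.trans_lt ht.1, ht.2.trans_le hb⟩)
    ((H.continuous_g_t x).intervalIntegrable _ _)).symm

theorem hasDerivAt_flux (H : IsTransport lam R T u u' f p g) (t x : ℝ) :
    HasDerivAt (fun y => y * u (f y t)) (u (f x t) + x * (u' (f x t) * p x t)) x := by
  simpa [Function.comp_def] using
    (hasDerivAt_id x).fun_mul ((H.u_deriv (f x t)).comp x (H.deriv_x x t))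

theorem continuous_flux_deriv (H : IsTransport lam R T u u' f p g) (t : ℝ) :
    Continuous fun x => u (f x t) + x * (u' (f x t) * p x t) := by
  have := H.continuous_x t
  have := H.continuous_u
  have := H.continuous_u'
  have := H.continuous_p t
  fun_prop

theorem flux_eq_zero (H : IsTransport lam R T u u' f p g) (t x : ℝ) (hx : R < |x|) :
    x * u (f x t) = 0 := by
  rw [H.supp x t hx, H.u_zero, mul_zero]

theorem integral_weight_sub (H : IsTransport lam R T u u' f p g) (hδ : 0 < δ) (ha : 0 ≤ a)
    (hab : a ≤ b) (hb : b ≤ T) (hgood : ∀ t ∈ Icc a b, IsGood u f δ m t) :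
    (∫ x, weight δ x * f x b) - ∫ x, weight δ x * f x a =
      ∫ t in a..b, -lam * ∫ x, 2 * max (x - δ) 0 * (x * u (f x t)) := by
  obtain ⟨C, hC⟩ := H.exists_integral_abs_le hδ m
  have hw := continuous_weight δ
  have hint : ∀ t, Integrable fun x => weight δ x * f x t := fun t => by
    have := H.continuous_x t
    exact integrable_of_continuous_of_eq_zero (R := R) (by fun_prop) fun x hx => by
      simp [H.supp x t hx]
  rw [integral_sub_integral_eq_integral_integral (z := g) (C := C) hab hw.measurable (hint a)
    (hint b) (fun x _ => H.sub_eq_integral ha hab hb x) H.measurable_g (fun t _ => ?_)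
    fun t ht => hC t (hgood t ht)]
  · refine intervalIntegral.integral_congr fun t _ => ?_
    have h := integral_mul_comp_mul_deriv (w := id) (w' := fun _ => 1) (hasDerivAt_weight δ)
      (continuous_weight_deriv δ) (H.hasDerivAt_flux t) (H.continuous_flux_deriv t)
      (H.flux_eq_zero t) hasDerivAt_id continuous_const rfl
    simp only [one_mul, id] at h
    rw [neg_mul, ← mul_neg, ← h, ← integral_const_mul]
    refine integral_congr_ae (ae_of_all _ fun x => ?_)
    simp only [H.g_eq]
    ring
  · have := H.continuous_g_x t
    exact integrable_of_continuous_of_eq_zero (R := R) (by fun_prop) fun x hx => by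
      simp [H.g_eq_zero hx]

/-- The part of the flux above `n` does not increase. -/
theorem integral_entropy_le (H : IsTransport lam R T u u' f p g) (hδ : 0 < δ) (ha : 0 ≤ a)
    (hab : a ≤ b) (hb : b ≤ T) (hgood : ∀ t ∈ Icc a b, IsGood u f δ m t) :
    ∫ x, weight δ x * entropy u n x (f x b) ≤ ∫ x, weight δ x * entropy u n x (f x a) := by
  obtain ⟨C, hC⟩ := H.exists_integral_abs_le hδ m
  have hw := continuous_weight δ
  have huc := H.continuous_u
  have htc := continuous_tent n
  have hint : ∀ t, Integrable fun x => weight δ x * entropy u n x (f x t) := fun t =>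
    integrable_of_continuous_of_eq_zero (R := R)
      (hw.mul (continuous_entropy huc n (H.continuous_x t))) fun x hx => by
        rw [H.supp x t hx, entropy_zero, mul_zero]
  have hcg : ∀ t, Continuous fun x => weight δ x * g x t := fun t => hw.mul (H.continuous_g_x t)
  have hci : ∀ t, Continuous fun x => weight δ x * (tent n (x * u (f x t)) * g x t) := fun t => by
    have := H.continuous_x t
    have := H.continuous_g_x t
    fun_prop
  have hzi : ∀ t, Integrable fun x => weight δ x * (tent n (x * u (f x t)) * g x t) := fun t =>
    integrable_of_continuous_of_eq_zero (R := R) (hci t) fun x hx => by simp [H.g_eq_zero hx]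
  refine sub_nonpos.1 ?_
  rw [integral_sub_integral_eq_integral_integral (C := C)
    (y := fun x t => entropy u n x (f x t)) (z := fun x t => tent n (x * u (f x t)) * g x t)
    hab hw.measurable (hint a) (hint b) ?_ ?_ (fun t _ => hzi t) fun t ht => ?_]
  · rw [← neg_nonneg, ← intervalIntegral.integral_neg]
    refine intervalIntegral.integral_nonneg hab fun t _ => ?_
    have hG : ∀ r, HasDerivAt (fun q => ∫ s in (0 : ℝ)..q, tent n s) (tent n r) r := fun r =>
      intervalIntegral.integral_hasDerivAt_right (htc.intervalIntegrable _ _)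
        (htc.stronglyMeasurableAtFilter _ _) htc.continuousAt
    have h := integral_mul_comp_mul_deriv (hasDerivAt_weight δ)
      (continuous_weight_deriv δ) (H.hasDerivAt_flux t) (H.continuous_flux_deriv t)
      (H.flux_eq_zero t) hG htc (by simp)
    have h' : ∫ x, weight δ x * (tent n (x * u (f x t)) * g x t) =
        lam * -∫ x, 2 * max (x - δ) 0 * ∫ s in (0 : ℝ)..(x * u (f x t)), tent n s := by
      rw [← h, ← integral_const_mul]
      refine integral_congr_ae (ae_of_all _ fun x => ?_)
      simp only [H.g_eq]
      ring
    rw [h', mul_neg, neg_neg]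
    refine mul_nonneg H.lam_pos.le (integral_nonneg fun x => ?_)
    rcases le_or_gt x δ with hx | hx
    · simp [max_eq_right (sub_nonpos.2 hx)]
    · exact mul_nonneg (by positivity) (intervalIntegral.integral_nonneg
        (mul_nonneg (hδ.trans hx).le (H.u_nonneg x t)) fun _ _ => tent_nonneg _ _)
  · intro x _
    refine (intervalIntegral.integral_eq_sub_of_hasDerivAt_of_le hab
      (f := fun t => entropy u n x (f x t)) ?_ (fun t ht => ?_) ?_).symm
    · exact (continuous_iff_continuousAt.2 fun r =>
        (hasDerivAt_entropy huc n x r).continuousAt).comp_continuousOn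
          (H.continuous_t x).continuousOn
    · exact (hasDerivAt_entropy huc n x (f x t)).comp t
        (H.deriv_t x t ⟨ha.trans_lt ht.1, ht.2.trans_le hb⟩)
    · have := H.continuous_t x
      have := H.continuous_g_t x
      exact Continuous.intervalIntegrable (by fun_prop) _ _
  · exact (htc.measurable.comp (measurable_fst.mul (huc.measurable.comp H.measurable_f))).mul
      H.measurable_g
  · refine (integral_mono_of_nonneg (ae_of_all _ fun x => abs_nonneg _)
      (integrable_of_continuous_of_eq_zero (R := R) (hcg t).abs fun x hx => by
        simp [H.g_eq_zero hx]) (ae_of_all _ fun x => ?_)).trans (hC t (hgood t ht))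
    simp only [abs_mul, abs_of_nonneg (tent_nonneg _ _)]
    exact mul_le_mul_of_nonneg_left (mul_le_of_le_one_left (abs_nonneg _) (tent_le_one _ _))
      (abs_nonneg _)

theorem sign_flux_sub (H : IsTransport lam R T u u' f p g) {x r s : ℝ} (hx : 0 < x)
    (hr : 0 ≤ r) (hs : 0 ≤ s) :
    x * (u r - u s) / |x * (u r - u s)| = (r - s) / |r - s| := by
  rcases lt_trichotomy r s with h | rfl | h
  · have h1 := H.u_mono hr hs h
    rw [abs_of_neg (mul_neg_of_pos_of_neg hx (sub_neg.2 h1)), abs_of_neg (sub_neg.2 h),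
      div_neg, div_neg, div_self (sub_neg.2 h).ne,
      div_self (mul_neg_of_pos_of_neg hx (sub_neg.2 h1)).ne]
  · simp
  · have h1 := H.u_mono hs hr h
    rw [abs_of_pos (mul_pos hx (sub_pos.2 h1)), abs_of_pos (sub_pos.2 h),
      div_self (sub_pos.2 h).ne', div_self (mul_pos hx (sub_pos.2 h1)).ne']

/-- Solutions contract the weighted distance to their dilations. -/
theorem dilDiff_le (H : IsTransport lam R T u u' f p g) (hδ : 0 < δ)
    (ha : 0 ≤ a) (hab : a ≤ b) (hb : b ≤ T) (hgood : ∀ t ∈ Icc a b, IsGood u f δ m t)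
    {k : ℝ} (hk : 1 ≤ k) : dilDiff f δ k b ≤ dilDiff f δ k a := by
  obtain ⟨C, hC⟩ := H.exists_integral_abs_le hδ m
  have hw := continuous_weight δ
  have huc := H.continuous_u
  have hk0 : 0 < k := by linarith
  have hfc := H.continuous_x
  have hgc := H.continuous_g_x
  have hint : ∀ t, Integrable fun x => weight δ x * |f (k * x) t - f x t| := fun t => by
    have := hfc t
    exact integrable_of_continuous_of_eq_zero (R := R) (by fun_prop) fun x hx => by
      simp [H.supp x t hx, H.supp _ t (lt_abs_mul hk hx)]
  set z : ℝ → ℝ → ℝ := fun x t =>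
    (f (k * x) t - f x t) / |f (k * x) t - f x t| * (g (k * x) t - g x t) with hz
  have hzm : Measurable (Function.uncurry z) := by
    have hd : Measurable fun q : ℝ × ℝ => (k * q.1, q.2) :=
      (measurable_fst.const_mul k).prodMk measurable_snd
    have h1 := (H.measurable_f.comp hd).sub H.measurable_f
    exact (h1.div h1.abs).mul ((H.measurable_g.comp hd).sub H.measurable_g)
  have hbint : ∀ t, Integrable fun x => |weight δ x * g x t| := fun t => by
    have := hgc t
    exact integrable_of_continuous_of_eq_zero (R := R) (by fun_prop) fun x hx => by
      simp [H.g_eq_zero hx]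
  have hbound : ∀ t x, |weight δ x * z x t| ≤
      |weight δ (k * x) * g (k * x) t| + |weight δ x * g x t| := fun t x => by
    rcases le_or_gt x δ with hx | hx
    · rw [weight_eq_zero hx]
      simp only [zero_mul, abs_zero, add_zero]
      exact abs_nonneg _
    · have h1 : weight δ x ≤ weight δ (k * x) := weight_mono δ (by nlinarith)
      have h2 : abs ((f (k * x) t - f x t) / |f (k * x) t - f x t|) ≤ 1 := by
        rw [abs_div, abs_abs]
        exact div_self_le_one _
      simp only [hz, abs_mul, abs_of_nonneg (weight_nonneg _ _)]
      calc _ ≤ weight δ x * |g (k * x) t - g x t| :=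
            mul_le_mul_of_nonneg_left (mul_le_of_le_one_left (abs_nonneg _) h2)
              (weight_nonneg _ _)
        _ ≤ weight δ x * (|g (k * x) t| + |g x t|) :=
            mul_le_mul_of_nonneg_left (abs_sub _ _) (weight_nonneg _ _)
        _ ≤ _ := by
            rw [mul_add]
            gcongr
  have hbint' : ∀ t, Integrable fun x => |weight δ (k * x) * g (k * x) t| := fun t =>
    (hbint t).comp_mul_left' hk0.ne'
  have hzi : ∀ t, Integrable fun x => weight δ x * z x t := fun t =>
    ((hbint' t).add (hbint t)).mono'
      (hw.measurable.mul (hzm.comp measurable_prodMk_right)).aestronglyMeasurable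
      (ae_of_all _ (hbound t))
  refine sub_nonpos.1 ?_
  rw [dilDiff, dilDiff, integral_sub_integral_eq_integral_integral (C := 2 * C)
    (y := fun x t => |f (k * x) t - f x t|) (z := z)
    hab hw.measurable (hint a) (hint b) ?_ hzm (fun t _ => hzi t) fun t ht => ?_]
  · rw [← neg_nonneg, ← intervalIntegral.integral_neg]
    refine intervalIntegral.integral_nonneg hab fun t _ => ?_
    rw [neg_nonneg]
    have hu'c := H.continuous_u'
    have hpc := H.continuous_p t
    have hft := hfc t
    have hP : ∀ x, HasDerivAt (fun y => y * (u (f (k * y) t) - u (f y t)))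
        ((u (f (k * x) t) - u (f x t)) +
          x * (u' (f (k * x) t) * (p (k * x) t * k) - u' (f x t) * p x t)) x := fun x => by
      have h1 : HasDerivAt (fun y => f (k * y) t) (p (k * x) t * k) x := by
        have h2 : HasDerivAt (fun y : ℝ => k * y) k x := by
          simpa using (hasDerivAt_id x).const_mul k
        exact (H.deriv_x (k * x) t).comp x h2
      simpa [Function.comp_def] using (hasDerivAt_id x).fun_mul
        (((H.u_deriv (f (k * x) t)).comp x h1).fun_sub ((H.u_deriv (f x t)).comp x (H.deriv_x x t)))
    have h := integral_mul_sign_mul_deriv_nonpos (R := R) (hasDerivAt_weight δ)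
      (continuous_weight_deriv δ) (fun x => by positivity) hP (by fun_prop) fun x hx => by
        simp [H.supp x t hx, H.supp _ t (lt_abs_mul hk hx)]
    have h' : ∫ x, weight δ x * z x t = lam * ∫ x, weight δ x *
        (x * (u (f (k * x) t) - u (f x t)) / |x * (u (f (k * x) t) - u (f x t))| *
          ((u (f (k * x) t) - u (f x t)) +
          x * (u' (f (k * x) t) * (p (k * x) t * k) - u' (f x t) * p x t))) := by
      rw [← integral_const_mul]
      refine integral_congr_ae (ae_of_all _ fun x => ?_)
      simp only
      rcases le_or_gt x δ with hx | hx
      · simp [weight_eq_zero hx]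
      · rw [H.sign_flux_sub (hδ.trans hx) (H.nonneg _ _) (H.nonneg _ _)]
        simp only [hz, H.g_eq]
        ring
    rw [h']
    exact mul_nonpos_of_nonneg_of_nonpos H.lam_pos.le h
  · intro x _
    refine abs_sub_abs_eq_integral_sign_mul (r := fun t => f (k * x) t - f x t) hab
      ((H.continuous_t _).sub (H.continuous_t _)).continuousOn (fun t ht => ?_)
      ((H.continuous_g_t _).sub (H.continuous_g_t _))
    have ht' : t ∈ Ioo 0 T := ⟨ha.trans_lt ht.1, ht.2.trans_le hb⟩
    exact (H.deriv_t _ t ht').sub (H.deriv_t _ t ht')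
  · refine (integral_mono (hzi t).abs ((hbint' t).add (hbint t)) (hbound t)).trans ?_
    have h1 := hC t (hgood t ht)
    have h2 : ∫ x, |weight δ (k * x) * g (k * x) t| = |k⁻¹| * ∫ x, |weight δ x * g x t| := by
      rw [Measure.integral_comp_mul_left (fun x => |weight δ x * g x t|), smul_eq_mul]
    have h3 : |k⁻¹| ≤ 1 := by
      rw [abs_of_pos (inv_pos.2 hk0)]
      exact inv_le_one_of_one_le₀ hk
    have h4 : 0 ≤ ∫ x, |weight δ x * g x t| := integral_nonneg fun _ => abs_nonneg _
    simp only [Pi.add_apply]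
    rw [integral_add (hbint' t) (hbint t), h2]
    nlinarith

end IsTransport

end Evolution

section Propagation

/-- A Baire category argument: a monotone sequence of closed sets covering `[0, T]` contains
`[0, T]` from some index on, provided membership propagates to the right across intervals whose
compact parts away from the left endpoint lie in some set of the sequence. -/
theorem exists_Icc_subset_of_propagation {T : ℝ} {S : ℕ → Set ℝ} (hmono : Monotone S)
    (hclosed : ∀ n, IsClosed (S n)) (hcover : ∀ t ∈ Icc 0 T, ∃ n, t ∈ S n)
    (hprop : ∀ n a b, 0 ≤ a → a < b → b ≤ T → a ∈ S n →
      (∀ c ∈ Ioc a b, ∃ m, Icc c b ⊆ S m) → b ∈ S n) : ∃ m, Icc 0 T ⊆ S m := by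
  set B : Set ℝ := {t | t ∈ Icc 0 T ∧ ∀ m, S m ∉ 𝓝[Icc 0 T] t} with hB
  have hcompact : ∀ K, IsCompact K → K ⊆ Icc 0 T → (∀ t ∈ K, t ∉ B) → ∃ m, K ⊆ S m := by
    intro K hK hKT hKB
    refine hK.induction_on (p := fun s => ∃ m, s ⊆ S m) ⟨0, empty_subset _⟩
      (fun s t hst ⟨m, hm⟩ => ⟨m, hst.trans hm⟩) (fun s t ⟨m, hm⟩ ⟨m', hm'⟩ =>
        ⟨max m m', union_subset (hm.trans (hmono (le_max_left _ _)))
          (hm'.trans (hmono (le_max_right _ _)))⟩) fun t ht => ?_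
    have : ∃ m, S m ∈ 𝓝[Icc 0 T] t := by
      by_contra! h
      exact hKB t ht ⟨hKT ht, h⟩
    obtain ⟨m, hm⟩ := this
    exact ⟨S m, nhdsWithin_mono t hKT hm, m, Subset.rfl⟩
  rcases B.eq_empty_or_nonempty with hBe | hBne
  · exact hcompact _ isCompact_Icc Subset.rfl fun t _ => by simp [hBe]
  exfalso
  have hBc : IsClosed B := by
    rw [← isOpen_compl_iff, isOpen_iff_mem_nhds]
    intro t ht
    by_cases htT : t ∈ Icc 0 T
    · have : ∃ m, S m ∈ 𝓝[Icc 0 T] t := by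
        by_contra! h
        exact ht ⟨htT, h⟩
      obtain ⟨m, hm⟩ := this
      have h1 : ∀ᶠ s in 𝓝[Icc 0 T] t, S m ∈ 𝓝[Icc 0 T] s := eventually_eventually_nhdsWithin.2 hm
      filter_upwards [eventually_nhdsWithin_iff.1 h1] with s hs hsB
      exact hsB.2 m (hs hsB.1)
    · filter_upwards [isClosed_Icc.isOpen_compl.mem_nhds htT] with s hs hsB
      exact hs hsB.1
  have : Nonempty B := hBne.to_subtype
  have : CompleteSpace B := hBc.completeSpace_coe
  obtain ⟨n, ⟨b, hbB⟩, hb⟩ := nonempty_interior_of_iUnion_of_closed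
    (f := fun n => ((↑) : B → ℝ) ⁻¹' S n) (fun n => (hclosed n).preimage continuous_subtype_val)
    (eq_univ_of_forall fun t => mem_iUnion.2 (hcover t t.2.1))
  obtain ⟨ε, hε, hball⟩ := Metric.mem_nhds_iff.1 (mem_interior_iff_mem_nhds.1 hb)
  have hnear : ∀ s ∈ B, |s - b| < ε → s ∈ S n := fun s hs hsb =>
    hball (show (⟨s, hs⟩ : B) ∈ Metric.ball ⟨b, hbB⟩ ε from hsb)
  have hb0 := hbB.1
  set c := max (b - ε / 2) 0 with hc
  have hcb : c ≤ b := max_le (by linarith) hb0.1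
  have hc0 : 0 ≤ c := le_max_right _ _
  have hcε : b - ε / 2 ≤ c := le_max_left _ _
  obtain ⟨n', hn'⟩ := hcover c ⟨hc0, hcb.trans hb0.2⟩
  have hkey : ∀ s ∈ Icc 0 T, c ≤ s → s < b + ε → s ∈ S (max n n') := by
    intro s hs hcs hsb
    by_cases hsB : s ∈ B
    · exact hmono (le_max_left _ _) (hnear s hsB (abs_lt.2 ⟨by linarith, by linarith⟩))
    have hK : IsCompact ((B ∪ {c}) ∩ Icc c s) :=
      isCompact_Icc.inter_left (hBc.union isClosed_singleton)
    have haK := hK.sSup_mem ⟨c, Or.inr rfl, le_rfl, hcs⟩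
    set a := sSup ((B ∪ {c}) ∩ Icc c s)
    have haS : a ∈ S (max n n') := by
      rcases haK.1 with h | h
      · exact hmono (le_max_left _ _) (hnear a h
          (abs_lt.2 ⟨by linarith [haK.2.1], by linarith [haK.2.2]⟩))
      · rw [h]
        exact hmono (le_max_right _ _) hn'
    rcases haK.2.2.eq_or_lt with h | h
    · rwa [← h]
    · refine hprop _ a s (hc0.trans haK.2.1) h hs.2 haS fun c' hc' =>
        hcompact _ isCompact_Icc
          (fun y hy => ⟨(hc0.trans haK.2.1).trans (hc'.1.le.trans hy.1), hy.2.trans hs.2⟩)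
          fun y hy hyB => ?_
      have : y ≤ a := le_csSup hK.bddAbove
        ⟨Or.inl hyB, haK.2.1.trans (hc'.1.le.trans hy.1), hy.2⟩
      linarith [hc'.1, hy.1]
  refine hbB.2 (max n n') (mem_nhdsWithin_iff_eventually.2 ?_)
  filter_upwards [Ioo_mem_nhds (a := b - ε / 2) (b := b + ε / 2) (by linarith) (by linarith)]
    with s hs hsT
  exact hkey s hsT (max_le hs.1.le hsT.1) (by linarith [hs.2])

namespace IsTransport

variable {lam R T : ℝ} {u u' : ℝ → ℝ} {f p g : ℝ → ℝ → ℝ} {δ n a b t : ℝ}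

theorem flux_le_of_integral_entropy_nonpos (H : IsTransport lam R T u u' f p g) (hn : 0 ≤ n)
    (h : ∫ x, weight δ x * entropy u n x (f x t) ≤ 0) (x : ℝ) (hx : δ < x) :
    x * u (f x t) ≤ n := by
  have hc : Continuous fun x => weight δ x * entropy u n x (f x t) :=
    (continuous_weight δ).mul (continuous_entropy H.continuous_u n (H.continuous_x t))
  have hi := integrable_of_continuous_of_eq_zero (R := R) hc fun x hx => by
    rw [H.supp x t hx, entropy_zero, mul_zero]
  have hpos : ∀ x, 0 ≤ weight δ x * entropy u n x (f x t) := fun x =>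
    mul_nonneg (weight_nonneg _ _) (entropy_nonneg (H.nonneg x t))
  have h0 := (integral_eq_zero_iff_of_nonneg hpos hi).1 (h.antisymm (integral_nonneg hpos))
  have h1 := congrFun ((hc.ae_eq_iff_eq volume continuous_const).1 h0) x
  exact le_of_entropy_eq_zero H.continuous_u H.u_zero hn (H.nonneg x t)
    ((mul_eq_zero.1 h1).resolve_left (weight_pos hx).ne')

theorem integral_entropy_eq_zero (H : IsTransport lam R T u u' f p g) (hδ : 0 < δ)
    (h : ∀ x, δ < x → x * u (f x t) ≤ n) :
    ∫ x, weight δ x * entropy u n x (f x t) = 0 := by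
  rw [integral_congr_ae (g := fun _ => (0 : ℝ)), integral_zero]
  refine ae_of_all _ fun x => ?_
  simp only
  rcases le_or_gt x δ with hx | hx
  · rw [weight_eq_zero hx, zero_mul]
  · rw [entropy_eq_zero_of_le H.u_mono (hδ.trans hx).le (H.nonneg x t) (h x hx), mul_zero]

/-- Bounds propagate to the right across intervals on which they hold locally uniformly. -/
theorem isGood_of_isGood_left (H : IsTransport lam R T u u' f p g) (hδ : 0 < δ) (hn : 0 ≤ n)
    (ha : 0 ≤ a) (hab : a < b) (hb : b ≤ T) (hga : IsGood u f δ n a)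
    (hloc : ∀ c ∈ Ioc a b, ∃ m : ℝ, ∀ t ∈ Icc c b, IsGood u f δ m t) : IsGood u f δ n b := by
  have hseq : ∀ t ∈ Ioc a b, ∀ j : ℕ, a + (t - a) * (1 / ((j : ℝ) + 1)) ∈ Ioc a t := by
    intro t ht j
    have h1 : (0 : ℝ) < 1 / ((j : ℝ) + 1) := by positivity
    have h2 : 1 / ((j : ℝ) + 1) ≤ 1 := div_le_one_of_le₀ (by simp) (by positivity)
    have := sub_pos.2 ht.1
    exact ⟨by nlinarith, by nlinarith⟩
  have hlim : ∀ t, Tendsto (fun j : ℕ => a + (t - a) * (1 / ((j : ℝ) + 1))) atTop (𝓝 a) := by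
    intro t
    simpa using ((tendsto_one_div_add_atTop_nhds_zero_nat (𝕜 := ℝ)).const_mul (t - a)).const_add a
  have hw := continuous_weight δ
  have hflux : ∀ t ∈ Ioc a b, ∀ x, δ < x → x * u (f x t) ≤ n := by
    intro t ht
    refine H.flux_le_of_integral_entropy_nonpos hn ?_
    rw [← H.integral_entropy_eq_zero hδ hga.1]
    refine ge_of_tendsto (tendsto_integral_of_eq_zero_of_le (R := R)
      (F := fun j x => weight δ x * entropy u n x (f x (a + (t - a) * (1 / ((j : ℝ) + 1)))))
      (h := fun x => weight δ x * ((n + 1) / δ)) (by fun_prop) ?_ ?_ ?_ ?_)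
      (Eventually.of_forall fun j => ?_)
    · exact fun j => (hw.mul
        (continuous_entropy H.continuous_u n (H.continuous_x _))).aestronglyMeasurable
    · intro j x hx
      rw [H.supp x _ hx, entropy_zero, mul_zero]
    · intro j x _
      rw [abs_of_nonneg (mul_nonneg (weight_nonneg _ _) (entropy_nonneg (H.nonneg x _)))]
      rcases le_or_gt x δ with hx | hx
      · simp [weight_eq_zero hx]
      · exact mul_le_mul_of_nonneg_left
          (entropy_le H.continuous_u H.le_u hδ hn hx (H.nonneg x _)) (weight_nonneg _ _)
    · intro x
      refine (((hasDerivAt_entropy H.continuous_u n x (f x a)).continuousAt.tendsto).comp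
        (((H.continuous_t x).tendsto a).comp (hlim t))).const_mul _
    · have hj := hseq t ht j
      obtain ⟨m, hm⟩ := hloc _ ⟨hj.1, hj.2.trans ht.2⟩
      exact H.integral_entropy_le hδ (ha.trans hj.1.le) hj.2 (ht.2.trans hb)
        fun s hs => hm s ⟨hs.1, hs.2.trans ht.2⟩
  refine ⟨hflux b ⟨hab, le_rfl⟩, fun k hk hk2 => ?_⟩
  have hb' : b ∈ Ioc a b := ⟨hab, le_rfl⟩
  refine le_trans ?_ (hga.2 k hk hk2)
  refine ge_of_tendsto (H.tendsto_dilDiff hδ (hlim b)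
    (fun j => hflux _ (hseq b hb' j)) hk.le) (Eventually.of_forall fun j => ?_)
  have hj := hseq b hb' j
  obtain ⟨m, hm⟩ := hloc _ hj
  exact H.dilDiff_le hδ (ha.trans hj.1.le) hj.2 hb hm hk.le

theorem IsGood.mono {m : ℝ} (h : IsGood u f δ n t) (hnm : n ≤ m) : IsGood u f δ m t :=
  ⟨fun x hx => (h.1 x hx).trans hnm, fun k hk hk2 =>
    (h.2 k hk hk2).trans (mul_le_mul_of_nonneg_right hnm (by linarith))⟩

theorem exists_forall_isGood (H : IsTransport lam R T u u' f p g) (hδ : 0 < δ) :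
    ∃ m : ℝ, ∀ t ∈ Icc 0 T, IsGood u f δ m t := by
  obtain ⟨m, hm⟩ := exists_Icc_subset_of_propagation (T := T)
    (S := fun n : ℕ => {t | IsGood u f δ n t})
    (fun n m hnm t ht => IsGood.mono ht (by exact_mod_cast hnm))
    (fun n => H.isClosed_setOf_isGood hδ n) (fun t _ => H.exists_isGood δ t)
    fun n a b ha hab hb hga hloc => H.isGood_of_isGood_left hδ (by positivity) ha hab hb hga
      fun c hc => (hloc c hc).elim fun m hm => ⟨m, hm⟩
  exact ⟨m, hm⟩

/-- The maximum principle for the flux. -/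
theorem flux_le (H : IsTransport lam R T u u' f p g) (hn : 0 ≤ n)
    (h : ∀ x, x * u (f x 0) ≤ n) (t : ℝ) (ht : t ∈ Icc 0 T) (x : ℝ) (hx : 0 < x) :
    x * u (f x t) ≤ n := by
  have hδ : 0 < x / 2 := by positivity
  obtain ⟨m, hm⟩ := H.exists_forall_isGood hδ
  refine H.flux_le_of_integral_entropy_nonpos (δ := x / 2) hn ?_ x (by linarith)
  rw [← H.integral_entropy_eq_zero hδ fun x _ => h x]
  exact H.integral_entropy_le hδ le_rfl ht.1 ht.2 fun s hs => hm s ⟨hs.1, hs.2.trans ht.2⟩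

end IsTransport

end Propagation

section SecondMoment

namespace IsTransport

variable {lam R T : ℝ} {u u' : ℝ → ℝ} {f p g : ℝ → ℝ → ℝ} {n a b : ℝ}

theorem integral_posPart_sub (H : IsTransport lam R T u u' f p g) (hn : 0 ≤ n)
    (h : ∀ x, x * u (f x 0) ≤ n) (ha : 0 ≤ a) (hab : a ≤ b) (hb : b ≤ T) :
    (∫ x, max x 0 ^ 2 * f x b) - ∫ x, max x 0 ^ 2 * f x a =
      ∫ t in a..b, -lam * ∫ x, 2 * max x 0 * (x * u (f x t)) := by
  have hflux := H.flux_le hn h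
  have hpos : ∀ j : ℕ, (0 : ℝ) < 1 / ((j : ℝ) + 1) := fun j => by positivity
  have h0 := tendsto_one_div_add_atTop_nhds_zero_nat (𝕜 := ℝ)
  have hmax : ∀ x, Tendsto (fun j : ℕ => max (x - 1 / ((j : ℝ) + 1)) 0) atTop (𝓝 (max x 0)) :=
    fun x => by simpa using (h0.const_sub x).max (tendsto_const_nhds (x := (0 : ℝ)))
  have hmaxle : ∀ (j : ℕ) (x : ℝ), max (x - 1 / ((j : ℝ) + 1)) 0 ≤ |x| := fun j x =>
    max_le (by linarith [hpos j, le_abs_self x]) (abs_nonneg x)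
  have hmoment : ∀ t, Tendsto (fun j : ℕ => ∫ x, weight (1 / ((j : ℝ) + 1)) x * f x t) atTop
      (𝓝 (∫ x, max x 0 ^ 2 * f x t)) := fun t => by
    have hc := H.continuous_x t
    refine tendsto_integral_of_eq_zero_of_le (R := R) (h := fun x => |x| ^ 2 * f x t)
      (by fun_prop) (fun j => ?_) (fun j x hx => ?_) (fun j x _ => ?_) fun x => ?_
    · exact ((continuous_weight _).mul hc).aestronglyMeasurable
    · rw [H.supp x t hx, mul_zero]
    · rw [abs_of_nonneg (mul_nonneg (weight_nonneg _ _) (H.nonneg x t))]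
      exact mul_le_mul_of_nonneg_right (pow_le_pow_left₀ (le_max_right _ _) (hmaxle j x) 2)
        (H.nonneg x t)
    · exact ((hmax x).pow 2).mul_const _
  have hinner : ∀ t, Tendsto
      (fun j : ℕ => ∫ x, 2 * max (x - 1 / ((j : ℝ) + 1)) 0 * (x * u (f x t))) atTop
      (𝓝 (∫ x, 2 * max x 0 * (x * u (f x t)))) := fun t => by
    have hc := H.continuous_x t
    have huc := H.continuous_u
    refine tendsto_integral_of_eq_zero_of_le (R := R)
      (h := fun x => 2 * |x| * |x * u (f x t)|)
      (by fun_prop) (fun j => ?_) (fun j x hx => ?_) (fun j x _ => ?_) fun x => ?_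
    · exact (by fun_prop : Continuous _).aestronglyMeasurable
    · rw [H.flux_eq_zero t x hx, mul_zero]
    · rw [abs_mul, abs_of_nonneg (by positivity : 0 ≤ 2 * max (x - 1 / ((j : ℝ) + 1)) 0)]
      exact mul_le_mul_of_nonneg_right
        (mul_le_mul_of_nonneg_left (hmaxle j x) zero_le_two) (abs_nonneg _)
    · exact ((hmax x).const_mul 2).mul_const _
  refine tendsto_nhds_unique ((hmoment b).sub (hmoment a)) ?_
  have hrhs : Tendsto (fun j : ℕ => ∫ t in a..b, -lam * ∫ x,
      2 * max (x - 1 / ((j : ℝ) + 1)) 0 * (x * u (f x t))) atTop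
      (𝓝 (∫ t in a..b, -lam * ∫ x, 2 * max x 0 * (x * u (f x t)))) := by
    refine intervalIntegral.tendsto_integral_filter_of_dominated_convergence
      (fun _ => lam * ∫ x in Icc (-R) R, 2 * |x| * n) (Eventually.of_forall fun j => ?_)
      (Eventually.of_forall fun j => ae_of_all _ fun t ht => ?_)
      intervalIntegrable_const (ae_of_all _ fun t _ => (hinner t).const_mul _)
    · have hm : Measurable (Function.uncurry fun x t =>
          2 * max (x - 1 / ((j : ℝ) + 1)) 0 * (x * u (f x t))) :=
        (Continuous.measurable (f := fun q : ℝ × ℝ => 2 * max (q.1 - 1 / ((j : ℝ) + 1)) 0)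
          (by fun_prop)).mul (measurable_fst.mul (H.continuous_u.measurable.comp H.measurable_f))
      exact ((StronglyMeasurable.integral_prod_left (f := fun x t =>
          2 * max (x - 1 / ((j : ℝ) + 1)) 0 * (x * u (f x t)))
        hm.stronglyMeasurable).const_mul _).aestronglyMeasurable
    · rw [uIoc_of_le hab] at ht
      rw [norm_mul, norm_neg, Real.norm_of_nonneg H.lam_pos.le,
        ← integral_indicator measurableSet_Icc]
      refine mul_le_mul_of_nonneg_left (norm_integral_le_of_norm_le
        ((integrable_indicator_iff measurableSet_Icc).2
          (Continuous.integrableOn_Icc (by fun_prop))) (ae_of_all _ fun x => ?_)) H.lam_pos.le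
      by_cases hx : x ∈ Icc (-R) R
      · rw [indicator_of_mem hx]
        rcases le_or_gt x 0 with hx0 | hx0
        · rw [max_eq_right (by linarith [hpos j])]
          simpa using by positivity
        · rw [Real.norm_of_nonneg (mul_nonneg (by positivity)
            (mul_nonneg hx0.le (H.u_nonneg x t)))]
          exact mul_le_mul (mul_le_mul_of_nonneg_left (hmaxle j x) zero_le_two)
            (hflux t ⟨ha.trans ht.1.le, ht.2.trans hb⟩ x hx0)
            (mul_nonneg hx0.le (H.u_nonneg x t)) (by positivity)
      · have hx' : R < |x| := lt_of_not_ge fun h => hx (abs_le.1 h)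
        simp [indicator_of_notMem hx, H.supp x t hx', H.u_zero]
  refine hrhs.congr fun j => ?_
  obtain ⟨m, hm⟩ := H.exists_forall_isGood (hpos j)
  exact (H.integral_weight_sub (hpos j) ha hab hb
    fun t ht => hm t ⟨ha.trans ht.1, ht.2.trans hb⟩).symm

theorem reflect (H : IsTransport lam R T u u' f p g) :
    IsTransport lam R T u u' (fun x => f (-x)) (fun x t => -p (-x) t) fun x => g (-x) where
  lam_pos := H.lam_pos
  u_deriv := H.u_deriv
  continuous_u' := H.continuous_u'
  u_zero := H.u_zero
  le_u := H.le_u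
  u_mono := H.u_mono
  nonneg x := H.nonneg (-x)
  supp x t hx := H.supp _ t (by rwa [abs_neg])
  deriv_x x t := by simpa [Function.comp_def] using (H.deriv_x (-x) t).comp x (hasDerivAt_neg x)
  continuous_p t := ((H.continuous_p t).comp continuous_neg).neg
  continuous_t x := H.continuous_t (-x)
  continuous_g_t x := H.continuous_g_t (-x)
  g_eq x t := by
    rw [H.g_eq]
    ring
  deriv_t x := H.deriv_t (-x)

theorem exists_abs_flux_le (H : IsTransport lam R T u u' f p g) :
    ∃ n, 0 ≤ n ∧ ∀ x, |x * u (f x 0)| ≤ n := by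
  have := H.continuous_x 0
  have := H.continuous_u
  obtain ⟨n, hn⟩ := (show Continuous fun x => x * u (f x 0) by
    fun_prop).bounded_above_of_compact_support
    (HasCompactSupport.intro (isCompact_Icc (a := -R) (b := R)) fun x hx =>
      H.flux_eq_zero 0 x (lt_of_not_ge fun h => hx (abs_le.1 h)))
  exact ⟨n, (norm_nonneg _).trans (hn 0), hn⟩

theorem abs_flux_le (H : IsTransport lam R T u u' f p g) (hn : 0 ≤ n)
    (h : ∀ x, |x * u (f x 0)| ≤ n) (t : ℝ) (ht : t ∈ Icc 0 T) (x : ℝ) :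
    |x * u (f x t)| ≤ n := by
  rcases lt_trichotomy x 0 with hx | rfl | hx
  · have h1 := H.reflect.flux_le hn (fun y => by linarith [(neg_le_abs _).trans (h (-y))]) t ht (-x)
      (neg_pos.2 hx)
    rw [neg_neg] at h1
    rw [abs_of_nonpos (mul_nonpos_of_nonpos_of_nonneg hx.le (H.u_nonneg x t))]
    linarith
  · simpa using hn
  · rw [abs_of_nonneg (mul_nonneg hx.le (H.u_nonneg x t))]
    exact H.flux_le hn (fun y => (le_abs_self _).trans (h y)) t ht x hx

theorem continuousOn_integral_mul_flux (H : IsTransport lam R T u u' f p g) {φ : ℝ → ℝ}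
    (hφ : Continuous φ) :
    ContinuousOn (fun t => ∫ x, φ x * (x * u (f x t))) (Icc 0 T) := by
  obtain ⟨n, hn, h⟩ := H.exists_abs_flux_le
  have huc := H.continuous_u
  refine continuousOn_of_dominated (bound := (Icc (-R) R).indicator fun x => |φ x| * n)
    (fun t _ => ?_) (fun t ht => ae_of_all _ fun x => ?_)
    ((integrable_indicator_iff measurableSet_Icc).2 (Continuous.integrableOn_Icc (by fun_prop)))
    (ae_of_all _ fun x => ?_)
  · have := H.continuous_x t
    exact (by fun_prop : Continuous _).aestronglyMeasurable
  · by_cases hx : x ∈ Icc (-R) R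
    · rw [indicator_of_mem hx, norm_mul]
      exact mul_le_mul_of_nonneg_left (H.abs_flux_le hn h t ht x) (norm_nonneg _)
    · rw [H.flux_eq_zero t x (lt_of_not_ge fun h => hx (abs_le.1 h))]
      simp [indicator_of_notMem hx]
  · have := H.continuous_t x
    exact (by fun_prop : Continuous _).continuousOn

/-- The evolution of the second moment, in integrated form. -/
theorem integral_sq_sub (H : IsTransport lam R T u u' f p g) (ha : 0 ≤ a) (hab : a ≤ b)
    (hb : b ≤ T) :
    (∫ x, x ^ 2 * f x b) - ∫ x, x ^ 2 * f x a =
      ∫ t in a..b, -(2 * lam) * ∫ x, x * (x * u (f x t)) := by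
  obtain ⟨n, hn, h⟩ := H.exists_abs_flux_le
  have huc := H.continuous_u
  have hsub : uIcc a b ⊆ Icc 0 T := by
    rw [uIcc_of_le hab]
    exact Icc_subset_Icc ha hb
  have h1 := H.integral_posPart_sub hn (fun x => (le_abs_self _).trans (h x)) ha hab hb
  have h2 := H.reflect.integral_posPart_sub hn
    (fun x => by linarith [(neg_le_abs _).trans (h (-x))]) ha hab hb
  have hm : ∀ t, ∫ x, max x 0 ^ 2 * f (-x) t = ∫ x, max (-x) 0 ^ 2 * f x t := fun t => by
    rw [← integral_neg_eq_self]
    simp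
  have hq : ∀ t, ∫ x, 2 * max x 0 * (x * u (f (-x) t)) =
      ∫ x, -(2 * max (-x) 0) * (x * u (f x t)) := fun t => by
    rw [← integral_neg_eq_self]
    simp
  have hsplit : ∀ t, ∫ x, x ^ 2 * f x t =
      (∫ x, max x 0 ^ 2 * f x t) + ∫ x, max (-x) 0 ^ 2 * f x t := fun t => by
    have hc := H.continuous_x t
    rw [← integral_add]
    · refine integral_congr_ae (ae_of_all _ fun x => ?_)
      rcases le_total x 0 with hx | hx
      · simp [hx]
      · simp [hx]
    all_goals
      exact integrable_of_continuous_of_eq_zero (R := R) (by fun_prop) fun x hx => by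
        rw [H.supp x t hx, mul_zero]
  simp only [hm, hq] at h2
  rw [hsplit, hsplit, add_sub_add_comm, h1, h2, ← intervalIntegral.integral_add]
  · refine intervalIntegral.integral_congr fun t _ => ?_
    have hc := H.continuous_x t
    rw [← mul_add, ← integral_add, show -(2 * lam) = -lam * 2 by ring, mul_assoc,
      ← integral_const_mul (2 : ℝ) fun x => x * (x * u (f x t))]
    · congr 1
      refine MeasureTheory.integral_congr_ae (ae_of_all _ fun x => ?_)
      rcases le_total x 0 with hx | hx
      · simp only [max_eq_right hx, max_eq_left (neg_nonneg.2 hx)]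
        ring
      · simp only [max_eq_left hx, max_eq_right (neg_nonpos.2 hx)]
        ring
    all_goals
      exact integrable_of_continuous_of_eq_zero (R := R) (by fun_prop) fun x hx => by
        rw [H.flux_eq_zero t x hx, mul_zero]
  · exact ((H.continuousOn_integral_mul_flux (φ := fun x => 2 * max x 0)
      (by fun_prop)).mono hsub).intervalIntegrable.const_mul _
  · exact ((H.continuousOn_integral_mul_flux (φ := fun x => -(2 * max (-x) 0))
      (by fun_prop)).mono hsub).intervalIntegrable.const_mul _

theorem hasDerivWithinAt_integral_sq (H : IsTransport lam R T u u' f p g) {t : ℝ}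
    (ht : t ∈ Icc 0 T) : HasDerivWithinAt (fun s => ∫ x, x ^ 2 * f x s)
      (-(2 * lam) * ∫ x, x * (x * u (f x t))) (Icc 0 T) t := by
  have hc : ContinuousOn (fun t => -(2 * lam) * ∫ x, x * (x * u (f x t))) (Icc 0 T) :=
    continuousOn_const.mul (H.continuousOn_integral_mul_flux continuous_id)
  have : Fact (t ∈ Icc 0 T) := ⟨ht⟩
  have hd := intervalIntegral.integral_hasDerivWithinAt_right (a := 0) (s := Icc 0 T)
    (t := Icc 0 T) ((hc.mono (by
      rw [uIcc_of_le ht.1]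
      exact Icc_subset_Icc_right ht.2)).intervalIntegrable)
    (hc.stronglyMeasurableAtFilter_nhdsWithin measurableSet_Icc t) (hc t ht)
  refine (hd.const_add (∫ x, x ^ 2 * f x 0)).congr_of_mem (fun s hs => ?_) ht
  rw [← H.integral_sq_sub le_rfl hs.1 hs.2]
  ring

end IsTransport

end SecondMoment

section ClassicalSolution

/-- The nonlinearity `r * (1 + β * r ^ α)`. -/
noncomputable def drift (β α r : ℝ) : ℝ := r + β * r ^ (α + 1)

/-- The derivative of `drift`. -/
noncomputable def driftDeriv (β α r : ℝ) : ℝ := 1 + β * ((α + 1) * r ^ α)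

/-- The projection of the line onto `[0, T]`. -/
noncomputable def clamp (T t : ℝ) : ℝ := max 0 (min t T)

variable {lam β σ α xstar T : ℝ} {f : ℝ → ℝ → ℝ}

theorem hasDerivAt_drift (hα : 0 < α) (r : ℝ) :
    HasDerivAt (drift β α) (driftDeriv β α r) r := by
  have h := Real.hasDerivAt_rpow_const (x := r) (p := α + 1) (Or.inr (by linarith))
  rw [add_sub_cancel_right] at h
  exact (hasDerivAt_id r).add (h.const_mul β)

theorem continuous_driftDeriv (hα : 0 < α) : Continuous (driftDeriv β α) :=
  continuous_const.add (continuous_const.mul (continuous_const.mul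
    (Real.continuous_rpow_const hα.le)))

theorem continuous_drift (hα : 0 < α) : Continuous (drift β α) :=
  continuous_iff_continuousAt.2 fun r => (hasDerivAt_drift hα r).continuousAt

theorem drift_zero (hα : 0 < α) : drift β α 0 = 0 := by
  simp [drift, Real.zero_rpow (by linarith : α + 1 ≠ 0)]

theorem mul_eq_drift (hα : 0 < α) {r : ℝ} (hr : 0 ≤ r) :
    (1 + β * r ^ α) * r = drift β α r := by
  rw [drift, Real.rpow_add_one' hr (by linarith)]
  ring

theorem continuous_clamp (T : ℝ) : Continuous (clamp T) := by
  unfold clamp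
  fun_prop

theorem clamp_mem (hT : 0 ≤ T) (t : ℝ) : clamp T t ∈ Icc 0 T :=
  ⟨le_max_left _ _, max_le hT (min_le_right _ _)⟩

theorem clamp_of_mem {t : ℝ} (ht : t ∈ Icc 0 T) : clamp T t = t := by
  rw [clamp, min_eq_left ht.2, max_eq_right ht.1]

theorem continuous_comp_clamp (hT : 0 ≤ T) {h : ℝ → ℝ} (hh : ContinuousOn h (Icc 0 T)) :
    Continuous fun t => h (clamp T t) :=
  hh.comp_continuous (continuous_clamp T) (clamp_mem hT)

namespace IsClassicalSolution

theorem nonneg (hf : IsClassicalSolution lam β σ α xstar T f) {t : ℝ} (ht : t ∈ Icc 0 T) (x : ℝ) :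
    0 ≤ f x t := hf.1 x t ht

theorem contDiff (hf : IsClassicalSolution lam β σ α xstar T f) {t : ℝ} (ht : t ∈ Icc 0 T) :
    ContDiff ℝ 2 fun x => f x t := hf.2.2.1 t ht

theorem exists_eq_zero (hf : IsClassicalSolution lam β σ α xstar T f) :
    ∃ R, ∀ t ∈ Icc 0 T, ∀ x, R < |x| → f (x + xstar) t = 0 := by
  obtain ⟨C, hC, hsupp⟩ := hf.2.1
  obtain ⟨R, hR⟩ := hC.isBounded.subset_closedBall xstar
  refine ⟨R, fun t ht x hx => ?_⟩
  by_contra h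
  have := hR (hsupp t ht _ h)
  rw [Metric.mem_closedBall, Real.dist_eq, add_sub_cancel_right] at this
  exact this.not_gt hx

theorem hasDerivAt_x (hf : IsClassicalSolution lam β σ α xstar T f) {t : ℝ} (ht : t ∈ Icc 0 T)
    (x : ℝ) : HasDerivAt (fun y => f y t) (deriv (fun y => f y t) x) x :=
  ((hf.contDiff ht).differentiable (by norm_num) x).hasDerivAt

theorem continuous_deriv_x (hf : IsClassicalSolution lam β σ α xstar T f) {t : ℝ}
    (ht : t ∈ Icc 0 T) : Continuous fun x => deriv (fun y => f y t) x :=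
  (hf.contDiff ht).continuous_deriv (by norm_num)

theorem deriv_drift (hf : IsClassicalSolution lam β σ α xstar T f) (hα : 0 < α) {t : ℝ}
    (ht : t ∈ Icc 0 T) (x : ℝ) :
    deriv (fun y => (y - xstar) * (1 + β * f y t ^ α) * f y t) x =
      drift β α (f x t) + (x - xstar) * (driftDeriv β α (f x t) * deriv (fun y => f y t) x) := by
  have h1 : (fun y => (y - xstar) * (1 + β * f y t ^ α) * f y t) =
      fun y => (y - xstar) * drift β α (f y t) := by
    funext y
    rw [mul_assoc, mul_eq_drift hα (hf.nonneg ht y)]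
  rw [h1]
  have h2 := ((hasDerivAt_id x).sub_const xstar).fun_mul
    ((hasDerivAt_drift (β := β) hα (f x t)).comp x (hf.hasDerivAt_x ht x))
  simpa [Function.comp_def] using h2.deriv

theorem continuous_t (hf : IsClassicalSolution lam β σ α xstar T f) (hT : 0 ≤ T) (x : ℝ) :
    Continuous fun t => f x (clamp T t) :=
  continuous_comp_clamp hT (hf.2.2.2.1 x).continuousOn

theorem continuous_derivWithin (hf : IsClassicalSolution lam β σ α xstar T f) (hT : 0 < T)
    (x : ℝ) : Continuous fun t => derivWithin (fun s => f x s) (Icc 0 T) (clamp T t) :=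
  continuous_comp_clamp (h := derivWithin (fun s => f x s) (Icc 0 T)) hT.le
    ((hf.2.2.2.1 x).continuousOn_derivWithin (uniqueDiffOn_Icc hT) le_rfl)

theorem hasDerivAt_t (hf : IsClassicalSolution lam β σ α xstar T f) (x : ℝ) {t : ℝ}
    (ht : t ∈ Ioo 0 T) : HasDerivAt (fun s => f x (clamp T s))
      (derivWithin (fun s => f x s) (Icc 0 T) (clamp T t)) t := by
  have ht' := Ioo_subset_Icc_self ht
  rw [clamp_of_mem ht']
  refine ((((hf.2.2.2.1 x).differentiableOn one_ne_zero t ht').hasDerivWithinAt).hasDerivAt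
    (Icc_mem_nhds ht.1 ht.2)).congr_of_eventuallyEq ?_
  filter_upwards [Icc_mem_nhds ht.1 ht.2] with s hs
  rw [clamp_of_mem hs]

/-- In the absence of diffusion a classical solution solves a transport equation. -/
theorem isTransport (hf : IsClassicalSolution lam β 0 α xstar T f) (hlam : 0 < lam) (hβ : 0 < β)
    (hα : 0 < α) (hT : 0 < T) {R : ℝ} (hR : ∀ t ∈ Icc 0 T, ∀ x, R < |x| → f (x + xstar) t = 0) :
    IsTransport lam R T (drift β α) (driftDeriv β α) (fun x t => f (x + xstar) (clamp T t))
      (fun x t => deriv (fun y => f y (clamp T t)) (x + xstar))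
      (fun x t => derivWithin (fun s => f (x + xstar) s) (Icc 0 T) (clamp T t)) where
  lam_pos := hlam
  u_deriv := hasDerivAt_drift hα
  continuous_u' := continuous_driftDeriv hα
  u_zero := drift_zero hα
  le_u r hr := le_add_of_nonneg_right (mul_nonneg hβ.le (Real.rpow_nonneg hr _))
  u_mono r hr s _ hrs := add_lt_add_of_lt_of_le hrs
    (mul_le_mul_of_nonneg_left (Real.rpow_le_rpow hr hrs.le (by linarith)) hβ.le)
  nonneg x t := hf.nonneg (clamp_mem hT.le t) _
  supp x t hx := hR _ (clamp_mem hT.le t) x hx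
  deriv_x x t := (hf.hasDerivAt_x (clamp_mem hT.le t) (x + xstar)).comp_add_const x xstar
  continuous_p t := (hf.continuous_deriv_x (clamp_mem hT.le t)).comp (by fun_prop)
  continuous_t x := hf.continuous_t hT.le _
  continuous_g_t x := hf.continuous_derivWithin hT _
  g_eq x t := by
    rw [hf.2.2.2.2 _ _ (clamp_mem hT.le t), hf.deriv_drift hα (clamp_mem hT.le t)]
    simp
  deriv_t x t ht := hf.hasDerivAt_t _ ht

theorem integrable_mul (hf : IsClassicalSolution lam β σ α xstar T f) {t : ℝ} (ht : t ∈ Icc 0 T)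
    {φ w : ℝ → ℝ} (hφ : Continuous φ) (hw : Continuous w) (hw0 : w 0 = 0) :
    Integrable fun x => φ x * w (f x t) := by
  obtain ⟨R, hR⟩ := hf.exists_eq_zero
  have hc := (hf.contDiff ht).continuous
  refine (integrable_of_continuous_of_eq_zero (R := R)
    (h := fun x => φ (x + xstar) * w (f (x + xstar) t)) (by fun_prop) fun x hx => ?_).comp_sub_right
      xstar |>.congr (by simp)
  rw [hR t ht x hx, hw0, mul_zero]

theorem hasDerivWithinAt_of_sigma_eq_zero (hf : IsClassicalSolution lam β 0 α xstar T f)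
    (hlam : 0 < lam) (hβ : 0 < β) (hα : 0 < α) (hT : 0 < T) {t : ℝ} (ht : t ∈ Icc 0 T) :
    HasDerivWithinAt (fun s => ∫ x, (x - xstar) ^ 2 * f x s)
      (-(2 * lam) * (∫ x, (x - xstar) ^ 2 * f x t) -
        2 * lam * β * ∫ x, (x - xstar) ^ 2 * f x t ^ (α + 1)) (Icc 0 T) t := by
  obtain ⟨R, hR⟩ := hf.exists_eq_zero
  have hα1 : α + 1 ≠ 0 := by linarith
  have hshift : ∀ s ∈ Icc 0 T, ∫ x, (x - xstar) ^ 2 * f x s =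
      ∫ x, x ^ 2 * f (x + xstar) (clamp T s) := fun s hs => by
    rw [clamp_of_mem hs, ← integral_add_right_eq_self _ xstar]
    simp
  refine ((hf.isTransport hlam hβ hα hT hR).hasDerivWithinAt_integral_sq ht).congr_of_mem
    hshift ht |>.congr_deriv ?_
  rw [clamp_of_mem ht, ← integral_sub_right_eq_self _ xstar]
  simp only [sub_add_cancel]
  have hi1 : Integrable fun x => (x - xstar) ^ 2 * f x t :=
    hf.integrable_mul ht (w := id) (by fun_prop) continuous_id rfl
  have hi2 : Integrable fun x => (x - xstar) ^ 2 * f x t ^ (α + 1) :=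
    hf.integrable_mul ht (w := fun r => r ^ (α + 1)) (by fun_prop)
      (Real.continuous_rpow_const (by linarith)) (Real.zero_rpow hα1)
  have : ∀ x, (x - xstar) * ((x - xstar) * drift β α (f x t)) =
      (x - xstar) ^ 2 * f x t + β * ((x - xstar) ^ 2 * f x t ^ (α + 1)) := fun x => by
    rw [drift]
    ring
  simp only [this]
  rw [integral_add hi1 (hi2.const_mul β), integral_const_mul]
  ring

end IsClassicalSolution

end ClassicalSolution

section Diffusion

/-- Exponentials of quadratics dominate geometric sequences. -/
theorem exists_pow_mul_lt_mul_exp {κ r l s : ℝ} (hκ : 0 < κ) (hr : 0 < r) (hl : 0 < l)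
    (hs : 0 < s) {Q N : ℝ} (hQ : 0 ≤ Q) (hN : 0 ≤ N) (K : ℝ) :
    ∃ k : ℕ, Q ^ k * N <
      r ^ k * κ * Real.exp (((2 * k + 2) * (s * (2 * k + 1)) - (2 * k + 2) * K) * l) := by
  set ρ := Q / r with hρ
  have hρ0 : 0 ≤ ρ := by positivity
  obtain ⟨k, hk⟩ := exists_nat_ge (max (N / κ) ((l * K + ρ + 1) / (l * s)))
  have hk1 : N ≤ k * κ := (div_le_iff₀ hκ).1 ((le_max_left _ _).trans hk)
  have hk2 : l * K + ρ + 1 ≤ k * (l * s) :=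
    (div_le_iff₀ (by positivity)).1 ((le_max_right _ _).trans hk)
  have hk0 : (0 : ℝ) ≤ k := k.cast_nonneg
  refine ⟨k, ?_⟩
  set E := ((2 * k + 2) * (s * (2 * k + 1)) - (2 * k + 2) * K) * l with hE
  have hls : 0 < l * s := by positivity
  have hkE : k * ρ + k ≤ E := by
    have h1 : ρ + 1 ≤ l * s * (2 * k + 1) - l * K := by nlinarith
    have h2 : E = (2 * k + 2) * (l * s * (2 * k + 1) - l * K) := by
      rw [hE]
      ring
    rw [h2]
    nlinarith
  have hQr : Q ^ k ≤ r ^ k * Real.exp (k * ρ) := by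
    rw [Real.exp_nat_mul, ← mul_pow]
    refine pow_le_pow_left₀ hQ ?_ k
    have h1 : ρ ≤ Real.exp ρ := (by linarith : ρ ≤ ρ + 1).trans (Real.add_one_le_exp ρ)
    calc Q = r * ρ := by rw [hρ, mul_div_cancel₀ _ hr.ne']
      _ ≤ _ := mul_le_mul_of_nonneg_left h1 hr.le
  have hexp : N < κ * Real.exp (E - k * ρ) := by
    have h1 := Real.add_one_le_exp (E - k * ρ)
    nlinarith
  calc Q ^ k * N ≤ r ^ k * Real.exp (k * ρ) * N := mul_le_mul_of_nonneg_right hQr hN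
    _ < r ^ k * Real.exp (k * ρ) * (κ * Real.exp (E - k * ρ)) :=
        mul_lt_mul_of_pos_left hexp (by positivity)
    _ = r ^ k * κ * Real.exp E := by
        rw [Real.exp_sub]
        field_simp

namespace IsClassicalSolution

variable {lam β σ α xstar T : ℝ} {f : ℝ → ℝ → ℝ}

theorem exists_eq_zero_of_lt_abs (hf : IsClassicalSolution lam β σ α xstar T f) :
    ∃ R, ∀ t ∈ Icc 0 T, ∀ x, R < |x| → f x t = 0 := by
  obtain ⟨R, hR⟩ := hf.exists_eq_zero
  refine ⟨R + |xstar|, fun t ht x hx => ?_⟩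
  have := hR t ht (x - xstar) (by linarith [abs_sub_abs_le_abs_sub x xstar])
  rwa [sub_add_cancel] at this

theorem contDiff_sq_mul (hf : IsClassicalSolution lam β σ α xstar T f) {t : ℝ}
    (ht : t ∈ Icc 0 T) : ContDiff ℝ 2 fun y => (y - xstar) ^ 2 * f y t :=
  ((contDiff_id.sub contDiff_const).pow 2).mul (hf.contDiff ht)

theorem hasDerivAt_sq_mul (hf : IsClassicalSolution lam β σ α xstar T f) {t : ℝ}
    (ht : t ∈ Icc 0 T) (x : ℝ) : HasDerivAt (fun y => (y - xstar) ^ 2 * f y t)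
      (deriv (fun y => (y - xstar) ^ 2 * f y t) x) x :=
  ((hf.contDiff_sq_mul ht).differentiable (by norm_num) x).hasDerivAt

theorem hasDerivAt_deriv_sq_mul (hf : IsClassicalSolution lam β σ α xstar T f) {t : ℝ}
    (ht : t ∈ Icc 0 T) (x : ℝ) : HasDerivAt (deriv fun y => (y - xstar) ^ 2 * f y t)
      (deriv (deriv fun y => (y - xstar) ^ 2 * f y t) x) x :=
  ((hf.contDiff_sq_mul ht).differentiable_deriv_two x).hasDerivAt

theorem continuous_deriv_sq_mul (hf : IsClassicalSolution lam β σ α xstar T f) {t : ℝ}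
    (ht : t ∈ Icc 0 T) : Continuous (deriv fun y => (y - xstar) ^ 2 * f y t) :=
  (hf.contDiff_sq_mul ht).continuous_deriv (by norm_num)

theorem continuous_deriv_deriv_sq_mul (hf : IsClassicalSolution lam β σ α xstar T f) {t : ℝ}
    (ht : t ∈ Icc 0 T) : Continuous (deriv (deriv fun y => (y - xstar) ^ 2 * f y t)) := by
  have : ContDiff ℝ 1 (deriv fun y => (y - xstar) ^ 2 * f y t) :=
    ContDiff.deriv' (n := 1) (hf.contDiff_sq_mul ht)
  exact this.continuous_deriv_one

theorem continuous_rate (hf : IsClassicalSolution lam β σ α xstar T f) (hα : 0 < α) {t : ℝ}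
    (ht : t ∈ Icc 0 T) : Continuous fun x => derivWithin (fun s => f x s) (Icc 0 T) t := by
  simp only [fun x => hf.2.2.2.2 x t ht, fun x => hf.deriv_drift hα ht x]
  have := hf.continuous_deriv_deriv_sq_mul ht
  have := hf.continuous_deriv_x ht
  have := (hf.contDiff ht).continuous
  have := continuous_drift (β := β) hα
  have := continuous_driftDeriv (β := β) hα
  fun_prop

theorem rate_eq_zero {R : ℝ}
    (hR : ∀ t ∈ Icc 0 T, ∀ x, R < |x| → f x t = 0) {t : ℝ} (ht : t ∈ Icc 0 T) {x : ℝ}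
    (hx : R < |x|) : derivWithin (fun s => f x s) (Icc 0 T) t = 0 := by
  rw [derivWithin_congr (f := fun _ => (0 : ℝ)) (fun s hs => hR s hs x hx) (hR t ht x hx),
    derivWithin_fun_const]
  rfl

/-- The rate of change of the even moments. -/
theorem integral_pow_mul_rate (hf : IsClassicalSolution lam β σ α xstar T f) (hα : 0 < α) {t : ℝ}
    (ht : t ∈ Icc 0 T) (k : ℕ) :
    ∫ x, (x - xstar) ^ (2 * k + 2) * derivWithin (fun s => f x s) (Icc 0 T) t =
      σ ^ 2 / 2 * ((2 * k + 2) * (2 * k + 1)) * (∫ x, (x - xstar) ^ (2 * k + 2) * f x t) -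
        lam * (2 * k + 2) * ∫ x, (x - xstar) ^ (2 * k + 2) * drift β α (f x t) := by
  obtain ⟨R, hR⟩ := hf.exists_eq_zero_of_lt_abs
  have hpow : ∀ (m : ℕ) (x : ℝ), HasDerivAt (fun x => (x - xstar) ^ (m + 1))
      ((m + 1 : ℕ) * (x - xstar) ^ m) x := fun m x => by
    simpa using ((hasDerivAt_id x).sub_const xstar).fun_pow (m + 1)
  have hfc := (hf.contDiff ht).continuous
  have hpc := hf.continuous_deriv_x ht
  have hdc := continuous_drift (β := β) hα
  have hdc' := continuous_driftDeriv (β := β) hα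
  have hP2 : ∀ x, R < |x| → (x - xstar) ^ 2 * f x t = 0 := fun x hx => by
    rw [hR t ht x hx, mul_zero]
  have hP2' := deriv_eq_zero_of_eq_zero (hf.hasDerivAt_sq_mul ht) hP2
  have hP2'' := deriv_eq_zero_of_eq_zero (hf.hasDerivAt_deriv_sq_mul ht) hP2'
  have hP1 : ∀ x, R < |x| → (x - xstar) * drift β α (f x t) = 0 := fun x hx => by
    rw [hR t ht x hx, drift_zero hα, mul_zero]
  have hP1d : ∀ x, HasDerivAt (fun y => (y - xstar) * drift β α (f y t))
      (drift β α (f x t) + (x - xstar) * (driftDeriv β α (f x t) * deriv (fun y => f y t) x)) x :=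
    fun x => by
      simpa [Function.comp_def] using ((hasDerivAt_id x).sub_const xstar).fun_mul
        ((hasDerivAt_drift (β := β) hα (f x t)).comp x (hf.hasDerivAt_x ht x))
  have h1 := integral_mul_comp_mul_deriv (w := id) (w' := fun _ => 1) (hpow (2 * k + 1))
    (by fun_prop) hP1d (by fun_prop) hP1 hasDerivAt_id continuous_const rfl
  have h2 := integral_mul_comp_mul_deriv (w := id) (w' := fun _ => 1) (hpow (2 * k + 1))
    (by fun_prop) (hf.hasDerivAt_deriv_sq_mul ht) (hf.continuous_deriv_deriv_sq_mul ht) hP2'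
    hasDerivAt_id continuous_const rfl
  have h3 := integral_mul_comp_mul_deriv (w := id) (w' := fun _ => 1) (hpow (2 * k))
    (by fun_prop) (hf.hasDerivAt_sq_mul ht) (hf.continuous_deriv_sq_mul ht) hP2
    hasDerivAt_id continuous_const rfl
  simp only [one_mul, id, mul_assoc, integral_const_mul] at h1 h2 h3
  have hi1 : Integrable fun x => (x - xstar) ^ (2 * k + 2) * (drift β α (f x t) +
      (x - xstar) * (driftDeriv β α (f x t) * deriv (fun y => f y t) x)) :=
    integrable_of_continuous_of_eq_zero (R := R) (by fun_prop) fun x hx => by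
      rw [deriv_eq_zero_of_eq_zero hP1d hP1 x hx, mul_zero]
  have hi2 : Integrable fun x => (x - xstar) ^ (2 * k + 2) *
      deriv (deriv fun y => (y - xstar) ^ 2 * f y t) x :=
    integrable_of_continuous_of_eq_zero (R := R)
      (Continuous.mul (by fun_prop) (hf.continuous_deriv_deriv_sq_mul ht)) fun x hx => by
      rw [hP2'' x hx, mul_zero]
  have h4 : ∫ x, (x - xstar) ^ (2 * k + 2) * derivWithin (fun s => f x s) (Icc 0 T) t =
      lam * (∫ x, (x - xstar) ^ (2 * k + 2) * (drift β α (f x t) +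
        (x - xstar) * (driftDeriv β α (f x t) * deriv (fun y => f y t) x))) +
      σ ^ 2 / 2 * ∫ x, (x - xstar) ^ (2 * k + 2) *
        deriv (deriv fun y => (y - xstar) ^ 2 * f y t) x := by
    rw [← integral_const_mul, ← integral_const_mul,
      ← integral_add (hi1.const_mul _) (hi2.const_mul _)]
    refine integral_congr_ae (ae_of_all _ fun x => ?_)
    simp only [hf.2.2.2.2 x t ht, hf.deriv_drift hα ht x]
    ring
  have h5 : ∀ w : ℝ → ℝ, (fun x => (x - xstar) ^ (2 * k) * ((x - xstar) ^ 2 * w x)) =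
      fun x => (x - xstar) ^ (2 * k + 2) * w x := fun w => by
    funext x
    ring
  have h6 : ∀ w : ℝ → ℝ, (fun x => (x - xstar) ^ (2 * k + 1) * ((x - xstar) * w x)) =
      fun x => (x - xstar) ^ (2 * k + 2) * w x := fun w => by
    funext x
    ring
  rw [h5] at h3
  rw [h6] at h1
  rw [h4, h1, h2, h3]
  push_cast
  ring

end IsClassicalSolution

end Diffusion

section Growth

/-- A differential inequality of Grönwall type, giving a lower bound. -/
theorem mul_exp_le_of_hasDerivAt {M M' : ℝ → ℝ} {C c d : ℝ} (hcd : c ≤ d)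
    (hM : ∀ t ∈ Icc c d, HasDerivAt M (M' t) t) (h : ∀ t ∈ Icc c d, C * M t ≤ M' t) :
    M c * Real.exp (C * (d - c)) ≤ M d := by
  have hd : ∀ t ∈ Icc c d, HasDerivAt (fun t => M t * Real.exp (-(C * (t - c))))
      ((M' t - C * M t) * Real.exp (-(C * (t - c)))) t := fun t ht => by
    have h1 : HasDerivAt (fun t => -(C * (t - c))) (-C) t := by
      simpa using (((hasDerivAt_id t).sub_const c).const_mul C).fun_neg
    exact ((hM t ht).fun_mul h1.exp).congr_deriv (by ring)
  have hmono : MonotoneOn (fun t => M t * Real.exp (-(C * (t - c)))) (Icc c d) := by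
    refine monotoneOn_of_deriv_nonneg (convex_Icc c d)
      (fun t ht => (hd t ht).continuousAt.continuousWithinAt)
      (fun t ht => (hd t (interior_subset ht)).differentiableAt.differentiableWithinAt)
      fun t ht => ?_
    rw [(hd t (interior_subset ht)).deriv]
    exact mul_nonneg (sub_nonneg.2 (h t (interior_subset ht))) (Real.exp_pos _).le
  have := hmono (left_mem_Icc.2 hcd) (right_mem_Icc.2 hcd) hcd
  simp only [sub_self, mul_zero, neg_zero, Real.exp_zero, mul_one, Real.exp_neg,
    ← div_eq_mul_inv] at this
  exact (le_div_iff₀ (Real.exp_pos _)).1 this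

namespace IsClassicalSolution

variable {lam β σ α xstar T : ℝ} {f : ℝ → ℝ → ℝ}

/-- By Baire's theorem, separate regularity gives uniform bounds on short time intervals. -/
theorem exists_ball_bound (hf : IsClassicalSolution lam β σ α xstar T f) (hα : 0 < α) (hT : 0 < T)
    {x₀ t₀ : ℝ} (ht₀ : t₀ ∈ Icc 0 T) (h₀ : 0 < f x₀ t₀) :
    ∃ t₁ ε, 0 < ε ∧ Metric.ball t₁ ε ⊆ Ioo 0 T ∧ 0 < f x₀ t₁ ∧ ∃ n : ℝ, ∀ t ∈ Metric.ball t₁ ε,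
      ∀ x, f x t ≤ n ∧ |derivWithin (fun s => f x s) (Icc 0 T) t| ≤ n := by
  obtain ⟨R, hR⟩ := hf.exists_eq_zero_of_lt_abs
  set A : ℕ → Set ℝ := fun n => {t | ∀ x, f x (clamp T t) ≤ n ∧
    |derivWithin (fun s => f x s) (Icc 0 T) (clamp T t)| ≤ n} with hA
  have hclosed : ∀ n, IsClosed (A n) := fun n => by
    simp only [hA, ofPred_forall]
    exact isClosed_iInter fun x => (isClosed_le (hf.continuous_t hT.le x) continuous_const).inter
      (isClosed_le (hf.continuous_derivWithin hT x).abs continuous_const)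
  have hbdd : ∀ h : ℝ → ℝ, Continuous h → (∀ x, R < |x| → h x = 0) → ∃ B, ∀ x, |h x| ≤ B :=
    fun h hc hz => by
      obtain ⟨B, hB⟩ := (isCompact_Icc (a := -R) (b := R)).exists_bound_of_continuousOn
        hc.continuousOn
      refine ⟨max B 0, fun x => ?_⟩
      by_cases hx : |x| ≤ R
      · exact (hB x (abs_le.1 hx)).trans (le_max_left _ _)
      · rw [hz x (not_le.1 hx), abs_zero]
        exact le_max_right _ _
  have hcover : ⋃ n, A n = univ := eq_univ_of_forall fun t => by
    have ht := clamp_mem hT.le t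
    obtain ⟨B₁, hB₁⟩ := hbdd _ (hf.contDiff ht).continuous (hR _ ht)
    obtain ⟨B₂, hB₂⟩ := hbdd _ (hf.continuous_rate hα ht) fun x hx => rate_eq_zero hR ht hx
    obtain ⟨n, hn⟩ := exists_nat_ge (max B₁ B₂)
    exact mem_iUnion.2 ⟨n, fun x => ⟨(le_abs_self _).trans ((hB₁ x).trans
      ((le_max_left _ _).trans hn)), (hB₂ x).trans ((le_max_right _ _).trans hn)⟩⟩
  have hdense := dense_iUnion_interior_of_closed hclosed hcover
  have hpos : IsOpen {t | 0 < f x₀ (clamp T t)} :=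
    isOpen_lt continuous_const (hf.continuous_t hT.le x₀)
  have hne : ({t | 0 < f x₀ (clamp T t)} ∩ Ioo 0 T).Nonempty :=
    mem_closure_iff.1 (by rwa [closure_Ioo hT.ne]) _ hpos
      (show 0 < f x₀ (clamp T t₀) by rwa [clamp_of_mem ht₀])
  obtain ⟨t₁, ⟨h1, h2⟩, h3⟩ := hdense.inter_open_nonempty _ (hpos.inter isOpen_Ioo) hne
  obtain ⟨n, hn⟩ := mem_iUnion.1 h3
  obtain ⟨ε, hε, hball⟩ := Metric.isOpen_iff.1 (isOpen_interior.inter isOpen_Ioo) t₁ ⟨hn, h2⟩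
  refine ⟨t₁, ε, hε, fun t ht => (hball ht).2, ?_, n, fun t ht x => ?_⟩
  · rwa [mem_ofPred_eq, clamp_of_mem (Ioo_subset_Icc_self h2)] at h1
  · have := interior_subset (hball ht).1 x
    rwa [clamp_of_mem (Ioo_subset_Icc_self (hball ht).2)] at this

theorem hasDerivAt_integral_pow_mul (hf : IsClassicalSolution lam β σ α xstar T f) (hα : 0 < α)
    {t₁ ε n : ℝ} (hsub : Metric.ball t₁ ε ⊆ Ioo 0 T) (hn : ∀ t ∈ Metric.ball t₁ ε,
      ∀ x, |derivWithin (fun s => f x s) (Icc 0 T) t| ≤ n) (m : ℕ) {t : ℝ}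
    (ht : t ∈ Metric.ball t₁ ε) :
    HasDerivAt (fun s => ∫ x, (x - xstar) ^ m * f x (clamp T s))
      (∫ x, (x - xstar) ^ m * derivWithin (fun s => f x s) (Icc 0 T) t) t := by
  obtain ⟨R, hR⟩ := hf.exists_eq_zero_of_lt_abs
  have hmem : ∀ s ∈ Metric.ball t₁ ε, s ∈ Icc 0 T := fun s hs => Ioo_subset_Icc_self (hsub hs)
  have hT : 0 ≤ T := (hmem t ht).1.trans (hmem t ht).2
  have hc : ∀ s, Continuous fun x => (x - xstar) ^ m * f x (clamp T s) := fun s => by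
    have := (hf.contDiff (clamp_mem hT s)).continuous
    fun_prop
  have hc' : Continuous fun x => (x - xstar) ^ m * derivWithin (fun s => f x s) (Icc 0 T) t := by
    have := hf.continuous_rate hα (hmem t ht)
    fun_prop
  refine (hasDerivAt_integral_of_dominated_loc_of_deriv_le
    (F' := fun s x => (x - xstar) ^ m * derivWithin (fun s => f x s) (Icc 0 T) s)
    (bound := (Icc (-R) R).indicator fun x => |x - xstar| ^ m * n)
    (Metric.isOpen_ball.mem_nhds ht)
    (Eventually.of_forall fun s => (hc s).aestronglyMeasurable)
    (integrable_of_continuous_of_eq_zero (R := R) (hc t) fun x hx => by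
      rw [hR _ (clamp_mem hT t) x hx, mul_zero])
    hc'.aestronglyMeasurable
    (ae_of_all _ fun x s hs => ?_) ?_
    (ae_of_all _ fun x s hs => ?_)).2
  · by_cases hx : |x| ≤ R
    · rw [indicator_of_mem (show x ∈ Icc (-R) R from abs_le.1 hx), norm_mul, norm_pow]
      exact mul_le_mul_of_nonneg_left (hn s hs x) (by positivity)
    · rw [indicator_of_notMem (fun h : x ∈ Icc (-R) R => hx (abs_le.2 h)),
        rate_eq_zero hR (hmem s hs) (not_le.1 hx)]
      simp
  · exact (Continuous.integrableOn_Icc (by fun_prop)).integrable_indicator measurableSet_Icc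
  · have := (hf.hasDerivAt_t x (hsub hs)).const_mul ((x - xstar) ^ m)
    rwa [clamp_of_mem (hmem s hs)] at this

/-- High moments grow at least exponentially, with a rate quadratic in the order. -/
theorem integral_pow_mul_mul_exp_le (hf : IsClassicalSolution lam β σ α xstar T f) (hlam : 0 < lam)
    (hβ : 0 < β) (hα : 0 < α) {t₁ ε n : ℝ} (hsub : Metric.ball t₁ ε ⊆ Ioo 0 T)
    (hn : ∀ t ∈ Metric.ball t₁ ε, ∀ x, f x t ≤ n ∧
      |derivWithin (fun s => f x s) (Icc 0 T) t| ≤ n) (k : ℕ) {c d : ℝ} (hcd : c ≤ d)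
    (hI : Icc c d ⊆ Metric.ball t₁ ε) :
    (∫ x, (x - xstar) ^ (2 * k + 2) * f x c) *
      Real.exp (((2 * k + 2) * (σ ^ 2 / 2 * (2 * k + 1)) -
        (2 * k + 2) * (lam * (1 + β * n ^ α))) * (d - c)) ≤
      ∫ x, (x - xstar) ^ (2 * k + 2) * f x d := by
  have hmem : ∀ s ∈ Icc c d, s ∈ Icc 0 T := fun s hs => Ioo_subset_Icc_self (hsub (hI hs))
  have := mul_exp_le_of_hasDerivAt hcd
    (C := (2 * k + 2) * (σ ^ 2 / 2 * (2 * k + 1)) - (2 * k + 2) * (lam * (1 + β * n ^ α)))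
    (fun t ht => hf.hasDerivAt_integral_pow_mul hα hsub (fun t ht x => (hn t ht x).2) (2 * k + 2)
      (hI ht)) fun t ht => ?_
  · rwa [clamp_of_mem (hmem c (left_mem_Icc.2 hcd)),
      clamp_of_mem (hmem d (right_mem_Icc.2 hcd))] at this
  have ht' := hmem t ht
  rw [hf.integral_pow_mul_rate hα ht', clamp_of_mem ht']
  have hdrift : ∫ x, (x - xstar) ^ (2 * k + 2) * drift β α (f x t) ≤
      (1 + β * n ^ α) * ∫ x, (x - xstar) ^ (2 * k + 2) * f x t := by
    rw [← integral_const_mul]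
    refine integral_mono
      (hf.integrable_mul ht' (by fun_prop) (continuous_drift hα) (drift_zero hα))
      ((hf.integrable_mul ht' (w := id) (by fun_prop) continuous_id rfl).const_mul _) fun x => ?_
    have h0 := hf.nonneg ht' x
    have h1 : f x t ^ α ≤ n ^ α := Real.rpow_le_rpow h0 (hn t (hI ht) x).1 hα.le
    have h2 : 0 ≤ (x - xstar) ^ (2 * k + 2) := Even.pow_nonneg ⟨k + 1, by ring⟩ _
    rw [← mul_eq_drift hα h0, mul_left_comm]
    gcongr
  have : (lam * (2 * k + 2)) * ∫ x, (x - xstar) ^ (2 * k + 2) * drift β α (f x t) ≤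
      (lam * (2 * k + 2)) * ((1 + β * n ^ α) * ∫ x, (x - xstar) ^ (2 * k + 2) * f x t) := by
    gcongr
  linarith

/-- In the presence of diffusion, only the trivial solution keeps its support in a fixed
compact set. -/
theorem eq_zero_of_sigma_pos (hf : IsClassicalSolution lam β σ α xstar T f) (hlam : 0 < lam)
    (hβ : 0 < β) (hα : 0 < α) (hT : 0 < T) (hσ : 0 < σ) {t : ℝ} (ht : t ∈ Icc 0 T) (x : ℝ) :
    f x t = 0 := by
  by_contra hne
  obtain ⟨c, ε, hε, hsub, hpos, n, hn⟩ :=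
    hf.exists_ball_bound hα hT ht ((hf.nonneg ht x).lt_of_ne' hne)
  obtain ⟨R, hR⟩ := hf.exists_eq_zero_of_lt_abs
  have hI : Icc c (c + ε / 2) ⊆ Metric.ball c ε := fun s hs => by
    rw [Metric.mem_ball, Real.dist_eq, abs_lt]
    constructor <;> linarith [hs.1, hs.2]
  have hc : c ∈ Icc 0 T := Ioo_subset_Icc_self (hsub (Metric.mem_ball_self hε))
  have hd : c + ε / 2 ∈ Icc 0 T :=
    Ioo_subset_Icc_self (hsub (hI (right_mem_Icc.2 (by linarith))))
  have hfc := (hf.contDiff hc).continuous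
  obtain ⟨x₁, hx₁, hne₁⟩ := (dense_compl_singleton xstar).inter_open_nonempty _
    (isOpen_lt continuous_const hfc) ⟨x, hpos⟩
  have hx₁s : 0 < (x₁ - xstar) ^ 2 := by
    have : x₁ - xstar ≠ 0 := sub_ne_zero.2 hne₁
    positivity
  set r := (x₁ - xstar) ^ 2 / 2 with hr
  have hr0 : 0 < r := by positivity
  have hφi : Integrable fun y => max ((y - xstar) ^ 2 - r) 0 * f y c :=
    hf.integrable_mul hc (w := id) (by fun_prop) continuous_id rfl
  have hκ : 0 < ∫ y, max ((y - xstar) ^ 2 - r) 0 * f y c := by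
    refine (Continuous.integral_pos_of_hasCompactSupport_nonneg_nonzero (x := x₁) (by fun_prop)
      (HasCompactSupport.intro (isCompact_Icc (a := -R) (b := R)) fun y hy => ?_)
      (fun y => mul_nonneg (le_max_right _ _) (hf.nonneg hc y)) ?_)
    · rw [hR c hc y (not_le.1 fun h => hy (abs_le.1 h)), mul_zero]
    · refine (mul_pos (lt_max_of_lt_left ?_) hx₁).ne'
      linarith
  have hN : 0 ≤ ∫ y, (y - xstar) ^ 2 * f y (c + ε / 2) :=
    integral_nonneg fun y => mul_nonneg (sq_nonneg _) (hf.nonneg hd y)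
  obtain ⟨k, hk⟩ := exists_pow_mul_lt_mul_exp hκ hr0 (half_pos hε)
    (show 0 < σ ^ 2 / 2 by positivity) (sq_nonneg (R + |xstar|)) hN (lam * (1 + β * n ^ α))
  have hgrowth := hf.integral_pow_mul_mul_exp_le hlam hβ hα hsub hn k
    (by linarith : c ≤ c + ε / 2) hI
  rw [add_sub_cancel_left] at hgrowth
  have hmi : ∀ {s}, s ∈ Icc 0 T → ∀ m : ℕ, Integrable fun y => (y - xstar) ^ m * f y s :=
    fun hs m => hf.integrable_mul hs (w := id) (by fun_prop) continuous_id rfl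
  have hlower : r ^ k * (∫ y, max ((y - xstar) ^ 2 - r) 0 * f y c) ≤
      ∫ y, (y - xstar) ^ (2 * k + 2) * f y c := by
    rw [← integral_const_mul]
    refine integral_mono (hφi.const_mul _) (hmi hc _) fun y => ?_
    rw [← mul_assoc, pow_add, pow_mul]
    refine mul_le_mul_of_nonneg_right ?_ (hf.nonneg hc y)
    rcases le_total ((y - xstar) ^ 2) r with h | h
    · rw [max_eq_right (sub_nonpos.2 h), mul_zero]
      positivity
    · rw [max_eq_left (sub_nonneg.2 h)]
      gcongr
      linarith
  have hupper : ∫ y, (y - xstar) ^ (2 * k + 2) * f y (c + ε / 2) ≤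
      ((R + |xstar|) ^ 2) ^ k * ∫ y, (y - xstar) ^ 2 * f y (c + ε / 2) := by
    rw [← integral_const_mul]
    refine integral_mono (hmi hd _) ((hmi hd 2).const_mul _) fun y => ?_
    rcases lt_or_ge R |y| with h | h
    · simp [hR _ hd y h]
    · rw [← mul_assoc, pow_add, pow_mul]
      refine mul_le_mul_of_nonneg_right (mul_le_mul_of_nonneg_right (pow_le_pow_left₀
        (sq_nonneg _) ?_ k) (sq_nonneg _)) (hf.nonneg hd y)
      rw [← sq_abs (y - xstar)]
      exact pow_le_pow_left₀ (abs_nonneg _) ((abs_sub _ _).trans (by linarith)) 2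
  have := mul_le_mul_of_nonneg_right hlower (Real.exp_pos (((2 * k + 2) *
    (σ ^ 2 / 2 * (2 * k + 1)) - (2 * k + 2) * (lam * (1 + β * n ^ α))) * (ε / 2))).le
  linarith

end IsClassicalSolution

end Growth

end

/-- For a classical solution of the superlinear consensus Fokker–Planck
equation, the second moment `V(t) = ∫ (x - x_*)² f(x,t) dx` satisfies, for every
`t ∈ [0,T]`, the identity
`dV/dt(t) = (σ² - 2λ) V(t) - 2λβ ∫ (x - x_*)² f(x,t)^{α+1} dx`. -/
theorem second_moment_evolution (lam β σ α xstar T : ℝ) (hlam : 0 < lam) (hβ : 0 < β)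
    (hσ : 0 ≤ σ) (hα : 0 < α) (hT : 0 ≤ T) (f : ℝ → ℝ → ℝ)
    (hf : IsClassicalSolution lam β σ α xstar T f) :
    ∀ t ∈ Icc (0 : ℝ) T,
      HasDerivWithinAt (fun s => ∫ x, (x - xstar) ^ 2 * f x s)
        ((σ ^ 2 - 2 * lam) * (∫ x, (x - xstar) ^ 2 * f x t) -
          2 * lam * β * ∫ x, (x - xstar) ^ 2 * f x t ^ (α + 1))
        (Icc 0 T) t := by
  intro t ht
  rcases hT.eq_or_lt with rfl | hT
  · rw [Icc_self]
    obtain rfl : t = 0 := by simpa using ht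
    exact HasFDerivWithinAt.of_subsingleton subsingleton_singleton
  rcases hσ.eq_or_lt with rfl | hσ
  · exact (hf.hasDerivWithinAt_of_sigma_eq_zero hlam hβ hα hT ht).congr_deriv (by ring)
  · have hz := fun s hs => hf.eq_zero_of_sigma_pos (t := s) hlam hβ hα hT hσ hs
    refine ((hasDerivWithinAt_const t (Icc 0 T) (0 : ℝ)).congr_of_mem
      (fun s hs => ?_) ht).congr_deriv ?_
    · simp [hz s hs]
    · simp [hz t ht, Real.zero_rpow (by linarith : α + 1 ≠ 0)]
end

section
/- Let α > 2, x_* ∈ ℝ, and let f : ℝ → ℝ be a nonnegative measurable function with ρ := ∫_ℝ f(x) dx, V := ∫_ℝ (x − x_*)² f(x) dx and A := ∫_ℝ (x − x_*)² f(x)^{α+1} dx. If V > 0, then A ≥ ρ^{3α/2} / ( (c_α d_α + d_α^{−2})^{3α/2} · V^{(α−2)/2} ), where c_α := 2α/(α−2) and d_α := (2(α+1)/(c_α(α−2)))^{1/3}. -/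
open MeasureTheory Real

/-- The constant `c_α = 2α/(α-2)`. -/
noncomputable def cConst (α : ℝ) : ℝ := 2 * α / (α - 2)

/-- The constant `d_α = (2(α+1)/(c_α (α-2)))^{1/3}`. -/
noncomputable def dConst (α : ℝ) : ℝ := (2 * (α + 1) / (cConst α * (α - 2))) ^ ((1 : ℝ) / 3)

theorem lintegral_abs_rpow_ball_le {p r : ℝ} (hp : -1 < p) (hr : 0 < r) :
    ∫⁻ x in Set.Ioo (-r) r, ENNReal.ofReal (|x| ^ p) ≤
      ENNReal.ofReal (2 * (r ^ (p + 1) / (p + 1))) := by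
  have hpos : ∫⁻ x in Set.Ioc 0 r, ENNReal.ofReal (|x| ^ p) =
      ENNReal.ofReal (r ^ (p + 1) / (p + 1)) := by
    have hint : IntegrableOn (fun x : ℝ => x ^ p) (Set.Ioc 0 r) :=
      (intervalIntegrable_iff_integrableOn_Ioc_of_le hr.le).1
        (intervalIntegral.intervalIntegrable_rpow' hp)
    have hval : ∫ x in Set.Ioc 0 r, x ^ p = r ^ (p + 1) / (p + 1) := by
      rw [← intervalIntegral.integral_of_le hr.le, integral_rpow (Or.inl hp),
        Real.zero_rpow (by linarith), sub_zero]
    rw [← hval, ofReal_integral_eq_lintegral_ofReal hint]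
    · refine setLIntegral_congr_fun measurableSet_Ioc fun x hx => ?_
      simp only [abs_of_pos hx.1]
    · filter_upwards [ae_restrict_mem measurableSet_Ioc] with x hx
      exact Real.rpow_nonneg hx.1.le _
  have hneg : ∫⁻ x in Set.Ico (-r) 0, ENNReal.ofReal (|x| ^ p) =
      ∫⁻ x in Set.Ioc 0 r, ENNReal.ofReal (|x| ^ p) := by
    have h := (Measure.measurePreserving_neg (volume : Measure ℝ)).setLIntegral_comp_preimage_emb
      (MeasurableEquiv.neg ℝ).measurableEmbedding (fun x : ℝ => ENNReal.ofReal (|x| ^ p))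
      (Set.Ioc 0 r)
    simpa using h
  have hsub : Set.Ioo (-r) r ⊆ (Set.Ico (-r) 0 ∪ Set.Ioc 0 r) ∪ {0} := by
    intro x hx
    rcases lt_trichotomy x 0 with h | h | h
    · exact Or.inl (Or.inl ⟨hx.1.le, h⟩)
    · exact Or.inr h
    · exact Or.inl (Or.inr ⟨h, hx.2.le⟩)
  calc ∫⁻ x in Set.Ioo (-r) r, ENNReal.ofReal (|x| ^ p)
      ≤ ∫⁻ x in (Set.Ico (-r) 0 ∪ Set.Ioc 0 r) ∪ {0}, ENNReal.ofReal (|x| ^ p) :=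
        lintegral_mono_set hsub
    _ ≤ ∫⁻ x in Set.Ico (-r) 0 ∪ Set.Ioc 0 r, ENNReal.ofReal (|x| ^ p) := by
        refine (lintegral_union_le _ _ _).trans ?_
        simp
    _ ≤ _ := lintegral_union_le _ _ _
    _ = _ := by
        have : 0 ≤ r ^ (p + 1) / (p + 1) := div_nonneg (by positivity) (by linarith)
        rw [hneg, hpos, ← ENNReal.ofReal_add this this, two_mul]

/-- Hölder's inequality against the weight `x ^ 2` on an interval centred at the origin. -/
theorem setLIntegral_le_weighted_moment {α r : ℝ} (hα : 2 < α) (hr : 0 < r)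
    {g : ℝ → ENNReal} (hg : Measurable g) :
    ∫⁻ x in Set.Ioo (-r) r, g x ≤
      (∫⁻ x, ENNReal.ofReal (x ^ 2) * g x ^ (α + 1)) ^ (1 / (α + 1)) *
        ENNReal.ofReal (cConst α * r ^ ((α - 2) / α)) ^ (α / (α + 1)) := by
  have hα0 : 0 < α := by linarith
  have hα1 : 0 < α + 1 := by linarith
  have hα2 : 0 < α - 2 := by linarith
  have hpq : (α + 1).HolderConjugate ((α + 1) / α) := by
    rw [Real.holderConjugate_iff]
    refine ⟨by linarith, ?_⟩
    field_simp
    ring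
  have hweight : ∫⁻ x in Set.Ioo (-r) r, ENNReal.ofReal (|x| ^ (-2 / α)) ≤
      ENNReal.ofReal (cConst α * r ^ ((α - 2) / α)) := by
    have hp : -1 < -2 / α := by rw [lt_div_iff₀ hα0]; linarith
    refine (lintegral_abs_rpow_ball_le hp hr).trans_eq ?_
    have he : -2 / α + 1 = (α - 2) / α := by field_simp; ring
    rw [he, cConst]
    congr 1
    field_simp
  have hholder := ENNReal.lintegral_mul_le_Lp_mul_Lq (volume.restrict (Set.Ioo (-r) r)) hpq
    (f := fun x => (ENNReal.ofReal (x ^ 2) * g x ^ (α + 1)) ^ (1 / (α + 1)))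
    (g := fun x => ENNReal.ofReal (|x| ^ (-2 / (α + 1))))
    (by fun_prop) (by fun_prop)
  have hf : ∀ x : ℝ, ((ENNReal.ofReal (x ^ 2) * g x ^ (α + 1)) ^ (1 / (α + 1))) ^ (α + 1) =
      ENNReal.ofReal (x ^ 2) * g x ^ (α + 1) := by
    intro x
    rw [← ENNReal.rpow_mul, one_div_mul_cancel hα1.ne', ENNReal.rpow_one]
  have hw : ∀ x : ℝ, ENNReal.ofReal (|x| ^ (-2 / (α + 1))) ^ ((α + 1) / α) =
      ENNReal.ofReal (|x| ^ (-2 / α)) := by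
    intro x
    rw [ENNReal.ofReal_rpow_of_nonneg (by positivity) (by positivity),
      ← Real.rpow_mul (abs_nonneg x)]
    congr 2
    field_simp
  simp only [hf, hw] at hholder
  calc ∫⁻ x in Set.Ioo (-r) r, g x
      = ∫⁻ x in Set.Ioo (-r) r, ((fun x => (ENNReal.ofReal (x ^ 2) * g x ^ (α + 1)) ^
          (1 / (α + 1))) * fun x => ENNReal.ofReal (|x| ^ (-2 / (α + 1)))) x := by
        refine lintegral_congr_ae ?_
        filter_upwards [ae_restrict_of_ae (Measure.ae_ne volume (0 : ℝ))] with x hx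
        have hx' : 0 < |x| := abs_pos.2 hx
        simp only [Pi.mul_apply]
        rw [ENNReal.mul_rpow_of_nonneg _ _ (by positivity), ← ENNReal.rpow_mul,
          mul_one_div_cancel hα1.ne', ENNReal.rpow_one,
          ENNReal.ofReal_rpow_of_nonneg (by positivity) (by positivity), ← sq_abs,
          ← Real.rpow_natCast, ← Real.rpow_mul hx'.le, mul_right_comm,
          ← ENNReal.ofReal_mul (by positivity), ← Real.rpow_add hx']
        have he : ((2 : ℕ) : ℝ) * (1 / (α + 1)) + -2 / (α + 1) = 0 := by
          push_cast; ring
        rw [he, Real.rpow_zero, ENNReal.ofReal_one, one_mul]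
    _ ≤ _ := hholder
    _ ≤ _ := by
        rw [one_div_div]
        gcongr
        exact Measure.restrict_le_self

theorem setLIntegral_compl_le_second_moment {r : ℝ} (hr : 0 < r) {g : ℝ → ENNReal} :
    ∫⁻ x in (Set.Ioo (-r) r)ᶜ, g x ≤
      (∫⁻ x, ENNReal.ofReal (x ^ 2) * g x) * ENNReal.ofReal (r ^ (-2 : ℝ)) := by
  rw [← lintegral_mul_const' _ _ ENNReal.ofReal_ne_top]
  refine le_trans ?_ (setLIntegral_le_lintegral (Set.Ioo (-r) r)ᶜ _)
  refine setLIntegral_mono' measurableSet_Ioo.compl fun x hx => ?_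
  have hx' : r ≤ |x| := by
    by_contra! h
    exact hx (abs_lt.1 h)
  rw [mul_right_comm, ← ENNReal.ofReal_mul (by positivity)]
  refine le_mul_of_one_le_left zero_le ?_
  rw [ENNReal.one_le_ofReal, Real.rpow_neg hr.le, Real.rpow_two, ← sq_abs,
    ← div_eq_mul_inv, one_le_div (by positivity)]
  gcongr

theorem two_lt_cConst {α : ℝ} (hα : 2 < α) : 2 < cConst α := by
  rw [cConst, lt_div_iff₀ (by linarith)]
  linarith

theorem one_le_dConst {α : ℝ} (hα : 2 < α) : 1 ≤ dConst α := by
  have h : 2 * (α + 1) / (cConst α * (α - 2)) = (α + 1) / α := by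
    have : α - 2 ≠ 0 := by linarith
    rw [cConst]
    field_simp
  rw [dConst, h]
  refine Real.one_le_rpow ?_ (by norm_num)
  rw [one_le_div (by linarith)]
  linarith

/-- The two-term bound evaluated at the radius `d_α v^{(α+1)/(3α)} a^{-1/(3α)}`. -/
theorem two_term_bound_at_radius {α a v r : ℝ} (hα : 2 < α) (ha : 0 < a) (hv : 0 < v)
    (hr : r = dConst α * v ^ ((α + 1) / (3 * α)) * a ^ (-1 / (3 * α))) :
    a ^ (1 / (α + 1)) * (cConst α * r ^ ((α - 2) / α)) ^ (α / (α + 1)) + v * r ^ (-2 : ℝ) ≤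
      (cConst α * dConst α + dConst α ^ (-2 : ℝ)) *
        (v ^ ((α - 2) / (3 * α)) * a ^ (2 / (3 * α))) := by
  have hα0 : 0 < α := by linarith
  have hα1 : 0 < α + 1 := by linarith
  have hα2 : 0 < α - 2 := by linarith
  have hc := two_lt_cConst hα
  have hd := one_le_dConst hα
  generalize cConst α = c at *
  generalize dConst α = d at *
  have hc0 : 0 < c := by linarith
  have hd0 : 0 < d := by linarith
  have hsplit (s : ℝ) : r ^ s =
      d ^ s * v ^ ((α + 1) / (3 * α) * s) * a ^ (-1 / (3 * α) * s) := by
    rw [hr, Real.mul_rpow (by positivity) (by positivity),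
      Real.mul_rpow (by positivity) (by positivity), ← Real.rpow_mul hv.le,
      ← Real.rpow_mul ha.le]
  have hr0 : 0 < r := by rw [hr]; positivity
  have hinner : a ^ (1 / (α + 1)) * (c * r ^ ((α - 2) / α)) ^ (α / (α + 1)) =
      (c ^ (α / (α + 1)) * d ^ ((α - 2) / (α + 1))) *
        (v ^ ((α - 2) / (3 * α)) * a ^ (2 / (3 * α))) := by
    have hexp : (α - 2) / α * (α / (α + 1)) = (α - 2) / (α + 1) := by field_simp
    have hv' : (α + 1) / (3 * α) * ((α - 2) / (α + 1)) = (α - 2) / (3 * α) := by field_simp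
    have ha' : 2 / (3 * α) = 1 / (α + 1) + -1 / (3 * α) * ((α - 2) / (α + 1)) := by
      field_simp; ring
    rw [Real.mul_rpow hc0.le (by positivity), ← Real.rpow_mul hr0.le, hexp, hsplit, hv', ha',
      Real.rpow_add ha]
    ring
  have houter : v * r ^ (-2 : ℝ) =
      d ^ (-2 : ℝ) * (v ^ ((α - 2) / (3 * α)) * a ^ (2 / (3 * α))) := by
    have hv' : (α - 2) / (3 * α) = 1 + (α + 1) / (3 * α) * (-2) := by field_simp; ring
    have ha' : -1 / (3 * α) * (-2) = 2 / (3 * α) := by ring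
    rw [hsplit, ha', hv', Real.rpow_add hv, Real.rpow_one]
    ring
  have hcle : c ^ (α / (α + 1)) ≤ c := by
    refine (Real.rpow_le_rpow_of_exponent_le (by linarith) ?_).trans_eq (Real.rpow_one c)
    rw [div_le_one hα1]; linarith
  have hdle : d ^ ((α - 2) / (α + 1)) ≤ d := by
    refine (Real.rpow_le_rpow_of_exponent_le hd ?_).trans_eq (Real.rpow_one d)
    rw [div_le_one hα1]; linarith
  rw [hinner, houter, ← add_mul]
  gcongr

/-- The interpolation inequality for finite, nonzero moments about the origin. -/
theorem lintegral_le_moment_interpolation {α : ℝ} (hα : 2 < α) {g : ℝ → ENNReal}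
    (hg : Measurable g) {V A : ENNReal} (hV : V = ∫⁻ x, ENNReal.ofReal (x ^ 2) * g x)
    (hA : A = ∫⁻ x, ENNReal.ofReal (x ^ 2) * g x ^ (α + 1))
    (hV0 : V ≠ 0) (hV1 : V ≠ ⊤) (hA0 : A ≠ 0) (hA1 : A ≠ ⊤) :
    ∫⁻ x, g x ≤ ENNReal.ofReal (cConst α * dConst α + dConst α ^ (-2 : ℝ)) *
      (V ^ ((α - 2) / (3 * α)) * A ^ (2 / (3 * α))) := by
  have hα0 : 0 < α := by linarith
  have hα2 : 0 < α - 2 := by linarith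
  have hv : 0 < V.toReal := ENNReal.toReal_pos hV0 hV1
  have ha : 0 < A.toReal := ENNReal.toReal_pos hA0 hA1
  have hc : 0 < cConst α := by linarith [two_lt_cConst hα]
  have hd : 0 < dConst α := by linarith [one_le_dConst hα]
  obtain ⟨r, hr⟩ : ∃ r, r = dConst α * V.toReal ^ ((α + 1) / (3 * α)) *
    A.toReal ^ (-1 / (3 * α)) := ⟨_, rfl⟩
  have hr0 : 0 < r := by rw [hr]; positivity
  have hreal := ENNReal.ofReal_le_ofReal (two_term_bound_at_radius hα ha hv hr)
  rw [ENNReal.ofReal_add (by positivity) (by positivity), ENNReal.ofReal_mul (by positivity),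
    ENNReal.ofReal_mul (by positivity), ENNReal.ofReal_mul (by positivity),
    ENNReal.ofReal_mul (by positivity), ← ENNReal.ofReal_rpow_of_pos ha,
    ← ENNReal.ofReal_rpow_of_pos ha, ← ENNReal.ofReal_rpow_of_pos hv,
    ← ENNReal.ofReal_rpow_of_pos (by positivity), ENNReal.ofReal_toReal hV1,
    ENNReal.ofReal_toReal hA1] at hreal
  refine le_trans ?_ hreal
  rw [← lintegral_add_compl g (measurableSet_Ioo (a := -r) (b := r))]
  refine add_le_add ?_ ?_
  · rw [hA]
    exact setLIntegral_le_weighted_moment hα hr0 hg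
  · nth_rewrite 1 [hV]
    exact setLIntegral_compl_le_second_moment hr0

/-- For `α > 2` and a nonnegative measurable `f` on `ℝ` with mass `ρ`,
second moment `V > 0` about `x_*`, and `A = ∫ (x-x_*)² f^{α+1}`, one has the interpolation
lower bound `A ≥ ρ^{3α/2} / ((c_α d_α + d_α^{-2})^{3α/2} V^{(α-2)/2})`.
Integrals are Lebesgue integrals, hence `∫⁻`. -/
theorem interpolation_lower_bound (α xstar : ℝ) (hα : 2 < α)
    (f : ℝ → ℝ) (hf_meas : Measurable f) (hf_nonneg : ∀ x, 0 ≤ f x)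
    (ρ V A : ENNReal)
    (hρ : ρ = ∫⁻ x, ENNReal.ofReal (f x))
    (hV : V = ∫⁻ x, ENNReal.ofReal ((x - xstar) ^ 2 * f x))
    (hA : A = ∫⁻ x, ENNReal.ofReal ((x - xstar) ^ 2 * f x ^ (α + 1)))
    (hVpos : 0 < V) :
    ρ ^ (3 * α / 2) /
        (ENNReal.ofReal (cConst α * dConst α + dConst α ^ (-2 : ℝ)) ^ (3 * α / 2) *
          V ^ ((α - 2) / 2)) ≤ A := by
  have hα0 : 0 < α := by linarith
  have hα2 : 0 < α - 2 := by linarith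
  have hc : 0 < cConst α := by linarith [two_lt_cConst hα]
  have hd : 0 < dConst α := by linarith [one_le_dConst hα]
  have hK : 0 < cConst α * dConst α + dConst α ^ (-2 : ℝ) := by positivity
  obtain ⟨g, hg⟩ : ∃ g : ℝ → ENNReal, g = fun x => ENNReal.ofReal (f (x + xstar)) := ⟨_, rfl⟩
  have hg_meas : Measurable g := by rw [hg]; fun_prop
  have hρ' : ρ = ∫⁻ x, g x := by
    rw [hρ, hg, lintegral_add_right_eq_self (fun x => ENNReal.ofReal (f x)) xstar]
  have hV' : V = ∫⁻ x, ENNReal.ofReal (x ^ 2) * g x := by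
    rw [hV, hg, ← lintegral_add_right_eq_self _ xstar]
    refine lintegral_congr fun x => ?_
    rw [add_sub_cancel_right, ENNReal.ofReal_mul (by positivity)]
  have hA' : A = ∫⁻ x, ENNReal.ofReal (x ^ 2) * g x ^ (α + 1) := by
    rw [hA, hg, ← lintegral_add_right_eq_self _ xstar]
    refine lintegral_congr fun x => ?_
    rw [add_sub_cancel_right, ENNReal.ofReal_mul (by positivity),
      ENNReal.ofReal_rpow_of_nonneg (hf_nonneg _) (by linarith)]
  have hK0 : ENNReal.ofReal (cConst α * dConst α + dConst α ^ (-2 : ℝ)) ^ (3 * α / 2) ≠ 0 := by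
    exact (ENNReal.rpow_pos (ENNReal.ofReal_pos.2 hK) ENNReal.ofReal_ne_top).ne'
  by_cases hV1 : V = ⊤
  · rw [hV1, ENNReal.top_rpow_of_pos (by linarith), ENNReal.mul_top hK0, ENNReal.div_top]
    exact zero_le
  by_cases hA1 : A = ⊤
  · rw [hA1]
    exact le_top
  have hA0 : A ≠ 0 := by
    intro h
    rw [hA', lintegral_eq_zero_iff (by fun_prop)] at h
    refine hVpos.ne' ?_
    rw [hV', lintegral_eq_zero_iff (by fun_prop)]
    filter_upwards [h] with x hx
    have hα1 : ¬ α + 1 < 0 := by linarith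
    have hα1' : 0 < α + 1 := by linarith
    simpa [ENNReal.rpow_eq_zero_iff, hα1, hα1'] using hx
  have h := lintegral_le_moment_interpolation hα hg_meas hV' hA' hVpos.ne' hV1 hA0 hA1
  rw [← hρ'] at h
  refine ENNReal.div_le_of_le_mul' ?_
  refine (ENNReal.rpow_le_rpow h (by positivity : 0 ≤ 3 * α / 2)).trans_eq ?_
  have hv : (α - 2) / (3 * α) * (3 * α / 2) = (α - 2) / 2 := by field_simp
  have ha : 2 / (3 * α) * (3 * α / 2) = 1 := by field_simp
  rw [ENNReal.mul_rpow_of_nonneg _ _ (by positivity), ENNReal.mul_rpow_of_nonneg _ _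
    (by positivity), ← ENNReal.rpow_mul, ← ENNReal.rpow_mul, hv, ha, ENNReal.rpow_one, mul_assoc]
end

section
/- Let α > 2, η ≥ 0, x_* ∈ ℝ, and let f : ℝ → ℝ be a nonnegative measurable function with U := ∫_ℝ |x − x_*|^{2η+2} f(x) dx > 0. Then ∫_ℝ (x − x_*)² |x − x_*|^{2η(α+1)} f(x)^{α+1} dx ≥ ( ∫_ℝ |x − x_*|^{2η} f(x) dx )^{3α/2} / ( (c_α d_α + d_α^{−2})^{3α/2} · U^{(α−2)/2} ), where c_α := 2α/(α−2) and d_α := (2(α+1)/(c_α(α−2)))^{1/3}. -/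
open MeasureTheory Real

/-- The mass of `|x| ^ (-2/α)` on the ball of radius `R`. -/
lemma lintegral_Ioo_abs_rpow {α R : ℝ} (hα : 2 < α) (hR : 0 < R) :
    ∫⁻ x in Set.Ioo (-R) R, ENNReal.ofReal (|x| ^ (-(2 / α))) =
      ENNReal.ofReal (cConst α * R ^ ((α - 2) / α)) := by
  have h2α : 2 / α < 1 := (div_lt_one (by linarith)).2 hα
  have hexp : -(2 / α) + 1 = (α - 2) / α := by field_simp; ring
  have hpos : 0 < (α - 2) / α := div_pos (by linarith) (by linarith)
  have right : ∫⁻ x in Set.Ioc 0 R, ENNReal.ofReal (|x| ^ (-(2 / α))) =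
      ENNReal.ofReal (R ^ ((α - 2) / α) / ((α - 2) / α)) := by
    have hint : IntervalIntegrable (fun x : ℝ => x ^ (-(2 / α))) volume 0 R :=
      intervalIntegral.intervalIntegrable_rpow' (by linarith)
    have hval := integral_rpow (a := 0) (b := R) (r := -(2 / α)) (Or.inl (by linarith))
    rw [hexp, zero_rpow hpos.ne', sub_zero, intervalIntegral.integral_of_le hR.le] at hval
    rw [← hval, ofReal_integral_eq_lintegral_ofReal
      ((intervalIntegrable_iff_integrableOn_Ioc_of_le hR.le).1 hint)]
    · refine setLIntegral_congr_fun measurableSet_Ioc fun x hx => ?_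
      simp only [abs_of_pos hx.1]
    · filter_upwards [ae_restrict_mem measurableSet_Ioc] with x hx
      exact rpow_nonneg hx.1.le _
  have left : ∫⁻ x in Set.Ico (-R) 0, ENNReal.ofReal (|x| ^ (-(2 / α))) =
      ∫⁻ x in Set.Ioc 0 R, ENNReal.ofReal (|x| ^ (-(2 / α))) := by
    have := (Measure.measurePreserving_neg (volume : Measure ℝ)).setLIntegral_comp_preimage_emb
      (Homeomorph.neg ℝ).measurableEmbedding (fun x => ENNReal.ofReal (|x| ^ (-(2 / α))))
      (Set.Ioc 0 R)
    simpa using this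
  have hsplit : Set.Ioo (-R) R =ᵐ[volume] (Set.Ico (-R) 0 ∪ Set.Ioc 0 R : Set ℝ) := by
    have h : Set.Ico (-R) 0 ∪ Set.Icc 0 R = Set.Icc (-R) R :=
      Set.Ico_union_Icc_eq_Icc (by linarith) hR.le
    refine Ioo_ae_eq_Icc.trans ?_
    rw [← h]
    exact (Filter.EventuallyEq.refl _ _).union Ioc_ae_eq_Icc.symm
  rw [setLIntegral_congr hsplit, lintegral_union measurableSet_Ioc, left, right,
    ← ENNReal.ofReal_add (by positivity) (by positivity)]
  · congr 1
    have : α - 2 ≠ 0 := by linarith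
    unfold cConst
    field_simp
    ring
  · exact Set.disjoint_left.2 fun x hx hx' => absurd hx.2 (not_lt.2 hx'.1.le)

/-- Hölder's inequality near the origin. -/
lemma setLIntegral_Ioo_le {α R : ℝ} (hα : 2 < α) (hR : 0 < R) {g : ℝ → ENNReal}
    (hg : Measurable g) :
    ∫⁻ x in Set.Ioo (-R) R, g x ≤
      (∫⁻ x, ENNReal.ofReal (x ^ 2) * g x ^ (α + 1)) ^ (1 / (α + 1)) *
        ENNReal.ofReal (cConst α * R ^ ((α - 2) / α)) ^ (α / (α + 1)) := by
  have hα1 : 0 < α + 1 := by linarith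
  have hα0 : 0 < α := by linarith
  have hconj : (α + 1).HolderConjugate ((α + 1) / α) := by
    rw [Real.holderConjugate_iff]
    exact ⟨by linarith, by field_simp; ring⟩
  have holder := ENNReal.lintegral_mul_le_Lp_mul_Lq (volume.restrict (Set.Ioo (-R) R)) hconj
    (f := fun x => ENNReal.ofReal (|x| ^ (2 / (α + 1))) * g x)
    (g := fun x => ENNReal.ofReal (|x| ^ (-(2 / (α + 1)))))
    (by fun_prop) (by fun_prop)
  have hne : ∀ᵐ x ∂(volume.restrict (Set.Ioo (-R) R)), x ≠ (0 : ℝ) :=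
    ae_restrict_of_ae (by simp [ae_iff])
  calc ∫⁻ x in Set.Ioo (-R) R, g x
      = ∫⁻ x in Set.Ioo (-R) R, ((fun x => ENNReal.ofReal (|x| ^ (2 / (α + 1))) * g x) *
          fun x => ENNReal.ofReal (|x| ^ (-(2 / (α + 1))))) x := by
        refine lintegral_congr_ae ?_
        filter_upwards [hne] with x hx
        have hx' : 0 < |x| := abs_pos.2 hx
        rw [Pi.mul_apply, mul_right_comm, ← ENNReal.ofReal_mul (by positivity),
          ← rpow_add hx', add_neg_cancel, rpow_zero, ENNReal.ofReal_one, one_mul]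
    _ ≤ _ := holder
    _ ≤ _ := by
        rw [← lintegral_Ioo_abs_rpow hα hR, one_div_div]
        gcongr with x x
        · exact Measure.restrict_le_self
        · refine le_of_eq ?_
          rw [ENNReal.mul_rpow_of_nonneg _ _ hα1.le,
            ENNReal.ofReal_rpow_of_nonneg (by positivity) hα1.le, ← rpow_mul (abs_nonneg x),
            div_mul_cancel₀ _ hα1.ne', rpow_two, sq_abs]
        · refine le_of_eq ?_
          rw [ENNReal.ofReal_rpow_of_nonneg (by positivity) (by positivity),
            ← rpow_mul (abs_nonneg x)]
          congr 2
          field_simp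

/-- Chebyshev's inequality away from the origin. -/
lemma setLIntegral_compl_Ioo_le {R : ℝ} (hR : 0 < R) {g : ℝ → ENNReal} :
    ∫⁻ x in (Set.Ioo (-R) R)ᶜ, g x ≤
      (∫⁻ x, ENNReal.ofReal (x ^ 2) * g x) * ENNReal.ofReal (R ^ (-2 : ℝ)) := by
  rw [← lintegral_mul_const' _ _ ENNReal.ofReal_ne_top]
  refine (setLIntegral_mono' measurableSet_Ioo.compl fun x hx => ?_).trans
    (setLIntegral_le_lintegral _ _)
  have hRx : R ≤ |x| := by
    by_contra! h
    exact hx (abs_lt.1 h)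
  rw [mul_right_comm, ← ENNReal.ofReal_mul (by positivity)]
  refine le_mul_of_one_le_left' (ENNReal.one_le_ofReal.2 ?_)
  rw [rpow_neg hR.le, rpow_two, ← div_eq_mul_inv, one_le_div (by positivity), ← sq_abs x]
  gcongr

lemma cConst_pos {α : ℝ} (hα : 2 < α) : 0 < cConst α :=
  div_pos (by linarith) (by linarith)

lemma dConst_pos {α : ℝ} (hα : 2 < α) : 0 < dConst α :=
  rpow_pos_of_pos
    (div_pos (by linarith) (mul_pos (cConst_pos hα) (by linarith))) _

lemma one_le_cConst_mul_dConst_cube {α : ℝ} (hα : 2 < α) : 1 ≤ cConst α * dConst α ^ 3 := by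
  have hc := cConst_pos hα
  have h2 : 0 < α - 2 := by linarith
  have hd : dConst α ^ 3 = 2 * (α + 1) / (cConst α * (α - 2)) := by
    rw [dConst, ← rpow_natCast, ← rpow_mul (div_nonneg (by linarith) (by positivity))]
    norm_num
  rw [hd, mul_div_assoc', mul_div_mul_left _ _ hc.ne', one_le_div h2]
  linarith

/-- The sum of the inner and outer bounds at the radius `d (u ^ (α+1) / k) ^ (1 / (3α))`. -/
lemma exists_radius_bound {α c d u k : ℝ} (hα : 2 < α) (hc : 0 < c) (hd : 0 < d)
    (hcd : 1 ≤ c * d ^ 3) (hu : 0 < u) (hk : 0 < k) :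
    ∃ R > 0, k ^ (1 / (α + 1)) * (c * R ^ ((α - 2) / α)) ^ (α / (α + 1)) + u * R ^ (-2 : ℝ) ≤
      (c * d + d ^ (-2 : ℝ)) * (u ^ ((α - 2) / (3 * α)) * k ^ (2 / (3 * α))) := by
  obtain ⟨γ, rfl⟩ : ∃ γ, exp γ = c := ⟨log c, exp_log hc⟩
  obtain ⟨δ, rfl⟩ : ∃ δ, exp δ = d := ⟨log d, exp_log hd⟩
  obtain ⟨a, rfl⟩ : ∃ a, exp a = u := ⟨log u, exp_log hu⟩
  obtain ⟨b, rfl⟩ : ∃ b, exp b = k := ⟨log k, exp_log hk⟩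
  have hγδ : 0 ≤ γ + 3 * δ := by
    rw [← exp_nat_mul, ← exp_add, one_le_exp_iff] at hcd
    exact_mod_cast hcd
  have hα0 : 0 < α := by linarith
  have hα1 : 0 < α + 1 := by linarith
  refine ⟨exp (δ + ((α + 1) * a - b) / (3 * α)), exp_pos _, ?_⟩
  rw [add_mul (exp γ * exp δ)]
  simp only [← exp_mul, ← exp_add]
  refine add_le_add (exp_le_exp.2 ?_) (exp_le_exp.2 (le_of_eq ?_))
  · have key : γ + δ + (a * ((α - 2) / (3 * α)) + b * (2 / (3 * α))) -
        (b * (1 / (α + 1)) + (γ + (δ + ((α + 1) * a - b) / (3 * α)) * ((α - 2) / α)) *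
          (α / (α + 1))) = (γ + 3 * δ) / (α + 1) := by
      field_simp
      ring
    have := div_nonneg hγδ hα1.le
    linarith
  · field_simp
    ring

/-- Interpolation of the mass between the second moment and a weighted `L^(α+1)` norm. -/
lemma lintegral_rpow_le_of_second_moment {α : ℝ} (hα : 2 < α) {g : ℝ → ENNReal}
    (hg : Measurable g) (hU0 : ∫⁻ x, ENNReal.ofReal (x ^ 2) * g x ≠ 0)
    (hUtop : ∫⁻ x, ENNReal.ofReal (x ^ 2) * g x ≠ ⊤)
    (hKtop : ∫⁻ x, ENNReal.ofReal (x ^ 2) * g x ^ (α + 1) ≠ ⊤) :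
    (∫⁻ x, g x) ^ (3 * α / 2) ≤
      (∫⁻ x, ENNReal.ofReal (x ^ 2) * g x ^ (α + 1)) *
        (ENNReal.ofReal (cConst α * dConst α + dConst α ^ (-2 : ℝ)) ^ (3 * α / 2) *
          (∫⁻ x, ENNReal.ofReal (x ^ 2) * g x) ^ ((α - 2) / 2)) := by
  have hα0 : 0 < α := by linarith
  have hα1 : 0 < α + 1 := by linarith
  have hc := cConst_pos hα
  have hd := dConst_pos hα
  have hK0 : ∫⁻ x, ENNReal.ofReal (x ^ 2) * g x ^ (α + 1) ≠ 0 := by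
    contrapose! hU0
    rw [lintegral_eq_zero_iff (by fun_prop)] at hU0 ⊢
    filter_upwards [hU0] with x hx
    simpa [hα1, hα1.not_gt] using hx
  have hball (R : ℝ) (hR : 0 < R) := add_le_add (setLIntegral_Ioo_le hα hR hg)
    (setLIntegral_compl_Ioo_le hR (g := g))
  simp only [lintegral_add_compl _ measurableSet_Ioo] at hball
  generalize (∫⁻ x, ENNReal.ofReal (x ^ 2) * g x) = U at *
  generalize (∫⁻ x, ENNReal.ofReal (x ^ 2) * g x ^ (α + 1)) = K at *
  have hu := ENNReal.toReal_pos hU0 hUtop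
  have hk := ENNReal.toReal_pos hK0 hKtop
  obtain ⟨R, hR, hle⟩ := exists_radius_bound hα hc hd (one_le_cConst_mul_dConst_cube hα) hu hk
  have hM := hball R hR
  rw [← ENNReal.ofReal_toReal hUtop, ← ENNReal.ofReal_toReal hKtop] at hM ⊢
  generalize U.toReal = u at *
  generalize K.toReal = k at *
  have h3 : 0 < 3 * α / 2 := by positivity
  rw [ENNReal.ofReal_rpow_of_pos hk, ENNReal.ofReal_rpow_of_nonneg (by positivity) (by positivity),
    ← ENNReal.ofReal_mul (by positivity), ← ENNReal.ofReal_mul hu.le,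
    ← ENNReal.ofReal_add (by positivity) (by positivity)] at hM
  refine (ENNReal.rpow_le_rpow (hM.trans (ENNReal.ofReal_le_ofReal hle)) h3.le).trans_eq ?_
  rw [ENNReal.ofReal_rpow_of_pos (by positivity), ENNReal.ofReal_rpow_of_pos (by positivity),
    ENNReal.ofReal_rpow_of_pos hu, ← ENNReal.ofReal_mul (by positivity),
    ← ENNReal.ofReal_mul hk.le, mul_rpow (by positivity) (by positivity),
    mul_rpow (by positivity) (by positivity), ← rpow_mul hu.le, ← rpow_mul hk.le]
  have e1 : (α - 2) / (3 * α) * (3 * α / 2) = (α - 2) / 2 := by field_simp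
  have e2 : 2 / (3 * α) * (3 * α / 2) = 1 := by field_simp
  rw [e1, e2, rpow_one]
  congr 1
  ring

/-- Weighted interpolation inequality: for `α > 2`, `η ≥ 0` and a
nonnegative measurable `f` with `U = ∫ |x-x_*|^{2η+2} f > 0`, one has
`∫ (x-x_*)² |x-x_*|^{2η(α+1)} f^{α+1}
  ≥ (∫ |x-x_*|^{2η} f)^{3α/2} / ((c_α d_α + d_α^{-2})^{3α/2} U^{(α-2)/2})`.
Integrals are Lebesgue integrals, hence `∫⁻`. -/
theorem weighted_interpolation_lower_bound (α η xstar : ℝ) (hα : 2 < α) (hη : 0 ≤ η)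
    (f : ℝ → ℝ) (hf_meas : Measurable f) (hf_nonneg : ∀ x, 0 ≤ f x)
    (U : ENNReal)
    (hU : U = ∫⁻ x, ENNReal.ofReal (|x - xstar| ^ (2 * η + 2) * f x))
    (hUpos : 0 < U) :
    (∫⁻ x, ENNReal.ofReal (|x - xstar| ^ (2 * η) * f x)) ^ (3 * α / 2) /
        (ENNReal.ofReal (cConst α * dConst α + dConst α ^ (-2 : ℝ)) ^ (3 * α / 2) *
          U ^ ((α - 2) / 2)) ≤
      ∫⁻ x, ENNReal.ofReal ((x - xstar) ^ 2 * |x - xstar| ^ (2 * η * (α + 1)) * f x ^ (α + 1)) := by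
  set g : ℝ → ENNReal := fun y => ENNReal.ofReal (|y| ^ (2 * η) * f (y + xstar)) with hg
  have hg_meas : Measurable g := by fun_prop
  have hα1 : 0 ≤ α + 1 := by linarith
  have hM : ∫⁻ x, ENNReal.ofReal (|x - xstar| ^ (2 * η) * f x) = ∫⁻ y, g y := by
    rw [← lintegral_sub_right_eq_self g xstar]
    simp [hg]
  have hU' : U = ∫⁻ y, ENNReal.ofReal (y ^ 2) * g y := by
    rw [hU, ← lintegral_sub_right_eq_self (fun y => ENNReal.ofReal (y ^ 2) * g y) xstar]
    refine lintegral_congr fun x => ?_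
    simp only [hg, sub_add_cancel]
    rw [← ENNReal.ofReal_mul (sq_nonneg _),
      rpow_add_of_nonneg (abs_nonneg _) (by positivity) zero_le_two, rpow_two, sq_abs]
    congr 1
    ring
  have hK : ∫⁻ x, ENNReal.ofReal
      ((x - xstar) ^ 2 * |x - xstar| ^ (2 * η * (α + 1)) * f x ^ (α + 1)) =
        ∫⁻ y, ENNReal.ofReal (y ^ 2) * g y ^ (α + 1) := by
    rw [← lintegral_sub_right_eq_self (fun y => ENNReal.ofReal (y ^ 2) * g y ^ (α + 1)) xstar]
    refine lintegral_congr fun x => ?_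
    have hfx := hf_nonneg x
    simp only [hg, sub_add_cancel]
    rw [ENNReal.ofReal_rpow_of_nonneg (by positivity) hα1, ← ENNReal.ofReal_mul (sq_nonneg _),
      mul_rpow (by positivity) hfx, ← rpow_mul (abs_nonneg _), mul_assoc]
  rw [hM, hK]
  have hC : 0 < cConst α * dConst α + dConst α ^ (-2 : ℝ) :=
    add_pos (mul_pos (cConst_pos hα) (dConst_pos hα)) (rpow_pos_of_pos (dConst_pos hα) _)
  rcases eq_or_ne U ⊤ with hUtop | hUtop
  · have hC' : ENNReal.ofReal (cConst α * dConst α + dConst α ^ (-2 : ℝ)) ^ (3 * α / 2) ≠ 0 :=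
      (ENNReal.rpow_pos (ENNReal.ofReal_pos.2 hC) ENNReal.ofReal_ne_top).ne'
    rw [hUtop, ENNReal.top_rpow_of_pos (by linarith), ENNReal.mul_top hC', ENNReal.div_top]
    exact zero_le
  rcases eq_or_ne (∫⁻ y, ENNReal.ofReal (y ^ 2) * g y ^ (α + 1)) ⊤ with hKtop | hKtop
  · exact hKtop ▸ le_top
  subst hU'
  exact ENNReal.div_le_of_le_mul
    (lintegral_rpow_le_of_second_moment hα hg_meas hUpos.ne' hUtop hKtop)
end

section
/- Let α > 2, x_* ∈ ℝ, and let f : ℝ → ℝ be a nonnegative measurable function with ρ := ∫_ℝ f(x) dx, V := ∫_ℝ (x − x_*)² f(x) dx and A := ∫_ℝ (x − x_*)² f(x)^{α+1} dx. Then for every R > 0, ρ ≤ c_α^{α/(α+1)} · R^{(α−2)/(α+1)} · A^{1/(α+1)} + R^{−2} V, where c_α := 2α/(α−2). -/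
open MeasureTheory Real

theorem lintegral_Ioc_rpow {r R : ℝ} (hr : -1 < r) (hR : 0 ≤ R) :
    ∫⁻ x in Set.Ioc 0 R, ENNReal.ofReal (x ^ r) = ENNReal.ofReal (R ^ (r + 1) / (r + 1)) := by
  have hint : IntegrableOn (fun x : ℝ => x ^ r) (Set.Ioc 0 R) :=
    (intervalIntegrable_iff_integrableOn_Ioc_of_le hR).1
      (intervalIntegral.intervalIntegrable_rpow' hr)
  rw [← ofReal_integral_eq_lintegral_ofReal hint, ← intervalIntegral.integral_of_le hR,
    integral_rpow (Or.inl hr), zero_rpow (by linarith), sub_zero]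
  filter_upwards [ae_restrict_mem measurableSet_Ioc] with x hx
  exact rpow_nonneg hx.1.le r

theorem lintegral_ball_abs_sub_rpow_le {r R : ℝ} (a : ℝ) (hr : -1 < r) (hR : 0 ≤ R) :
    ∫⁻ x in Metric.ball a R, ENNReal.ofReal (|x - a| ^ r) ≤
      ENNReal.ofReal (2 * (R ^ (r + 1) / (r + 1))) := by
  set g : ℝ → ENNReal := (Set.Ioc 0 R).indicator fun x => ENNReal.ofReal (x ^ r)
  have hg_mem {y : ℝ} (hy : 0 < y) (hyR : y ≤ R) : g y = ENNReal.ofReal (y ^ r) :=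
    Set.indicator_of_mem (Set.mem_Ioc.2 ⟨hy, hyR⟩) _
  have hg : ∫⁻ x, g x = ENNReal.ofReal (R ^ (r + 1) / (r + 1)) := by
    rw [lintegral_indicator measurableSet_Ioc, lintegral_Ioc_rpow hr hR]
  have hgm : Measurable g := (by fun_prop : Measurable fun x : ℝ =>
    ENNReal.ofReal (x ^ r)).indicator measurableSet_Ioc
  calc ∫⁻ x in Metric.ball a R, ENNReal.ofReal (|x - a| ^ r)
      = ∫⁻ x, (Metric.ball a R).indicator (fun x => ENNReal.ofReal (|x - a| ^ r)) x :=
        (lintegral_indicator Metric.isOpen_ball.measurableSet _).symm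
    _ ≤ ∫⁻ x, (g (x - a) + g (a - x)) := by
        refine lintegral_mono_ae ?_
        filter_upwards [Measure.ae_ne volume a] with x hxa
        refine Set.indicator_apply_le' (fun hx => ?_) fun _ => zero_le
        rw [Metric.mem_ball, Real.dist_eq] at hx
        rcases lt_or_gt_of_ne hxa with h | h
        · rw [abs_of_neg (sub_neg.2 h), neg_sub] at hx ⊢
          refine le_add_of_nonneg_of_le zero_le ?_
          exact (hg_mem (sub_pos.2 h) hx.le).ge
        · rw [abs_of_pos (sub_pos.2 h)] at hx ⊢
          refine le_add_of_le_of_nonneg ?_ zero_le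
          exact (hg_mem (sub_pos.2 h) hx.le).ge
    _ = ENNReal.ofReal (2 * (R ^ (r + 1) / (r + 1))) := by
        rw [lintegral_add_left (by fun_prop),
          lintegral_sub_right_eq_self g, lintegral_sub_left_eq_self g, hg, ← two_mul,
          ENNReal.ofReal_mul zero_le_two, ENNReal.ofReal_ofNat]

/-- Chebyshev's estimate for the mass of `f` outside a ball. -/
theorem setLIntegral_compl_ball_le {f : ℝ → ℝ} (a : ℝ) {R : ℝ} (hR : 0 < R)
    (hf_nonneg : ∀ x, 0 ≤ f x) :
    ∫⁻ x in (Metric.ball a R)ᶜ, ENNReal.ofReal (f x) ≤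
      ENNReal.ofReal (R ^ (-2 : ℝ)) * ∫⁻ x, ENNReal.ofReal ((x - a) ^ 2 * f x) := by
  rw [← lintegral_const_mul' _ _ ENNReal.ofReal_ne_top]
  refine (setLIntegral_mono' Metric.isOpen_ball.measurableSet.compl fun x hx => ?_).trans
    (setLIntegral_le_lintegral _ _)
  rw [Set.mem_compl_iff, Metric.mem_ball, Real.dist_eq, not_lt] at hx
  rw [← ENNReal.ofReal_mul (rpow_nonneg hR.le _)]
  refine ENNReal.ofReal_le_ofReal ?_
  rw [rpow_neg hR.le, rpow_two, ← mul_assoc]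
  refine le_mul_of_one_le_left (hf_nonneg x) ?_
  rw [inv_mul_eq_div, one_le_div (by positivity), ← sq_abs (x - a)]
  gcongr

/-- Hölder's inequality with the weight `|x - a| ^ (2 / (α + 1))` on a ball. -/
theorem setLIntegral_ball_le {α : ℝ} (a : ℝ) (hα : 2 < α) {f : ℝ → ℝ}
    (hf_meas : Measurable f) (hf_nonneg : ∀ x, 0 ≤ f x) {R : ℝ} (hR : 0 < R) :
    ∫⁻ x in Metric.ball a R, ENNReal.ofReal (f x) ≤
      ENNReal.ofReal ((2 * α / (α - 2)) ^ (α / (α + 1))) *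
        ENNReal.ofReal (R ^ ((α - 2) / (α + 1))) *
        (∫⁻ x, ENNReal.ofReal ((x - a) ^ 2 * f x ^ (α + 1))) ^ (1 / (α + 1)) := by
  have hα0 : 0 < α := by linarith
  have hα2 : 0 < α - 2 := by linarith
  have hp : 0 < α + 1 := by linarith
  have hq : 0 < (α + 1) / α := by positivity
  have hpq : ((α + 1) / α).HolderConjugate (α + 1) := by
    rw [Real.holderConjugate_iff, one_lt_div hα0]
    exact ⟨by linarith, by field_simp⟩
  set u : ℝ → ENNReal := fun x => ENNReal.ofReal (|x - a| ^ (-(2 / (α + 1))))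
  set v : ℝ → ENNReal := fun x => ENNReal.ofReal (|x - a| ^ (2 / (α + 1)) * f x)
  have hu_pow (x : ℝ) : u x ^ ((α + 1) / α) = ENNReal.ofReal (|x - a| ^ (-(2 / α))) := by
    rw [ENNReal.ofReal_rpow_of_nonneg (by positivity) hq.le, ← rpow_mul (abs_nonneg _)]
    congr 2
    field_simp
  have hv_pow (x : ℝ) : v x ^ (α + 1) = ENNReal.ofReal ((x - a) ^ 2 * f x ^ (α + 1)) := by
    have hfx := hf_nonneg x
    rw [ENNReal.ofReal_rpow_of_nonneg (by positivity) hp.le, mul_rpow (by positivity) hfx,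
      ← rpow_mul (abs_nonneg _), div_mul_cancel₀ _ hp.ne', rpow_two, sq_abs]
  have hu_int : ∫⁻ x in Metric.ball a R, u x ^ ((α + 1) / α) ≤
      ENNReal.ofReal (2 * α / (α - 2) * R ^ ((α - 2) / α)) := by
    simp_rw [hu_pow]
    refine (lintegral_ball_abs_sub_rpow_le a ?_ hR.le).trans_eq ?_
    · rw [neg_lt_neg_iff, div_lt_one hα0]
      exact hα
    · have h : -(2 / α) + 1 = (α - 2) / α := by field_simp; ring
      rw [h]
      congr 1
      field_simp
  have huv : (fun x => ENNReal.ofReal (f x)) =ᵐ[volume.restrict (Metric.ball a R)] u * v := by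
    filter_upwards [ae_restrict_of_ae (Measure.ae_ne volume a)] with x hx
    have hxa : 0 < |x - a| := abs_pos.2 (sub_ne_zero.2 hx)
    rw [Pi.mul_apply, ← ENNReal.ofReal_mul (by positivity), ← mul_assoc, ← rpow_add hxa,
      neg_add_cancel, rpow_zero, one_mul]
  rw [lintegral_congr_ae huv]
  refine (ENNReal.lintegral_mul_le_Lp_mul_Lq _ hpq (by fun_prop) (by fun_prop)).trans ?_
  simp_rw [hv_pow]
  gcongr
  · refine (ENNReal.rpow_le_rpow hu_int (by positivity)).trans_eq ?_
    rw [ENNReal.ofReal_rpow_of_nonneg (by positivity) (by positivity),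
      mul_rpow (by positivity) (by positivity), ENNReal.ofReal_mul (by positivity),
      ← rpow_mul hR.le, one_div_div]
    congr 3
    field_simp
  · exact Measure.restrict_le_self

/-- For `α > 2` and a nonnegative measurable `f` with mass
`ρ = ∫ f`, second moment `V = ∫ (x-x_*)² f` and `A = ∫ (x-x_*)² f^{α+1}`,
for every `R > 0` splitting the mass into `{|x-x_*| < R}` (Hölder with singular weight)
and its complement (Chebyshev) gives
`ρ ≤ c_α^{α/(α+1)} R^{(α-2)/(α+1)} A^{1/(α+1)} + R^{-2} V`, with `c_α = 2α/(α-2)`.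
Integrals are Lebesgue integrals, hence `∫⁻`. -/
theorem mass_splitting_singular (α xstar : ℝ) (hα : 2 < α)
    (f : ℝ → ℝ) (hf_meas : Measurable f) (hf_nonneg : ∀ x, 0 ≤ f x)
    (ρ V A : ENNReal)
    (hρ : ρ = ∫⁻ x, ENNReal.ofReal (f x))
    (hV : V = ∫⁻ x, ENNReal.ofReal ((x - xstar) ^ 2 * f x))
    (hA : A = ∫⁻ x, ENNReal.ofReal ((x - xstar) ^ 2 * f x ^ (α + 1))) :
    ∀ R : ℝ, 0 < R →
      ρ ≤ ENNReal.ofReal ((2 * α / (α - 2)) ^ (α / (α + 1))) *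
            ENNReal.ofReal (R ^ ((α - 2) / (α + 1))) * A ^ (1 / (α + 1)) +
          ENNReal.ofReal (R ^ (-2 : ℝ)) * V := by
  intro R hR
  rw [hρ, hV, hA, ← lintegral_add_compl _ (Metric.isOpen_ball (x := xstar) (ε := R)).measurableSet]
  exact add_le_add (setLIntegral_ball_le xstar hα hf_meas hf_nonneg hR)
    (setLIntegral_compl_ball_le xstar hR hf_nonneg)
end

section
/- Let α > 2, Θ > 0, Ξ ≥ 0 and T > 0, and let U : [0,T] → (0,∞) be a differentiable function satisfying Ξ · U(0)^{(α−2)/2} < Θ and U′(t) ≤ −Θ · U(t)^{−(α−2)/2} + Ξ for all t ∈ [0,T]. Then U(t)^{α/2} ≤ U(0)^{α/2} − (α/2) · (Θ − Ξ · U(0)^{(α−2)/2}) · t for all t ∈ [0,T]; in particular, since U is strictly positive on [0,T], necessarily T < t* := 2 U(0)^{α/2} / ( α (Θ − Ξ U(0)^{(α−2)/2}) ). -/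
open Set

/-- ODE comparison lemma for the weighted energy functional: if
`α > 2`, `Θ > 0`, `Ξ ≥ 0`, `T > 0` and `U : [0,T] → (0,∞)` is differentiable with
`Ξ U(0)^{(α-2)/2} < Θ` and `U'(t) ≤ -Θ U(t)^{-(α-2)/2} + Ξ` on `[0,T]`, then
`U(t)^{α/2} ≤ U(0)^{α/2} - (α/2)(Θ - Ξ U(0)^{(α-2)/2}) t` on `[0,T]`, and in particular
`T < t* = 2 U(0)^{α/2} / (α (Θ - Ξ U(0)^{(α-2)/2}))`. -/
theorem ode_comparison_finite_time (α Θ Ξ T : ℝ) (hα : 2 < α) (hΘ : 0 < Θ) (hΞ : 0 ≤ Ξ)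
    (hT : 0 < T) (U : ℝ → ℝ)
    (hU_pos : ∀ t ∈ Icc (0 : ℝ) T, 0 < U t)
    (hU_diff : ∀ t ∈ Icc (0 : ℝ) T, DifferentiableWithinAt ℝ U (Icc 0 T) t)
    (hinit : Ξ * U 0 ^ ((α - 2) / 2) < Θ)
    (hode : ∀ t ∈ Icc (0 : ℝ) T,
      derivWithin U (Icc 0 T) t ≤ -Θ * U t ^ (-((α - 2) / 2)) + Ξ) :
    (∀ t ∈ Icc (0 : ℝ) T,
        U t ^ (α / 2) ≤ U 0 ^ (α / 2) - α / 2 * (Θ - Ξ * U 0 ^ ((α - 2) / 2)) * t) ∧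
      T < 2 * U 0 ^ (α / 2) / (α * (Θ - Ξ * U 0 ^ ((α - 2) / 2))) := by
  set p := (α - 2) / 2 with hp
  have hp0 : 0 ≤ p := by linarith
  have h0 : (0 : ℝ) ∈ Icc 0 T := left_mem_Icc.2 hT.le
  have hU_cont : ContinuousOn U (Icc 0 T) := fun t ht => (hU_diff t ht).continuousWithinAt
  have hU_deriv : ∀ t ∈ Ico (0 : ℝ) T,
      HasDerivWithinAt U (derivWithin U (Icc 0 T) t) (Ici t) t := fun t ht =>
    (hU_diff t (Ico_subset_Icc_self ht)).hasDerivWithinAt.mono_of_mem_nhdsWithin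
      (Icc_mem_nhdsGE_of_mem ht)
  have hcancel : ∀ t ∈ Icc (0 : ℝ) T, U t ^ (-p) * U t ^ p = 1 := fun t ht => by
    rw [← Real.rpow_add (hU_pos t ht), neg_add_cancel, Real.rpow_zero]
  have hle : ∀ ⦃t⦄, t ∈ Icc (0 : ℝ) T → U t ≤ U 0 := by
    refine image_le_of_deriv_right_lt_deriv_boundary' (B := fun _ => U 0) (B' := fun _ => 0)
      hU_cont hU_deriv le_rfl continuousOn_const (fun t _ => hasDerivWithinAt_const _ _ _) ?_
    intro t ht heq
    have hode_t := hode t (Ico_subset_Icc_self ht)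
    rw [heq] at hode_t
    have hneg_pos : 0 < U 0 ^ (-p) := Real.rpow_pos_of_pos (hU_pos 0 h0) _
    have hmul := mul_lt_mul_of_pos_right hinit hneg_pos
    rw [mul_assoc, mul_comm (U 0 ^ p), hcancel 0 h0] at hmul
    linarith
  have hmain : ∀ ⦃t⦄, t ∈ Icc (0 : ℝ) T →
      U t ^ (α / 2) ≤ U 0 ^ (α / 2) - α / 2 * (Θ - Ξ * U 0 ^ p) * t := by
    refine image_le_of_deriv_right_le_deriv_boundary
      (f := fun t => U t ^ (α / 2))
      (f' := fun t => derivWithin U (Icc 0 T) t * (α / 2) * U t ^ (α / 2 - 1))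
      (B' := fun _ => -(α / 2 * (Θ - Ξ * U 0 ^ p)))
      (hU_cont.rpow_const fun t ht => Or.inl (hU_pos t ht).ne')
      (fun t ht => (hU_deriv t ht).rpow_const
        (Or.inl (hU_pos t (Ico_subset_Icc_self ht)).ne'))
      (by simp) (by fun_prop) (fun t _ => ?_) ?_
    · simpa using ((hasDerivWithinAt_id t (Ici t)).const_mul
        (α / 2 * (Θ - Ξ * U 0 ^ p))).const_sub (U 0 ^ (α / 2))
    · intro t ht
      have ht' := Ico_subset_Icc_self ht
      have hpow_pos : 0 < U t ^ p := Real.rpow_pos_of_pos (hU_pos t ht') _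
      have hpow_le : U t ^ p ≤ U 0 ^ p :=
        Real.rpow_le_rpow (hU_pos t ht').le (hle ht') hp0
      have hexp : α / 2 - 1 = p := by rw [hp]; ring
      have hrate : derivWithin U (Icc 0 T) t * U t ^ p ≤ -(Θ - Ξ * U 0 ^ p) := by
        calc derivWithin U (Icc 0 T) t * U t ^ p
            ≤ (-Θ * U t ^ (-p) + Ξ) * U t ^ p :=
              mul_le_mul_of_nonneg_right (hode t ht') hpow_pos.le
          _ = -Θ + Ξ * U t ^ p := by linear_combination -Θ * hcancel t ht'
          _ ≤ -(Θ - Ξ * U 0 ^ p) := by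
              linarith [mul_le_mul_of_nonneg_left hpow_le hΞ]
      simp only [hexp]
      linarith [mul_le_mul_of_nonneg_left hrate (by linarith : 0 ≤ α / 2)]
  refine ⟨hmain, ?_⟩
  have hT_mem : T ∈ Icc (0 : ℝ) T := right_mem_Icc.2 hT.le
  have hpos : 0 < U T ^ (α / 2) := Real.rpow_pos_of_pos (hU_pos T hT_mem) _
  rw [lt_div_iff₀ (mul_pos (by linarith) (sub_pos.2 hinit))]
  linarith [hmain hT_mem]
end

section
/- Let λ, σ, β > 0, α > 0, η ∈ (0, 1/2), x_* ∈ ℝ and C > 0 with β C^α < 1. Define Φ(x) := (2λ/σ²) · |x − x_*|^{2(1−η)} / (1−η) and g_∞(x) := C e^{−Φ(x)} · (1 − β C^α e^{−α Φ(x)})^{−1/α}, which is well defined since β C^α e^{−α Φ(x)} ≤ β C^α < 1 for all x. Then g_∞ is differentiable on ℝ \ {x_*} and satisfies, for every x ≠ x_*, the stationary equation g_∞′(x) = −(4λ/σ²) · (x − x_*) · |x − x_*|^{−2η} · g_∞(x) · (1 + β g_∞(x)^α). -/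
open Real

/-- `Φ(x) = (2λ/σ²) |x - x_*|^{2(1-η)} / (1-η)`. -/
noncomputable def Phi (lam σ η xstar x : ℝ) : ℝ :=
  2 * lam / σ ^ 2 * |x - xstar| ^ (2 * (1 - η)) / (1 - η)

/-- The weighted steady state `g_∞(x) = C e^{-Φ(x)} (1 - β C^α e^{-α Φ(x)})^{-1/α}`. -/
noncomputable def gInf (lam σ β α η xstar C x : ℝ) : ℝ :=
  C * Real.exp (-Phi lam σ η xstar x) *
    (1 - β * C ^ α * Real.exp (-(α * Phi lam σ η xstar x))) ^ (-(1 / α))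

/-- For `y ≠ 0`, the derivative of `|y| ^ p` is `p * y * |y| ^ (p - 2)`. -/
theorem hasDerivAt_abs_rpow_of_ne {y : ℝ} (hy : y ≠ 0) (p : ℝ) :
    HasDerivAt (fun z : ℝ => |z| ^ p) (p * y * |y| ^ (p - 2)) y := by
  have hpos : 0 < |y| := abs_pos.mpr hy
  convert (hasDerivAt_abs hy).rpow_const (p := p) (Or.inl hpos.ne') using 1
  have hsign : (SignType.sign y : ℝ) * |y| = y := sign_mul_abs y
  have hpow : |y| ^ (p - 1) = |y| * |y| ^ (p - 2) := by
    rw [show p - 1 = 1 + (p - 2) by ring, Real.rpow_add hpos, Real.rpow_one]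
  rw [hpow]
  linear_combination (-(p * |y| ^ (p - 2))) * hsign

theorem hasDerivAt_Phi (lam σ η xstar : ℝ) (hη : η ≠ 1) {x : ℝ} (hx : x ≠ xstar) :
    HasDerivAt (Phi lam σ η xstar)
      (4 * lam / σ ^ 2 * (x - xstar) * |x - xstar| ^ (-(2 * η))) x := by
  have h := (((hasDerivAt_abs_rpow_of_ne (sub_ne_zero.mpr hx) (2 * (1 - η))).comp_sub_const
    x xstar).const_mul (2 * lam / σ ^ 2)).div_const (1 - η)
  have hη' : 1 - η ≠ 0 := sub_ne_zero.mpr hη.symm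
  refine h.congr_deriv ?_
  rw [show 2 * (1 - η) - 2 = -(2 * η) by ring]
  field_simp
  ring

theorem Phi_nonneg {lam η : ℝ} (hlam : 0 ≤ lam) (hη : η ≤ 1) (σ xstar x : ℝ) :
    0 ≤ Phi lam σ η xstar x := by
  have : 0 ≤ 1 - η := sub_nonneg.mpr hη
  unfold Phi
  positivity

theorem one_sub_mul_exp_pos {b t : ℝ} (hb : 0 ≤ b) (hb' : b < 1) (ht : 0 ≤ t) :
    0 < 1 - b * Real.exp (-t) := by
  have h : Real.exp (-t) ≤ 1 := Real.exp_le_one_iff.mpr (neg_nonpos.mpr ht)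
  linarith [mul_le_of_le_one_right hb h]

theorem gInf_rpow {lam σ β α η xstar C x : ℝ} (hα : α ≠ 0) (hC : 0 ≤ C)
    (hD : 0 < 1 - β * C ^ α * Real.exp (-(α * Phi lam σ η xstar x))) :
    gInf lam σ β α η xstar C x ^ α =
      C ^ α * Real.exp (-(α * Phi lam σ η xstar x)) /
        (1 - β * C ^ α * Real.exp (-(α * Phi lam σ η xstar x))) := by
  unfold gInf
  rw [Real.mul_rpow (by positivity) (Real.rpow_nonneg hD.le _),
    Real.mul_rpow hC (Real.exp_pos _).le, ← Real.exp_mul, ← Real.rpow_mul hD.le,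
    show -(1 / α) * α = -1 by field_simp, Real.rpow_neg_one, div_eq_mul_inv,
    show -Phi lam σ η xstar x * α = -(α * Phi lam σ η xstar x) by ring]

/-- For `λ, σ, β > 0`, `α > 0`, `η ∈ (0,1/2)`, `C > 0` with `β C^α < 1`,
the function `g_∞` is differentiable away from `x_*` and satisfies the stationary equation
`g_∞'(x) = -(4λ/σ²) (x - x_*) |x - x_*|^{-2η} g_∞(x) (1 + β g_∞(x)^α)`. -/
theorem steady_state_equation (lam σ β α η xstar C : ℝ) (hlam : 0 < lam) (hσ : 0 < σ)
    (hβ : 0 < β) (hα : 0 < α) (hη0 : 0 < η) (hη : η < 1 / 2) (hC : 0 < C)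
    (hsub : β * C ^ α < 1) :
    ∀ x : ℝ, x ≠ xstar →
      HasDerivAt (gInf lam σ β α η xstar C)
        (-(4 * lam / σ ^ 2) * (x - xstar) * |x - xstar| ^ (-(2 * η)) *
          gInf lam σ β α η xstar C x * (1 + β * gInf lam σ β α η xstar C x ^ α)) x := by
  intro x hx
  have hΦ := hasDerivAt_Phi lam σ η xstar (by linarith) hx
  have hD := one_sub_mul_exp_pos (by positivity) hsub
    (mul_nonneg hα.le (Phi_nonneg hlam.le (by linarith) σ xstar x : 0 ≤ Phi lam σ η xstar x))
  have hg := (hΦ.fun_neg.exp.const_mul C).mul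
    ((((hΦ.const_mul α).fun_neg.exp.const_mul (β * C ^ α)).const_sub 1).rpow_const
      (p := -(1 / α)) (Or.inl hD.ne'))
  refine hg.congr_deriv ?_
  rw [gInf_rpow hα.ne' hC.le hD, gInf, Real.rpow_sub_one hD.ne']
  field_simp
  ring
end

section
/- Let λ, σ, β > 0, α > 0, η ∈ (0, 1/2) and x_* ∈ ℝ. Define Φ(x) := (2λ/σ²) · |x − x_*|^{2(1−η)} / (1−η), the critical constant C_M := β^{−1/α}, and the critical steady state f_{∞,C_M}(x) := |x − x_*|^{−2η} · C_M e^{−Φ(x)} · (1 − e^{−α Φ(x)})^{−1/α} for x ≠ x_*. Then lim_{x → x_*} |x − x_*|^{2η + 2(1−η)/α} · f_{∞,C_M}(x) = β^{−1/α} · ( σ² (1−η) / (2λα) )^{1/α}; that is, f_{∞,C_M} diverges at x_* with exact algebraic order 2η + 2(1−η)/α. -/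
open Real Filter Topology

/-- The critical steady state
`f_{∞,C_M}(x) = |x - x_*|^{-2η} β^{-1/α} e^{-Φ(x)} (1 - e^{-α Φ(x)})^{-1/α}`,
corresponding to the maximal admissible constant `C_M = β^{-1/α}`. -/
noncomputable def fInfCrit (lam σ β α η xstar x : ℝ) : ℝ :=
  |x - xstar| ^ (-(2 * η)) * (β ^ (-(1 / α)) * Real.exp (-Phi lam σ η xstar x) *
    (1 - Real.exp (-(α * Phi lam σ η xstar x))) ^ (-(1 / α)))

/-- `(1 - e^{-t}) / t → 1` as `t → 0`, `t ≠ 0`. -/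
theorem tendsto_one_sub_exp_neg_div :
    Tendsto (fun t : ℝ => (1 - Real.exp (-t)) / t) (𝓝[≠] 0) (𝓝 1) := by
  have h : HasDerivAt (fun t : ℝ => 1 - Real.exp (-t)) 1 0 := by
    simpa using ((hasDerivAt_id (0 : ℝ)).neg.exp).const_sub 1
  refine (hasDerivAt_iff_tendsto_slope.1 h).congr fun t => ?_
  simp [slope_def_field]

/-- The critical steady state diverges at `x_*` with exact algebraic
order `2η + 2(1-η)/α`:
`lim_{x → x_*} |x - x_*|^{2η + 2(1-η)/α} f_{∞,C_M}(x) = β^{-1/α} (σ²(1-η)/(2λα))^{1/α}`. -/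
theorem critical_steady_state_blowup_order (lam σ β α η xstar : ℝ) (hlam : 0 < lam)
    (hσ : 0 < σ) (hβ : 0 < β) (hα : 0 < α) (hη0 : 0 < η) (hη : η < 1 / 2) :
    Tendsto (fun x => |x - xstar| ^ (2 * η + 2 * (1 - η) / α) * fInfCrit lam σ β α η xstar x)
      (𝓝[≠] xstar)
      (𝓝 (β ^ (-(1 / α)) * (σ ^ 2 * (1 - η) / (2 * lam * α)) ^ (1 / α))) := by
  have hη1 : 0 < 1 - η := by linarith
  have hk : 0 < 2 * (1 - η) := by linarith
  have hA : 0 < 2 * lam * α / (σ ^ 2 * (1 - η)) := by positivity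
  have hΦ : Tendsto (Phi lam σ η xstar) (𝓝[≠] xstar) (𝓝 0) := by
    have hcont : Continuous (Phi lam σ η xstar) := by
      unfold Phi
      exact (continuous_const.mul ((continuous_id.sub continuous_const).abs.rpow_const
        fun _ => Or.inr hk.le)).div_const _
    have h0 : Phi lam σ η xstar xstar = 0 := by
      simp [Phi, Real.zero_rpow hk.ne']
    simpa only [h0] using (hcont.tendsto xstar).mono_left nhdsWithin_le_nhds
  have hΦpos : ∀ x, x ≠ xstar → 0 < Phi lam σ η xstar x := by
    intro x hx
    have : 0 < |x - xstar| := abs_pos.2 (sub_ne_zero.2 hx)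
    unfold Phi
    positivity
  have ht : Tendsto (fun x => α * Phi lam σ η xstar x) (𝓝[≠] xstar) (𝓝[≠] 0) := by
    refine tendsto_nhdsWithin_iff.2 ⟨by simpa using hΦ.const_mul α, ?_⟩
    filter_upwards [self_mem_nhdsWithin] with x hx
    exact (mul_pos hα (hΦpos x hx)).ne'
  have hratio := (tendsto_one_sub_exp_neg_div.comp ht).const_mul
    (2 * lam * α / (σ ^ 2 * (1 - η)))
  rw [mul_one] at hratio
  have hpow := hratio.rpow_const (p := -(1 / α)) (Or.inl hA.ne')
  have hexp : Tendsto (fun x => Real.exp (-Phi lam σ η xstar x)) (𝓝[≠] xstar) (𝓝 1) := by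
    simpa using hΦ.neg.rexp
  have hlim := (hexp.const_mul (β ^ (-(1 / α)))).mul hpow
  rw [mul_one, Real.rpow_neg hA.le, ← Real.inv_rpow hA.le, inv_div] at hlim
  refine hlim.congr' ?_
  filter_upwards [self_mem_nhdsWithin] with x hx
  have hr : 0 < |x - xstar| := abs_pos.2 (sub_ne_zero.2 hx)
  have hrk : 0 < |x - xstar| ^ (2 * (1 - η)) := Real.rpow_pos_of_pos hr _
  have hE : 0 ≤ 1 - Real.exp (-(α * Phi lam σ η xstar x)) := by
    have := mul_pos hα (hΦpos x hx)
    exact sub_nonneg.2 (Real.exp_le_one_iff.2 (by linarith))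
  have hquot : 2 * lam * α / (σ ^ 2 * (1 - η)) *
      ((1 - Real.exp (-(α * Phi lam σ η xstar x))) / (α * Phi lam σ η xstar x)) =
      (1 - Real.exp (-(α * Phi lam σ η xstar x))) / |x - xstar| ^ (2 * (1 - η)) := by
    generalize 1 - Real.exp (-(α * Phi lam σ η xstar x)) = E
    unfold Phi
    field_simp
  have hcancel : |x - xstar| ^ (2 * η + 2 * (1 - η) / α) * |x - xstar| ^ (-(2 * η)) =
      ((|x - xstar| ^ (2 * (1 - η))) ^ (-(1 / α)))⁻¹ := by
    rw [← Real.rpow_add hr, ← Real.rpow_mul hr.le, ← Real.rpow_neg hr.le]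
    congr 1
    ring
  simp only [Function.comp_apply]
  rw [hquot, Real.div_rpow hE hrk.le, fInfCrit, ← mul_assoc, hcancel]
  ring
end

section
/- Let λ, σ, β > 0, η ∈ (0, 1/2), x_* ∈ ℝ, and let α > 0 satisfy 2η + 2(1−η)/α < 1 (equivalently α > 2(1−η)/(1−2η)). Define Φ(x) := (2λ/σ²) · |x − x_*|^{2(1−η)} / (1−η) and the critical steady state f_{∞,C_M}(x) := |x − x_*|^{−2η} · β^{−1/α} e^{−Φ(x)} · (1 − e^{−α Φ(x)})^{−1/α} for x ≠ x_*. Then f_{∞,C_M} is Lebesgue integrable on ℝ; i.e., the critical mass ρ_c := ∫_ℝ f_{∞,C_M}(x) dx is finite. -/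
open Real MeasureTheory

theorem mul_exp_neg_half_le_one_sub_exp_neg {t : ℝ} (ht : 0 ≤ t) :
    t * Real.exp (-(t / 2)) ≤ 1 - Real.exp (-t) := by
  have h := Real.self_le_sinh_iff.2 (div_nonneg ht zero_le_two)
  rw [Real.sinh_eq] at h
  have h₁ : Real.exp (t / 2) * Real.exp (-(t / 2)) = 1 := by
    rw [← Real.exp_add, add_neg_cancel, Real.exp_zero]
  have h₂ : Real.exp (-t) = Real.exp (-(t / 2)) * Real.exp (-(t / 2)) := by
    rw [← Real.exp_add]; ring_nf
  nlinarith [Real.exp_pos (-(t / 2))]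

theorem one_sub_exp_neg_rpow_neg_le {t a : ℝ} (ht : 0 < t) (ha : 0 ≤ a) :
    (1 - Real.exp (-t)) ^ (-a) ≤ t ^ (-a) * Real.exp (a * t / 2) := by
  calc (1 - Real.exp (-t)) ^ (-a) ≤ (t * Real.exp (-(t / 2))) ^ (-a) :=
        Real.rpow_le_rpow_of_nonpos (by positivity)
          (mul_exp_neg_half_le_one_sub_exp_neg ht.le) (neg_nonpos.2 ha)
    _ = t ^ (-a) * Real.exp (a * t / 2) := by
        rw [Real.mul_rpow ht.le (Real.exp_pos _).le, ← Real.exp_mul]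
        ring_nf

theorem measurable_fInfCrit (lam σ β α η xstar : ℝ) :
    Measurable (fInfCrit lam σ β α η xstar) := by
  unfold fInfCrit Phi
  fun_prop

theorem fInfCrit_nonneg {lam σ β α η : ℝ} (xstar x : ℝ) (hlam : 0 ≤ lam) (hβ : 0 ≤ β)
    (hα : 0 ≤ α) (hη : η ≤ 1) : 0 ≤ fInfCrit lam σ β α η xstar x := by
  have hη' : 0 ≤ 1 - η := sub_nonneg.2 hη
  have hΦ : 0 ≤ Phi lam σ η xstar x := by unfold Phi; positivity
  have : 0 ≤ 1 - Real.exp (-(α * Phi lam σ η xstar x)) :=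
    sub_nonneg.2 (Real.exp_le_one_iff.2 (neg_nonpos.2 (mul_nonneg hα hΦ)))
  unfold fInfCrit
  positivity

theorem fInfCrit_le {lam σ β α η r : ℝ} (hlam : 0 < lam) (hσ : 0 < σ) (hβ : 0 ≤ β)
    (hα : 0 < α) (hη : η < 1) (hr : 0 < r) :
    fInfCrit lam σ β α η 0 r ≤
      β ^ (-(1 / α)) * (α * (2 * lam / σ ^ 2 / (1 - η))) ^ (-(1 / α)) *
        (r ^ (-(2 * η + 2 * (1 - η) / α)) *
          Real.exp (-(2 * lam / σ ^ 2 / (1 - η) / 2) * r ^ (2 * (1 - η)))) := by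
  have hη' : 0 < 1 - η := sub_pos.2 hη
  set c := 2 * lam / σ ^ 2 / (1 - η) with hc
  have hc0 : 0 < c := by positivity
  have hΦ : Phi lam σ η 0 r = c * r ^ (2 * (1 - η)) := by
    rw [Phi, sub_zero, abs_of_pos hr, hc]; ring
  have hp : 0 < r ^ (2 * (1 - η)) := Real.rpow_pos_of_pos hr _
  have key := one_sub_exp_neg_rpow_neg_le (t := α * (c * r ^ (2 * (1 - η))))
    (a := 1 / α) (by positivity) (by positivity)
  rw [fInfCrit, hΦ, sub_zero, abs_of_pos hr]
  calc _ ≤ r ^ (-(2 * η)) * (β ^ (-(1 / α)) * Real.exp (-(c * r ^ (2 * (1 - η)))) *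
        ((α * (c * r ^ (2 * (1 - η)))) ^ (-(1 / α)) *
          Real.exp (1 / α * (α * (c * r ^ (2 * (1 - η)))) / 2))) := by gcongr
    _ = _ := by
        have h₁ : (α * (c * r ^ (2 * (1 - η)))) ^ (-(1 / α)) =
            (α * c) ^ (-(1 / α)) * r ^ (-(2 * (1 - η) / α)) := by
          rw [← mul_assoc, Real.mul_rpow (by positivity) hp.le, ← Real.rpow_mul hr.le]
          ring_nf
        have h₂ : Real.exp (-(c / 2) * r ^ (2 * (1 - η))) =
            Real.exp (-(c * r ^ (2 * (1 - η)))) *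
              Real.exp (1 / α * (α * (c * r ^ (2 * (1 - η)))) / 2) := by
          rw [← Real.exp_add]
          congr 1
          field_simp
          ring
        rw [h₁, h₂, neg_add, Real.rpow_add hr]
        ring

/-- If the local blow-up order satisfies `2η + 2(1-η)/α < 1`, then the
critical steady state is Lebesgue integrable on `ℝ`; its (finite) integral defines the
critical mass `ρ_c` of the system. -/
theorem critical_steady_state_integrable (lam σ β α η xstar : ℝ) (hlam : 0 < lam)
    (hσ : 0 < σ) (hβ : 0 < β) (hα : 0 < α) (hη0 : 0 < η) (hη : η < 1 / 2)
    (hcrit : 2 * η + 2 * (1 - η) / α < 1) :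
    Integrable (fun x => fInfCrit lam σ β α η xstar x) := by
  have hη' : 0 < 1 - η := by linarith
  have hIoi : IntegrableOn (fInfCrit lam σ β α η 0) (Set.Ioi 0) := by
    refine Integrable.mono' ((integrableOn_rpow_mul_exp_neg_mul_rpow
      (s := -(2 * η + 2 * (1 - η) / α)) (p := 2 * (1 - η))
      (b := 2 * lam / σ ^ 2 / (1 - η) / 2) (by linarith) (by positivity)
      (by positivity)).const_mul
        (β ^ (-(1 / α)) * (α * (2 * lam / σ ^ 2 / (1 - η))) ^ (-(1 / α))))
      (measurable_fInfCrit lam σ β α η 0).aestronglyMeasurable ?_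
    filter_upwards [ae_restrict_mem measurableSet_Ioi] with r hr
    rw [Real.norm_of_nonneg (fInfCrit_nonneg 0 r hlam.le hβ.le hα.le (by linarith))]
    exact fInfCrit_le hlam hσ hβ.le hα (by linarith) hr
  have hnorm : Integrable (fun x : ℝ => fInfCrit lam σ β α η 0 ‖x‖) := by
    rw [integrable_fun_norm_addHaar]
    simpa using hIoi
  simpa [fInfCrit, Phi] using hnorm.comp_sub_right xstar
end
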